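/- Let n ≥ 2, s ∈ (0,1), α > 0, and let K : ℝⁿ → [0,∞) be radially symmetric with non-increasing radial profile and 0 ≤ K(x) ≤ |x|^{−(n+s)} for all x ≠ 0. Let m > 0, r₀ > 0 with |B_{r₀}| = m, and set γ = α·m^{(1−s)/n}. If F is a set of finite perimeter with |F| = m and J_α(F) ≤ J_α(B_{r₀}), then there is a constant C depending only on n such that: (i) P(F) ≤ C(1 + (nω_n γ)^{1/(1−s)})·m^{(n−1)/n}; (ii) the isoperimetric deficit D(F) = (P(F) − P(B_{r₀}))/P(B_{r₀}) satisfies D(F) ≤ C·γ·(1 + (nω_n γ)^{1/(1−s)})^s; and (iii) there exists a translate of F (still denoted F) with |F Δ B_{r₀}| ≤ C·m·√γ·(1 + (nω_n γ)^{1/(1−s)})^{s/2}. -/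

import Mathlib

open MeasureTheory Metric Set Filter
open scoped ENNReal Pointwise symmDiff Classical

noncomputable section

abbrev Euc (n : ℕ) := EuclideanSpace ℝ (Fin n)

/-- Divergence of a vector field on ℝⁿ. -/
def divg {n : ℕ} (g : Euc n → Euc n) (x : Euc n) : ℝ :=
  ∑ i : Fin n, fderiv ℝ g x (EuclideanSpace.single i 1) i

/-- The admissible values in the variational definition of the perimeter:
values `∫_E div g` over C¹ compactly supported vector fields with `‖g‖ ≤ 1`. -/
def perimVals {n : ℕ} (E : Set (Euc n)) : Set ℝ :=
  {r | ∃ g : Euc n → Euc n, ContDiff ℝ 1 g ∧ HasCompactSupport g ∧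
        (∀ x, ‖g x‖ ≤ 1) ∧ r = ∫ x in E, divg g x}

/-- Perimeter: total variation of the characteristic function. -/
def perim {n : ℕ} (E : Set (Euc n)) : ℝ := sSup (perimVals E)

/-- A set has finite perimeter if the variational quantities are bounded above. -/
def HasFinitePerim {n : ℕ} (E : Set (Euc n)) : Prop := BddAbove (perimVals E)

/-- Characteristic function of a set. -/
def chi {n : ℕ} (E : Set (Euc n)) : Euc n → ℝ := E.indicator 1

/-- Nonlocal perimeter associated with a kernel `K`. -/
def PK {n : ℕ} (K : Euc n → ℝ) (E : Set (Euc n)) : ℝ :=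
  ∫ x, ∫ y, K (x - y) * |chi E x - chi E y|

/-- Fractional `s`-perimeter. -/
def Ps (n : ℕ) (s : ℝ) (E : Set (Euc n)) : ℝ :=
  ∫ x : Euc n, ∫ y : Euc n, |chi E x - chi E y| / ‖x - y‖ ^ ((n : ℝ) + s)

/-- The energy `J_α(E) = P(E) - α s (1-s) P_K(E)`. -/
def Jen {n : ℕ} (K : Euc n → ℝ) (s α : ℝ) (E : Set (Euc n)) : ℝ :=
  perim E - α * s * (1 - s) * PK K E

/-- The energy `F_{s,α}(E) = P(E) - α s (1-s) P_s(E)`. -/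
def Fen (n : ℕ) (s α : ℝ) (E : Set (Euc n)) : ℝ :=
  perim E - α * s * (1 - s) * Ps n s E

/-- ω_n : volume of the unit ball of ℝⁿ. -/
def ballVol (n : ℕ) : ℝ := (volume (ball (0 : Euc n) 1)).toReal

/-- Volume-constrained global minimizer of `J_α` (volume `m`). -/
def IsJMin {n : ℕ} (K : Euc n → ℝ) (s α m : ℝ) (E : Set (Euc n)) : Prop :=
  MeasurableSet E ∧ HasFinitePerim E ∧ volume E = ENNReal.ofReal m ∧
    ∀ F : Set (Euc n), MeasurableSet F → HasFinitePerim F →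
      volume F = ENNReal.ofReal m → Jen K s α E ≤ Jen K s α F

/-- Volume-constrained global minimizer of `F_{s,α}` (volume `m`). -/
def IsFMin (n : ℕ) (s α m : ℝ) (E : Set (Euc n)) : Prop :=
  MeasurableSet E ∧ HasFinitePerim E ∧ volume E = ENNReal.ofReal m ∧
    ∀ F : Set (Euc n), MeasurableSet F → HasFinitePerim F →
      volume F = ENNReal.ofReal m → Fen n s α E ≤ Fen n s α F


def psi (n : ℕ) (τ : ℝ) : ℝ := τ + n * τ ^ (-(1 / (n : ℝ))) - (n + 1)

lemma psi_id (n : ℕ) (σ : ℝ) :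
    1 + n * σ ^ (n + 1) - (n + 1) * σ ^ n
      = (1 - σ) ^ 2 * ∑ k ∈ Finset.range n, ((k : ℝ) + 1) * σ ^ k := by
  induction n with
  | zero => simp
  | succ m ih =>
    rw [Finset.sum_range_succ, mul_add, ← ih]
    push_cast
    ring

lemma psi_data (n : ℕ) (hn : 1 ≤ n) (τ : ℝ) (hτ : 0 < τ) :
    ∃ σ : ℝ, 0 < σ ∧ τ * σ ^ n = 1 ∧ psi n τ = τ + n * σ - (n + 1) ∧
      τ ^ (-(1 / (n : ℝ))) = σ := by
  refine ⟨τ ^ (-(1 / (n : ℝ))), Real.rpow_pos_of_pos hτ _, ?_, rfl, rfl⟩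
  have hn0 : (n : ℝ) ≠ 0 := by positivity
  rw [← Real.rpow_natCast, ← Real.rpow_mul hτ.le]
  have : -(1 / (n : ℝ)) * n = -1 := by field_simp
  rw [this, Real.rpow_neg_one, mul_inv_cancel₀ hτ.ne']

lemma psi_eq (n : ℕ) (τ σ : ℝ) (h : τ * σ ^ n = 1) :
    τ + n * σ - (n + 1) = τ * ((1 - σ) ^ 2 * ∑ k ∈ Finset.range n, ((k : ℝ) + 1) * σ ^ k) := by
  rw [← psi_id]
  have : τ * (1 + n * σ ^ (n + 1) - (n + 1) * σ ^ n)
      = τ + n * σ * (τ * σ ^ n) - (n + 1) * (τ * σ ^ n) := by ring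
  rw [this, h]; ring

lemma psi_nonneg (n : ℕ) (hn : 1 ≤ n) (τ : ℝ) (hτ : 0 < τ) : 0 ≤ psi n τ := by
  obtain ⟨σ, hσ, h1, h2, -⟩ := psi_data n hn τ hτ
  rw [h2, psi_eq n τ σ h1]
  have : 0 ≤ ∑ k ∈ Finset.range n, ((k : ℝ) + 1) * σ ^ k :=
    Finset.sum_nonneg fun k _ => by positivity
  positivity

lemma one_sub_pow_le (n : ℕ) (σ : ℝ) (hσ : 0 < σ) (h : σ ^ n ≤ 2) :
    |1 - σ ^ n| ≤ 2 * n * |1 - σ| := by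
  have h1 : 1 - σ ^ n = (1 - σ) * ∑ k ∈ Finset.range n, σ ^ k := by
    rw [mul_neg_geom_sum]
  rw [h1, abs_mul, mul_comm]
  apply mul_le_mul_of_nonneg_right _ (abs_nonneg _)
  have : ∀ k ∈ Finset.range n, |σ ^ k| ≤ 2 := by
    intro k hk
    rw [abs_of_pos (by positivity)]
    rcases le_or_gt σ 1 with hs | hs
    · exact (pow_le_one₀ hσ.le hs).trans (by norm_num)
    · exact (pow_le_pow_right₀ hs.le (Finset.mem_range.1 hk).le).trans h
  calc |∑ k ∈ Finset.range n, σ ^ k| ≤ ∑ k ∈ Finset.range n, |σ ^ k| :=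
        Finset.abs_sum_le_sum_abs _ _
    _ ≤ ∑ k ∈ Finset.range n, (2 : ℝ) := Finset.sum_le_sum this
    _ = 2 * n := by simp; ring

lemma psi_lower1 (n : ℕ) (hn : 1 ≤ n) (τ : ℝ) (hτ : 1 / 2 ≤ τ) :
    (τ - 1) ^ 2 ≤ 4 * n ^ 2 * (τ * psi n τ) := by
  have hτ0 : 0 < τ := by linarith
  obtain ⟨σ, hσ, h1, h2, -⟩ := psi_data n hn τ hτ0
  have hσn : σ ^ n ≤ 2 := by
    by_contra hc
    push Not at hc
    nlinarith
  have h3 := one_sub_pow_le n σ hσ hσn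
  have h4 : (1 - σ ^ n) ^ 2 ≤ 4 * n ^ 2 * (1 - σ) ^ 2 := by
    rw [← sq_abs, ← sq_abs (1 - σ)]
    calc |1 - σ ^ n| ^ 2 ≤ (2 * n * |1 - σ|) ^ 2 := by gcongr
      _ = _ := by ring
  have h5 : 1 ≤ ∑ k ∈ Finset.range n, ((k : ℝ) + 1) * σ ^ k := by
    have := Finset.single_le_sum (f := fun k : ℕ => ((k : ℝ) + 1) * σ ^ k) (s := Finset.range n)
      (fun k _ => by positivity) (Finset.mem_range.2 hn)
    simpa using this
  have h6 : τ * (1 - σ) ^ 2 ≤ psi n τ := by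
    rw [h2, psi_eq n τ σ h1]
    gcongr
    nlinarith [sq_nonneg (1 - σ)]
  have h7 : (τ - 1) ^ 2 = τ ^ 2 * (1 - σ ^ n) ^ 2 := by
    have : τ - 1 = τ * (1 - σ ^ n) := by linear_combination h1
    rw [this]; ring
  rw [h7]
  calc τ ^ 2 * (1 - σ ^ n) ^ 2 ≤ τ ^ 2 * (4 * n ^ 2 * (1 - σ) ^ 2) := by gcongr
    _ = 4 * n ^ 2 * (τ * (τ * (1 - σ) ^ 2)) := by ring
    _ ≤ _ := by gcongr

lemma psi_lower2 (n : ℕ) (hn : 1 ≤ n) (τ : ℝ) (hτ0 : 0 < τ) (hτ : τ ≤ 1 / 2) :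
    1 ≤ 6 * n * psi n τ := by
  obtain ⟨σ, hσ, h1, h2, -⟩ := psi_data n hn τ hτ0
  have hn1 : (1 : ℝ) ≤ n := by exact_mod_cast hn
  have hσn : 2 ≤ σ ^ n := by
    by_contra hc
    push Not at hc
    nlinarith [pow_pos hσ n]
  have hσ1 : 1 < σ := by
    by_contra hc
    push Not at hc
    have := pow_le_one₀ hσ.le hc (n := n)
    linarith
  have hσ2 : 1 + 1 / (2 * n) ≤ σ := by
    by_contra hc
    push Not at hc
    have hb : (1 + 1 / (2 * (n : ℝ))) ^ n ≤ Real.exp (1 / 2) := by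
      have := Real.add_one_le_exp (1 / (2 * (n : ℝ)))
      calc (1 + 1 / (2 * (n : ℝ))) ^ n ≤ (Real.exp (1 / (2 * (n : ℝ)))) ^ n := by
            gcongr; linarith
        _ = Real.exp (1 / 2) := by
            rw [← Real.exp_nat_mul]; congr 1; field_simp
    have hc2 : σ ^ n ≤ (1 + 1 / (2 * (n : ℝ))) ^ n := by gcongr
    have he : Real.exp (1 / 2) < 2 := by
      have h0 := Real.exp_one_lt_d9
      have : Real.exp (1 / 2) ^ 2 = Real.exp 1 := by
        rw [← Real.exp_nat_mul]; norm_num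
      nlinarith [Real.exp_pos (1 / 2)]
    linarith
  have h5 : n * σ ^ (n - 1) ≤ ∑ k ∈ Finset.range n, ((k : ℝ) + 1) * σ ^ k := by
    have := Finset.single_le_sum (f := fun k : ℕ => ((k : ℝ) + 1) * σ ^ k) (s := Finset.range n)
      (fun k _ => by positivity) (Finset.mem_range.2 (show n - 1 < n by omega))
    have hc : ((n - 1 : ℕ) : ℝ) + 1 = n := by
      rw [Nat.cast_sub hn]; simp
    simp only [hc] at this
    exact this
  have h6 : τ * ((1 - σ) ^ 2 * (n * σ ^ (n - 1))) ≤ psi n τ := by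
    rw [h2, psi_eq n τ σ h1]
    gcongr
  have h7 : σ * (τ * ((1 - σ) ^ 2 * (n * σ ^ (n - 1)))) = n * (σ - 1) ^ 2 := by
    have : σ ^ n = σ * σ ^ (n - 1) := by
      rw [← pow_succ']; congr 1; omega
    calc _ = n * (σ - 1) ^ 2 * (τ * (σ * σ ^ (n - 1))) := by ring
      _ = _ := by rw [← this, h1, mul_one]
  have h8 : n * (σ - 1) ^ 2 ≤ σ * psi n τ := by rw [← h7]; gcongr
  have h9 : 1 ≤ 2 * n * (σ - 1) := by
    have h : 1 / (2 * (n : ℝ)) ≤ σ - 1 := by linarith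
    rw [div_le_iff₀ (by positivity)] at h
    linarith
  have h10 : 0 ≤ psi n τ := psi_nonneg n hn τ hτ0
  have h11 : σ ≤ 3 * n * (2 * (σ - 1)) := by nlinarith
  have h12 : σ ≤ 6 * n * (n * (σ - 1) ^ 2) := by
    have : σ - 1 ≤ 2 * n * (σ - 1) ^ 2 := by nlinarith
    nlinarith
  have h13 : σ ≤ σ * (6 * n * psi n τ) := by nlinarith
  exact le_of_mul_le_mul_left (by linarith) hσ

lemma amgm_step (n : ℕ) (hn : 1 ≤ n) (κ τ : ℝ) (hκ : 0 < κ) (hτ : 0 < τ) :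
    (n + 1) * κ ^ (-(1 / ((n : ℝ) + 1))) ≤ τ + n * (κ * τ) ^ (-(1 / (n : ℝ))) := by
  have hn0 : (0 : ℝ) < n := by positivity
  set c := κ ^ (1 / ((n : ℝ) + 1)) with hc
  have hc0 : 0 < c := Real.rpow_pos_of_pos hκ _
  have h := psi_nonneg n hn (c * τ) (by positivity)
  unfold psi at h
  have hci : κ ^ (-(1 / ((n : ℝ) + 1))) = c⁻¹ := by rw [Real.rpow_neg hκ.le]
  rw [hci]
  have hk : κ = c * c ^ (n : ℝ) := by
    rw [hc, ← Real.rpow_mul hκ.le, ← Real.rpow_add hκ]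
    have : 1 / ((n : ℝ) + 1) + 1 / ((n : ℝ) + 1) * n = 1 := by field_simp; ring
    rw [this, Real.rpow_one]
  have h2 : (κ * τ) ^ (-(1 / (n : ℝ))) = c⁻¹ * (c * τ) ^ (-(1 / (n : ℝ))) := by
    have : κ * τ = c ^ (n : ℝ) * (c * τ) := by rw [hk]; ring
    rw [this, Real.mul_rpow (by positivity) (by positivity), ← Real.rpow_mul hc0.le]
    have : (n : ℝ) * -(1 / (n : ℝ)) = -1 := by field_simp
    rw [this, Real.rpow_neg_one]
  rw [h2]
  have h3 : τ + n * (c⁻¹ * (c * τ) ^ (-(1 / (n : ℝ)))) - (n + 1) * c⁻¹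
      = c⁻¹ * (c * τ + n * (c * τ) ^ (-(1 / (n : ℝ))) - (n + 1)) := by
    field_simp
  have : 0 ≤ c⁻¹ * (c * τ + n * (c * τ) ^ (-(1 / (n : ℝ))) - (n + 1)) := by positivity
  linarith

lemma ballVol_pos (n : ℕ) : 0 < ballVol n := by
  unfold ballVol
  exact ENNReal.toReal_pos (measure_ball_pos _ _ one_pos).ne' measure_ball_lt_top.ne

def wt (n : ℕ) (y : ℝ) : ℝ := ballVol n * (√(1 - y ^ 2)) ^ n

lemma wt_cont (n : ℕ) : Continuous (wt n) := by unfold wt; fun_prop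

lemma wt_nonneg (n : ℕ) (y : ℝ) : 0 ≤ wt n y :=
  mul_nonneg (ballVol_pos n).le (by positivity)

lemma wt_pos (n : ℕ) (y : ℝ) (hy : y ∈ Ioo (-1 : ℝ) 1) : 0 < wt n y := by
  have : 0 < 1 - y ^ 2 := by nlinarith [hy.1, hy.2]
  have h2 := Real.sqrt_pos.2 this
  have := ballVol_pos n
  unfold wt; positivity

lemma wt_neg (n : ℕ) (y : ℝ) : wt n (-y) = wt n y := by unfold wt; simp

def Wx (n : ℕ) (y : ℝ) : ℝ := (∫ z in (-1)..y, wt n z) + max (y - 1) 0 + min (y + 1) 0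

lemma wt_ii (n : ℕ) (a b : ℝ) : IntervalIntegrable (wt n) volume a b :=
  (wt_cont n).intervalIntegrable a b

lemma Wx_strictMono (n : ℕ) : StrictMono (Wx n) := by
  have hmono : ∀ x y : ℝ, x ≤ y → (∫ z in (-1)..x, wt n z) ≤ ∫ z in (-1)..y, wt n z := by
    intro x y hxy
    rw [← intervalIntegral.integral_add_adjacent_intervals (wt_ii n (-1) x) (wt_ii n x y)]
    have := intervalIntegral.integral_nonneg (μ := volume) hxy (fun u _ => wt_nonneg n u)
    linarith
  intro x y hxy
  have h1 := hmono x y hxy.le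
  have h2 : max (x - 1) 0 ≤ max (y - 1) 0 := max_le_max (by linarith) le_rfl
  have h3 : min (x + 1) 0 ≤ min (y + 1) 0 := min_le_min (by linarith) le_rfl
  unfold Wx
  by_cases hx : x < -1
  · have : min (x + 1) 0 < min (y + 1) 0 := by
      rw [min_eq_left (by linarith : x + 1 ≤ 0)]
      exact lt_min (by linarith) (by linarith)
    linarith
  by_cases hy : 1 < y
  · have : max (x - 1) 0 < max (y - 1) 0 := by
      rw [max_eq_left (by linarith : 0 ≤ y - 1)]
      exact max_lt (by linarith) (by linarith)
    linarith
  push Not at hx hy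
  have : (∫ z in (-1)..x, wt n z) < ∫ z in (-1)..y, wt n z := by
    rw [← intervalIntegral.integral_add_adjacent_intervals (wt_ii n (-1) x) (wt_ii n x y)]
    have := intervalIntegral.intervalIntegral_pos_of_pos_on (wt_ii n x y)
      (fun u hu => wt_pos n u ⟨by linarith [hu.1], by linarith [hu.2]⟩) hxy
    linarith
  linarith

lemma Wx_cont (n : ℕ) : Continuous (Wx n) := by
  unfold Wx
  have : Continuous fun y => ∫ z in (-1)..y, wt n z :=
    intervalIntegral.continuous_primitive (fun a b => wt_ii n a b) _
  fun_prop

lemma Wx_surj (n : ℕ) : Function.Surjective (Wx n) := by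
  apply (Wx_cont n).surjective
  · refine tendsto_atTop_mono' atTop (f₁ := fun y : ℝ => y - 1) ?_ (tendsto_atTop_add_const_right _ _ tendsto_id)
    filter_upwards [eventually_ge_atTop 1] with y hy
    unfold Wx
    have h1 := intervalIntegral.integral_nonneg (a := -1) (b := y) (μ := volume) (by linarith) (fun u _ => wt_nonneg n u)
    have h2 := le_max_left (y - 1) 0
    have h3 : min (y + 1) 0 = 0 := min_eq_right (by linarith)
    linarith
  · refine tendsto_atBot_mono' atBot (f₁ := fun y : ℝ => y + 1) ?_ (tendsto_atBot_add_const_right _ _ tendsto_id)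
    filter_upwards [eventually_le_atBot (-1)] with y hy
    unfold Wx
    have h1 := intervalIntegral.integral_nonneg (a := y) (b := -1) (μ := volume) (by linarith) (fun u _ => wt_nonneg n u)
    rw [intervalIntegral.integral_symm] at h1
    have h2 := min_le_left (y + 1) 0
    have h3 : max (y - 1) 0 = 0 := max_eq_right (by linarith)
    linarith

def Whomeo (n : ℕ) : ℝ ≃ₜ ℝ :=
  ((Wx_strictMono n).orderIsoOfSurjective (Wx n) (Wx_surj n)).toHomeomorph

lemma Wx_eq (n : ℕ) (y : ℝ) (hy : y ∈ Icc (-1 : ℝ) 1) : Wx n y = ∫ z in (-1)..y, wt n z := by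
  unfold Wx
  rw [max_eq_right (by linarith [hy.2]), min_eq_right (by linarith [hy.1])]; ring

lemma Wx_deriv (n : ℕ) (y : ℝ) (hy : y ∈ Ioo (-1 : ℝ) 1) : HasDerivAt (Wx n) (wt n y) y := by
  have h : HasDerivAt (fun y => ∫ z in (-1)..y, wt n z) (wt n y) y :=
    intervalIntegral.integral_hasDerivAt_right (wt_ii n _ _)
      ((wt_cont n).stronglyMeasurableAtFilter _ _) (wt_cont n).continuousAt
  refine h.congr_of_eventuallyEq ?_
  filter_upwards [Ioo_mem_nhds hy.1 hy.2] with z hz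
  exact Wx_eq n z ⟨hz.1.le, hz.2.le⟩

lemma exists_T (n : ℕ) (A : ℝ → ℝ) (hA : Continuous A) (hpos : ∀ t, 0 < A t)
    (t0 t1 κ : ℝ) (ht : t0 < t1) (hκ : 0 < κ)
    (hint : ∫ t in t0..t1, A t = κ * ∫ y in (-1)..1, wt n y) :
    ∃ T : ℝ → ℝ, Continuous T ∧ T t0 = -1 ∧ T t1 = 1 ∧
      (∀ t ∈ Ioo t0 t1, T t ∈ Ioo (-1 : ℝ) 1 ∧ HasDerivAt T (A t / (κ * wt n (T t))) t) ∧
      (∀ t ∈ Icc t0 t1, ∫ u in t0..t, A u = κ * ∫ y in (-1)..(T t), wt n y) := by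
  set Φ : ℝ → ℝ := fun t => (∫ u in t0..t, A u) / κ with hΦ
  have hΦd : ∀ t, HasDerivAt Φ (A t / κ) t := fun t =>
    (intervalIntegral.integral_hasDerivAt_right (hA.intervalIntegrable _ _)
      (hA.stronglyMeasurableAtFilter _ _) hA.continuousAt).div_const κ
  have hΦc : Continuous Φ := continuous_iff_continuousAt.2 fun t => (hΦd t).continuousAt
  have hΦm : StrictMono Φ := strictMono_of_hasDerivAt_pos hΦd (fun t => div_pos (hpos t) hκ)
  set G := (Whomeo n).symm with hG
  have hWG : ∀ z, Wx n (G z) = z := fun z => (Whomeo n).apply_symm_apply z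
  have hGW : ∀ z, G (Wx n z) = z := fun z => (Whomeo n).symm_apply_apply z
  have hGm : StrictMono G := by
    intro x y hxy
    rw [← (Wx_strictMono n).lt_iff_lt, hWG, hWG]; exact hxy
  have hT0 : G (Φ t0) = -1 := by
    have : Φ t0 = Wx n (-1) := by
      rw [Wx_eq n _ (by constructor <;> norm_num)]; simp [hΦ]
    rw [this, hGW]
  have hT1 : G (Φ t1) = 1 := by
    have : Φ t1 = Wx n 1 := by
      rw [Wx_eq n _ (by constructor <;> norm_num)]; simp only [hΦ]; rw [hint]; field_simp
    rw [this, hGW]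
  refine ⟨fun t => G (Φ t), G.continuous.comp hΦc, hT0, hT1, ?_, ?_⟩
  · intro t htt
    have hmem : G (Φ t) ∈ Ioo (-1 : ℝ) 1 :=
      ⟨by rw [← hT0]; exact hGm (hΦm htt.1), by rw [← hT1]; exact hGm (hΦm htt.2)⟩
    refine ⟨hmem, ?_⟩
    have hGd : HasDerivAt G (wt n (G (Φ t)))⁻¹ (Φ t) :=
      HasDerivAt.of_local_left_inverse G.continuous.continuousAt (Wx_deriv n _ hmem)
        (wt_pos n _ hmem).ne' (Eventually.of_forall hWG)
    have := hGd.comp t (hΦd t)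
    have he : (wt n (G (Φ t)))⁻¹ * (A t / κ) = A t / (κ * wt n (G (Φ t))) := by
      rw [div_mul_eq_div_div, div_eq_inv_mul (A t / κ)]
    rw [← he]
    exact this
  · intro t htt
    have hmem : G (Φ t) ∈ Icc (-1 : ℝ) 1 :=
      ⟨by rw [← hT0]; exact hGm.monotone (hΦm.monotone htt.1),
       by rw [← hT1]; exact hGm.monotone (hΦm.monotone htt.2)⟩
    rw [← Wx_eq n _ hmem, hWG]
    simp only [hΦ]; rw [mul_div_cancel₀ _ hκ.ne']

def JL {n : ℕ} (i : Fin (n + 1)) : (ℝ × Euc n) →L[ℝ] Euc (n + 1) :=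
  LinearMap.toContinuousLinearMap
    { toFun := fun z => WithLp.toLp 2 (Fin.insertNth (α := fun _ => ℝ) i z.1 z.2.ofLp)
      map_add' := by
        intro x y
        ext j
        rcases Fin.eq_self_or_eq_succAbove i j with h | ⟨k, h⟩ <;> subst h <;> simp
      map_smul' := by
        intro c x
        ext j
        rcases Fin.eq_self_or_eq_succAbove i j with h | ⟨k, h⟩ <;> subst h <;> simp }

lemma JL_same {n : ℕ} (i : Fin (n + 1)) (z : ℝ × Euc n) : JL i z i = z.1 := by
  simp [JL]

lemma JL_succAbove {n : ℕ} (i : Fin (n + 1)) (z : ℝ × Euc n) (j : Fin n) :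
    JL i z (i.succAbove j) = z.2 j := by
  simp [JL]

lemma JL_norm {n : ℕ} (i : Fin (n + 1)) (z : ℝ × Euc n) :
    ‖JL i z‖ ^ 2 = z.1 ^ 2 + ‖z.2‖ ^ 2 := by
  rw [EuclideanSpace.real_norm_sq_eq, EuclideanSpace.real_norm_sq_eq, Fin.sum_univ_succAbove _ i,
    JL_same]
  simp [JL_succAbove]

lemma JL_inl {n : ℕ} (i : Fin (n + 1)) : JL i (1, (0 : Euc n)) = EuclideanSpace.single i 1 := by
  ext j
  rcases Fin.eq_self_or_eq_succAbove i j with h | ⟨k, h⟩ <;> subst h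
  · simp [JL_same]
  · rw [JL_succAbove]; simp

lemma JL_inr {n : ℕ} (i : Fin (n + 1)) (j : Fin n) :
    JL i (0, EuclideanSpace.single j 1) = EuclideanSpace.single (i.succAbove j) 1 := by
  ext k
  rcases Fin.eq_self_or_eq_succAbove i k with h | ⟨k, h⟩ <;> subst h
  · simp [JL_same]
  · rw [JL_succAbove]
    simp [Pi.single_apply]

def JE {n : ℕ} (i : Fin (n + 1)) : (ℝ × Euc n) ≃ᵐ Euc (n + 1) :=
  ((MeasurableEquiv.prodCongr (MeasurableEquiv.refl ℝ) (MeasurableEquiv.toLp 2 (Fin n → ℝ)).symm).trans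
    (MeasurableEquiv.piFinSuccAbove (fun _ => ℝ) i).symm).trans (MeasurableEquiv.toLp 2 (Fin (n+1) → ℝ))

lemma JE_eq {n : ℕ} (i : Fin (n + 1)) (z : ℝ × Euc n) : JE i z = JL i z := rfl

lemma JE_mp {n : ℕ} (i : Fin (n + 1)) :
    MeasurePreserving (JE (n := n) i) (volume : Measure (ℝ × Euc n)) volume := by
  have h1 : MeasurePreserving (MeasurableEquiv.prodCongr (MeasurableEquiv.refl ℝ)
      (MeasurableEquiv.toLp 2 (Fin n → ℝ)).symm) (volume : Measure (ℝ × Euc n)) volume :=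
    (MeasurePreserving.id volume).prod (EuclideanSpace.volume_preserving_symm_measurableEquiv_toLp (Fin n))
  exact (PiLp.volume_preserving_toLp _).comp
    (((volume_preserving_piFinSuccAbove (fun _ => ℝ) i).symm _).comp h1)

lemma norm_dual_sq {n : ℕ} (ℓ : Euc n →L[ℝ] ℝ) :
    ‖ℓ‖ ^ 2 = ∑ j, (ℓ (EuclideanSpace.single j 1)) ^ 2 := by
  obtain ⟨g, rfl⟩ := (InnerProductSpace.toDual ℝ (Euc n)).surjective ℓ
  rw [LinearIsometryEquiv.norm_map, EuclideanSpace.real_norm_sq_eq]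
  simp [EuclideanSpace.inner_single_right]

def k1 {n : ℕ} (i : Fin (n + 1)) (f : Euc (n + 1) → ℝ) (x : Euc (n + 1)) : ℝ :=
  fderiv ℝ f x (EuclideanSpace.single i 1)

def k2 {n : ℕ} (i : Fin (n + 1)) (f : Euc (n + 1) → ℝ) (x : Euc (n + 1)) : ℝ :=
  ‖(fderiv ℝ f x).comp ((JL i).comp (ContinuousLinearMap.inr ℝ ℝ (Euc n)))‖

def kg {n : ℕ} (f : Euc n → ℝ) (x : Euc n) : ℝ := ‖fderiv ℝ f x‖

lemma kg_sq {n : ℕ} (i : Fin (n + 1)) (f : Euc (n + 1) → ℝ) (x : Euc (n + 1)) :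
    kg f x ^ 2 = k1 i f x ^ 2 + k2 i f x ^ 2 := by
  unfold kg k1 k2
  rw [norm_dual_sq, norm_dual_sq, Fin.sum_univ_succAbove _ i]
  simp [JL_inr]

lemma cauchy_def (g p q T : ℝ) (hg : 0 ≤ g) (hq : 0 ≤ q) (h : g ^ 2 = p ^ 2 + q ^ 2)
    (hT : T ∈ Icc (-1 : ℝ) 1) :
    1 / 2 * (g * (T + p / g) ^ 2) ≤ g + T * p - √(1 - T ^ 2) * q := by
  have h1 : 0 ≤ 1 - T ^ 2 := by nlinarith [hT.1, hT.2]
  set r := √(1 - T ^ 2) with hr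
  have hr0 : 0 ≤ r := Real.sqrt_nonneg _
  have hr2 : r ^ 2 = 1 - T ^ 2 := Real.sq_sqrt h1
  rcases hg.eq_or_lt with h0 | h0
  · subst h0
    have : p = 0 := by nlinarith
    have : q = 0 := by nlinarith
    subst_vars; simp
  · have e : g * (T + p / g) ^ 2 = (g * T + p) ^ 2 / g := by field_simp
    rw [e, ← sub_nonneg]
    have : g + T * p - r * q - 1 / 2 * ((g * T + p) ^ 2 / g) = (g * r - q) ^ 2 / (2 * g) := by
      field_simp
      have : T ^ 2 = 1 - r ^ 2 := by linarith
      linear_combination (-g ^ 2 ) * this + h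
    rw [this]; positivity

/-- test functions -/
structure TF {n : ℕ} (f : Euc n → ℝ) : Prop where
  c1 : ContDiff ℝ 1 f
  cs : HasCompactSupport f
  nn : ∀ x, 0 ≤ f x
  le : ∀ x, f x ≤ 1

def sl {n : ℕ} (i : Fin (n + 1)) (k : Euc (n + 1) → ℝ) (t : ℝ) : ℝ := ∫ y : Euc n, k (JL i (t, y))

lemma norm_le_JL {n : ℕ} (i : Fin (n + 1)) (t : ℝ) (y : Euc n) : ‖y‖ ≤ ‖JL i (t, y)‖ := by
  have := JL_norm i (t, y)
  simp only at this
  nlinarith [norm_nonneg y, norm_nonneg (JL i (t, y)), sq_nonneg t]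

lemma abs_le_JL {n : ℕ} (i : Fin (n + 1)) (t : ℝ) (y : Euc n) : |t| ≤ ‖JL i (t, y)‖ := by
  have := JL_norm i (t, y)
  simp only at this
  refine abs_le_of_sq_le_sq ?_ (norm_nonneg _)
  nlinarith [norm_nonneg y]

lemma cs_bound {n : ℕ} {k : Euc n → ℝ} (hk : HasCompactSupport k) :
    ∃ L : ℝ, 1 ≤ L ∧ ∀ x, L ≤ ‖x‖ → k x = 0 := by
  obtain ⟨R, hR⟩ := hk.isCompact.isBounded.subset_ball (0 : Euc n)
  refine ⟨max R 1, le_max_right _ _, fun x hx => ?_⟩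
  by_contra h
  have := hR (subset_tsupport _ h)
  simp at this
  linarith [le_max_left R 1]

lemma sl_cont {n : ℕ} (i : Fin (n + 1)) {k : Euc (n + 1) → ℝ} (hk : Continuous k)
    (hs : HasCompactSupport k) : Continuous (sl i k) := by
  obtain ⟨L, -, hL⟩ := cs_bound hs
  rw [← continuousOn_univ]
  refine continuousOn_integral_of_compact_support (isCompact_closedBall (0 : Euc n) L) ?_ ?_
  · exact (hk.comp (JL i).continuous).continuousOn
  · intro t y _ hy
    apply hL
    simp at hy
    exact hy.le.trans (norm_le_JL i t y)

lemma sl_zero {n : ℕ} (i : Fin (n + 1)) {k : Euc (n + 1) → ℝ} {L : ℝ}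
    (hL : ∀ x, L ≤ ‖x‖ → k x = 0) (t : ℝ) (ht : L ≤ |t|) : sl i k t = 0 := by
  unfold sl
  have : ∀ y : Euc n, k (JL i (t, y)) = 0 := fun y => hL _ (ht.trans (abs_le_JL i t y))
  simp [this]

lemma sl_slice_int {n : ℕ} (i : Fin (n + 1)) {k : Euc (n + 1) → ℝ} (hk : Continuous k)
    (hs : HasCompactSupport k) (t : ℝ) : Integrable (fun y : Euc n => k (JL i (t, y))) := by
  obtain ⟨L, -, hL⟩ := cs_bound hs
  refine Continuous.integrable_of_hasCompactSupport ?_ ?_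
  · exact hk.comp ((JL i).continuous.comp (by fun_prop))
  · refine HasCompactSupport.intro (isCompact_closedBall (0 : Euc n) L) ?_
    intro y hy
    apply hL
    simp at hy
    exact hy.le.trans (norm_le_JL i t y)

lemma sl_integral {n : ℕ} (i : Fin (n + 1)) {k : Euc (n + 1) → ℝ} (hk : Integrable k) :
    ∫ t, sl i k t = ∫ x, k x := by
  rw [← (JE_mp i).integral_comp (JE i).measurableEmbedding]
  have := (JE_mp i).integrable_comp_emb (JE i).measurableEmbedding |>.2 hk
  exact (integral_prod _ this).symm

lemma sl_integral_interval {n : ℕ} (i : Fin (n + 1)) {k : Euc (n + 1) → ℝ} (hk : Integrable k)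
    {L : ℝ} (hL : ∀ x, L ≤ ‖x‖ → k x = 0) {l0 l1 : ℝ} (h0 : l0 ≤ -L) (h1 : L ≤ l1) (hl : l0 ≤ l1) :
    ∫ t in l0..l1, sl i k t = ∫ x, k x := by
  rw [← sl_integral i hk, intervalIntegral.integral_of_le hl]
  apply setIntegral_eq_integral_of_forall_compl_eq_zero
  intro t ht
  apply sl_zero i hL
  simp only [mem_Ioc, not_and_or, not_lt, not_le] at ht
  rcases ht with h | h
  · exact (by linarith : L ≤ -t).trans (neg_le_abs t)
  · exact (by linarith : L ≤ t).trans (le_abs_self t)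

lemma sl_deriv {n : ℕ} (i : Fin (n + 1)) {f : Euc (n + 1) → ℝ} (hf : ContDiff ℝ 1 f)
    (hs : HasCompactSupport f) (t : ℝ) : HasDerivAt (sl i f) (sl i (k1 i f) t) t := by
  have hc : Continuous (k1 i f) := by
    unfold k1
    exact (hf.continuous_fderiv (by simp)).clm_apply continuous_const
  have hcs : HasCompactSupport (k1 i f) := hs.fderiv_apply (𝕜 := ℝ) _
  obtain ⟨L, -, hL⟩ := cs_bound hcs
  obtain ⟨M, hM⟩ := hc.bounded_above_of_compact_support hcs
  have := hasDerivAt_integral_of_dominated_loc_of_deriv_le (μ := (volume : Measure (Euc n))) (𝕜 := ℝ)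
    (F := fun t y => f (JL i (t, y))) (F' := fun t y => k1 i f (JL i (t, y))) (x₀ := t) (s := univ)
    (bound := (closedBall (0 : Euc n) L).indicator (fun _ => M)) univ_mem
    (Eventually.of_forall fun t => (sl_slice_int i hf.continuous hs t).aestronglyMeasurable)
    (sl_slice_int i hf.continuous hs t) (sl_slice_int i hc hcs t).aestronglyMeasurable
    (ae_of_all _ fun y t _ => by
      by_cases hy : y ∈ closedBall (0 : Euc n) L
      · rw [indicator_of_mem hy]; exact hM _
      · rw [indicator_of_notMem hy]
        simp at hy
        rw [hL _ (hy.le.trans (norm_le_JL i t y))]; simp)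
    ((integrable_indicator_iff measurableSet_closedBall).2 (integrableOn_const measure_closedBall_lt_top.ne))
    (ae_of_all _ fun y t _ => by
      have h1 : HasFDerivAt f (fderiv ℝ f (JL i (t, y))) (JL i (t, y)) :=
        (hf.differentiable (by simp) _).hasFDerivAt
      have h2 : HasDerivAt (fun t : ℝ => JL i (t, y)) (JL i (1, 0)) t :=
        (JL i).hasFDerivAt.comp_hasDerivAt t ((hasDerivAt_id t).prodMk (hasDerivAt_const t y))
      rw [JL_inl] at h2
      exact h1.comp_hasDerivAt t h2)
  exact this.2

lemma slice_TF {n : ℕ} (i : Fin (n + 1)) {f : Euc (n + 1) → ℝ} (hf : TF f) (t : ℝ) :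
    TF (fun y : Euc n => f (JL i (t, y))) := by
  obtain ⟨L, -, hL⟩ := cs_bound hf.cs
  refine ⟨?_, ?_, fun _ => hf.nn _, fun _ => hf.le _⟩
  · exact hf.c1.comp ((JL i).contDiff.comp (by fun_prop))
  · refine HasCompactSupport.intro (isCompact_closedBall (0 : Euc n) L) ?_
    intro y hy
    apply hL
    simp at hy
    exact hy.le.trans (norm_le_JL i t y)

lemma slice_kg {n : ℕ} (i : Fin (n + 1)) {f : Euc (n + 1) → ℝ} (hf : TF f) (t : ℝ) (y : Euc n) :
    kg (fun y : Euc n => f (JL i (t, y))) y = k2 i f (JL i (t, y)) := by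
  unfold kg k2
  have h1 : HasFDerivAt f (fderiv ℝ f (JL i (t, y))) (JL i (t, y)) :=
    (hf.c1.differentiable (by simp) _).hasFDerivAt
  have h2 : HasFDerivAt (fun y : Euc n => JL i (t, y))
      ((JL i).comp (ContinuousLinearMap.inr ℝ ℝ (Euc n))) y :=
    (JL i).hasFDerivAt.comp y ((hasFDerivAt_prodMk_right t y))
  have h3 := (h1.comp y h2).fderiv
  simp only [Function.comp_def] at h3
  rw [h3]

lemma k1_cont {n : ℕ} (i : Fin (n + 1)) {f : Euc (n + 1) → ℝ} (hf : TF f) : Continuous (k1 i f) := by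
  unfold k1
  exact (hf.c1.continuous_fderiv (by simp)).clm_apply continuous_const
lemma k1_cs {n : ℕ} (i : Fin (n + 1)) {f : Euc (n + 1) → ℝ} (hf : TF f) : HasCompactSupport (k1 i f) :=
  hf.cs.fderiv_apply (𝕜 := ℝ) _
lemma k2_cont {n : ℕ} (i : Fin (n + 1)) {f : Euc (n + 1) → ℝ} (hf : TF f) : Continuous (k2 i f) := by
  unfold k2
  exact ((hf.c1.continuous_fderiv (by simp)).clm_comp continuous_const).norm
lemma k2_cs {n : ℕ} (i : Fin (n + 1)) {f : Euc (n + 1) → ℝ} (hf : TF f) : HasCompactSupport (k2 i f) := by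
  have := hf.cs.fderiv (𝕜 := ℝ)
  refine this.comp_left (g := fun ℓ : Euc (n+1) →L[ℝ] ℝ => ‖ℓ.comp ((JL i).comp (ContinuousLinearMap.inr ℝ ℝ (Euc n)))‖) ?_
  simp
lemma kg_cont {n : ℕ} {f : Euc n → ℝ} (hf : TF f) : Continuous (kg f) :=
  (hf.c1.continuous_fderiv (by simp)).norm
lemma kg_cs {n : ℕ} {f : Euc n → ℝ} (hf : TF f) : HasCompactSupport (kg f) :=
  (hf.cs.fderiv (𝕜 := ℝ)).norm
lemma TF.int {n : ℕ} {f : Euc n → ℝ} (hf : TF f) : Integrable f :=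
  hf.c1.continuous.integrable_of_hasCompactSupport hf.cs
lemma TF.sq_cont {n : ℕ} {f : Euc n → ℝ} (hf : TF f) : Continuous (fun x => f x ^ 2) :=
  hf.c1.continuous.pow 2
lemma TF.sq_cs {n : ℕ} {f : Euc n → ℝ} (hf : TF f) : HasCompactSupport (fun x => f x ^ 2) :=
  hf.cs.comp_left (g := fun r : ℝ => r ^ 2) (by simp)
lemma TF.sq_int {n : ℕ} {f : Euc n → ℝ} (hf : TF f) : Integrable (fun x => f x ^ 2) :=
  hf.sq_cont.integrable_of_hasCompactSupport hf.sq_cs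
lemma TF.kg_int {n : ℕ} {f : Euc n → ℝ} (hf : TF f) : Integrable (kg f) :=
  (kg_cont hf).integrable_of_hasCompactSupport (kg_cs hf)
lemma kg_nonneg {n : ℕ} (f : Euc n → ℝ) (x : Euc n) : 0 ≤ kg f x := norm_nonneg _
lemma k2_nonneg {n : ℕ} (i : Fin (n + 1)) (f : Euc (n + 1) → ℝ) (x : Euc (n + 1)) : 0 ≤ k2 i f x :=
  norm_nonneg _
lemma TF.supp {n : ℕ} {f : Euc n → ℝ} (hf : TF f) : ∃ L : ℝ, 1 ≤ L ∧ (∀ x, L ≤ ‖x‖ → f x = 0) ∧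
    (∀ x, L ≤ ‖x‖ → fderiv ℝ f x = 0) := by
  have h := hf.cs.fderiv (𝕜 := ℝ)
  obtain ⟨R, hR⟩ := hf.cs.isCompact.isBounded.subset_ball (0 : Euc n)
  refine ⟨max R 1, le_max_right _ _, fun x hx => ?_, fun x hx => ?_⟩
  · by_contra h
    have := hR (subset_tsupport _ h)
    simp at this
    linarith [le_max_left R 1]
  · by_contra h
    have := hR (support_fderiv_subset ℝ h)
    simp at this
    linarith [le_max_left R 1]

lemma integral_wt (n : ℕ) : ∫ y in (-1 : ℝ)..1, wt n y = ballVol (n + 1) := by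
  have hi : Integrable ((ball (0 : Euc (n + 1)) 1).indicator (fun _ => (1 : ℝ))) :=
    (integrable_indicator_iff measurableSet_ball).2 (integrableOn_const measure_ball_lt_top.ne)
  have h0 : ∫ x, (ball (0 : Euc (n + 1)) 1).indicator (fun _ => (1 : ℝ)) x = ballVol (n + 1) := by
    rw [integral_indicator measurableSet_ball]
    simp [ballVol, Measure.real]
  rw [← h0, ← sl_integral_interval 0 hi (L := 1) (l0 := -1) (l1 := 1) ?_ le_rfl le_rfl (by norm_num)]
  · apply intervalIntegral.integral_congr_ae
    have : ∀ᵐ y : ℝ, y ≠ 1 := by simp [ae_iff]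
    filter_upwards [this] with t ht1 ht
    rw [uIoc_of_le (by norm_num)] at ht
    have ht' : t < 1 := lt_of_le_of_ne ht.2 ht1
    have hp : 0 < 1 - t ^ 2 := by nlinarith [ht.1]
    unfold sl
    have : ∀ y : Euc n, (ball (0 : Euc (n + 1)) 1).indicator (fun _ => (1 : ℝ)) (JL 0 (t, y)) =
        (ball (0 : Euc n) (√(1 - t ^ 2))).indicator (fun _ => (1 : ℝ)) y := by
      intro y
      have e : JL 0 (t, y) ∈ ball (0 : Euc (n + 1)) 1 ↔ y ∈ ball (0 : Euc n) (√(1 - t ^ 2)) := by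
        rw [mem_ball_zero_iff, mem_ball_zero_iff, Real.lt_sqrt (norm_nonneg _),
          ← sq_lt_one_iff₀ (norm_nonneg _), JL_norm]
        simp only
        constructor <;> intro h <;> linarith
      simp only [indicator, e]
    simp_rw [this]
    rw [integral_indicator measurableSet_ball]
    simp only [integral_const, smul_eq_mul, mul_one, Measure.real, MeasurableSet.univ, Measure.restrict_apply, univ_inter]
    rw [Measure.addHaar_ball_of_pos _ _ (Real.sqrt_pos.2 hp)]
    simp [wt, ballVol, mul_comm, ENNReal.toReal_mul]
  · intro x hx
    rw [indicator_of_notMem]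
    simpa using hx

structure SD (n : ℕ) (a a' V S P : ℝ → ℝ) : Prop where
  ca : Continuous a
  ca' : Continuous a'
  cV : Continuous V
  cS : Continuous S
  cP : Continuous P
  da : ∀ t, HasDerivAt a (a' t) t
  V0 : ∀ t, 0 ≤ V t
  Va : ∀ t, V t ≤ a t
  S0 : ∀ t, 0 ≤ S t
  iso : ∀ t, (n : ℝ) * (ballVol n) ^ ((1 : ℝ) / n) * V t ≤ (a t) ^ ((1 : ℝ) / n) * S t
  Pge : ∀ t, ∀ T ∈ Icc (-1 : ℝ) 1, -(T * a' t) + √(1 - T ^ 2) * S t ≤ P t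

lemma SD.slab {n : ℕ} {a a' V S P : ℝ → ℝ} (h : SD n a a' V S P) (hn : 1 ≤ n)
    (t A κ T : ℝ) (hA : 0 < A) (haA : a t ≤ A) (hκ : 0 < κ) (hT : T ∈ Ioo (-1 : ℝ) 1) :
    n * V t * (κ * (A / (κ * wt n T))) ^ (-((1 : ℝ) / n)) ≤ √(1 - T ^ 2) * S t := by
  have hw := wt_pos n T hT
  have hn' : (0 : ℝ) < n := by exact_mod_cast hn
  have e1 : κ * (A / (κ * wt n T)) = A / wt n T := by field_simp
  have hr : 0 ≤ √(1 - T ^ 2) := Real.sqrt_nonneg _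
  have e2 : (A / wt n T) ^ (-((1 : ℝ) / n)) = ballVol n ^ ((1 : ℝ) / n) * √(1 - T ^ 2) / A ^ ((1 : ℝ) / n) := by
    rw [Real.rpow_neg (by positivity), ← Real.inv_rpow (by positivity), inv_div,
      Real.div_rpow hw.le hA.le]
    congr 1
    unfold wt
    rw [Real.mul_rpow (ballVol_pos n).le (by positivity)]
    congr 1
    rw [← Real.rpow_natCast, ← Real.rpow_mul hr]
    field_simp
    simp
  rw [e1, e2]
  have hAp : 0 < A ^ ((1 : ℝ) / n) := by positivity
  have h1 := h.iso t
  have h2 : (a t) ^ ((1 : ℝ) / n) * S t ≤ A ^ ((1 : ℝ) / n) * S t := by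
    apply mul_le_mul_of_nonneg_right _ (h.S0 t)
    exact Real.rpow_le_rpow ((h.V0 t).trans (h.Va t)) haA (by positivity)
  have h3 := h1.trans h2
  rw [show (n : ℝ) * V t * (ballVol n ^ ((1 : ℝ) / n) * √(1 - T ^ 2) / A ^ ((1 : ℝ) / n)) =
    √(1 - T ^ 2) * (((n : ℝ) * (ballVol n) ^ ((1 : ℝ) / n) * V t) / A ^ ((1 : ℝ) / n)) by ring]
  apply mul_le_mul_of_nonneg_left _ hr
  rw [div_le_iff₀ hAp]; linarith

lemma SD.step0 {n : ℕ} {a a' V S P : ℝ → ℝ} (h : SD n a a' V S P) (hn : 1 ≤ n)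
    (t0 t1 : ℝ) (ht : t0 < t1) (ε : ℝ) (hε : 0 < ε) (κ : ℝ)
    (hκ : κ * ballVol (n + 1) = ∫ t in (t0 - ε)..(t1 + ε), (a t + ε)) :
    (n + 1) * (∫ t in t0..t1, V t) ≤
      κ ^ ((1 : ℝ) / (n + 1)) * ((∫ t in t0..t1, P t) + a t0 + a t1) := by
  have hpos : ∀ t, 0 < a t + ε := fun t => by linarith [h.V0 t, h.Va t]
  have hAc : Continuous fun t => a t + ε := h.ca.add continuous_const
  have hIp : 0 < ∫ t in (t0 - ε)..(t1 + ε), (a t + ε) :=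
    intervalIntegral.intervalIntegral_pos_of_pos (hAc.intervalIntegrable _ _) hpos (by linarith)
  have hω := ballVol_pos (n + 1)
  have hκ0 : 0 < κ := by
    by_contra hh
    push Not at hh
    nlinarith
  obtain ⟨T, hTc, -, -, hT, -⟩ := exists_T n (fun t => a t + ε) hAc hpos (t0 - ε) (t1 + ε) κ
    (by linarith) hκ0 (by rw [integral_wt, ← hκ])
  set T' : ℝ → ℝ := fun t => (a t + ε) / (κ * wt n (T t)) with hT'
  have hsub : ∀ t ∈ Icc t0 t1, t ∈ Ioo (t0 - ε) (t1 + ε) := fun t ht =>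
    ⟨by linarith [ht.1], by linarith [ht.2]⟩
  have hT'c : ContinuousOn T' (Icc t0 t1) := by
    refine hAc.continuousOn.div ?_ ?_
    · exact (continuous_const.mul ((wt_cont n).comp hTc)).continuousOn
    · intro t ht
      exact (mul_pos hκ0 (wt_pos n _ (hT t (hsub t ht)).1)).ne'
  have hT'i : IntervalIntegrable T' volume t0 t1 := by
    apply ContinuousOn.intervalIntegrable; rwa [uIcc_of_le ht.le]
  have ibp := intervalIntegral.integral_mul_deriv_eq_deriv_mul (a := t0) (b := t1) (u := T) (v := a)
    (u' := T') (v' := a')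
    (fun t htt => by rw [uIcc_of_le ht.le] at htt; exact (hT t (hsub t htt)).2)
    (fun t _ => h.da t) hT'i (h.ca'.intervalIntegrable _ _)
  have hmem : ∀ t ∈ Icc t0 t1, T t ∈ Icc (-1 : ℝ) 1 := fun t ht => Ioo_subset_Icc_self (hT t (hsub t ht)).1
  have key : ∀ t ∈ Icc t0 t1, (n + 1) * κ ^ (-((1 : ℝ) / (n + 1))) * V t + -(T t * a' t) - T' t * a t ≤ P t := by
    intro t htt
    have hTm := (hT t (hsub t htt)).1
    have h1 := h.slab hn t (a t + ε) κ (T t) (hpos t) (by linarith) hκ0 hTm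
    have h2 := h.Pge t (T t) (hmem t htt)
    have hτ : 0 < T' t := div_pos (hpos t) (mul_pos hκ0 (wt_pos n _ hTm))
    have h3 := amgm_step n hn κ (T' t) hκ0 hτ
    have h4 := mul_le_mul_of_nonneg_left h3 (h.V0 t)
    have h5 := mul_le_mul_of_nonneg_left (h.Va t) hτ.le
    simp only [hT'] at h4 h5 ⊢
    push_cast at h4
    nlinarith
  have hi1 : IntervalIntegrable (fun t => T t * a' t) volume t0 t1 :=
    (hTc.mul h.ca').intervalIntegrable _ _
  have hi2 : IntervalIntegrable (fun t => T' t * a t) volume t0 t1 := by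
    apply ContinuousOn.intervalIntegrable; rw [uIcc_of_le ht.le]
    exact hT'c.mul h.ca.continuousOn
  have hi3 : IntervalIntegrable (fun t => (n + 1) * κ ^ (-((1 : ℝ) / (n + 1))) * V t) volume t0 t1 :=
    (h.cV.const_mul _ ).intervalIntegrable _ _
  have hI := intervalIntegral.integral_mono_on ht.le ((hi3.add hi1.neg).sub hi2)
    (h.cP.intervalIntegrable _ _) key
  rw [intervalIntegral.integral_sub (hi3.add hi1.neg) hi2] at hI
  have hadd := intervalIntegral.integral_add hi3 hi1.neg
  simp only [Pi.neg_apply] at hadd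
  simp only [Pi.add_apply, Pi.neg_apply] at hI
  rw [hadd, intervalIntegral.integral_neg, intervalIntegral.integral_const_mul, ibp] at hI
  have b0 := hmem t0 (left_mem_Icc.2 ht.le)
  have b1 := hmem t1 (right_mem_Icc.2 ht.le)
  have a0 := (h.V0 t0).trans (h.Va t0)
  have a1 := (h.V0 t1).trans (h.Va t1)
  have hfin : (n + 1) * κ ^ (-((1 : ℝ) / (n + 1))) * (∫ t in t0..t1, V t) ≤
      (∫ t in t0..t1, P t) + a t0 + a t1 := by
    nlinarith [b0.1, b0.2, b1.1, b1.2]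
  have hkp : 0 < κ ^ ((1 : ℝ) / (n + 1)) := by positivity
  have := mul_le_mul_of_nonneg_left hfin hkp.le
  rw [Real.rpow_neg hκ0.le] at this
  calc _ = κ ^ ((1 : ℝ) / (n + 1)) * ((n + 1) * (κ ^ ((1 : ℝ) / (n + 1)))⁻¹ * (∫ t in t0..t1, V t)) := by
        field_simp
    _ ≤ _ := this

lemma SD.step {n : ℕ} {a a' V S P : ℝ → ℝ} (h : SD n a a' V S P) (hn : 1 ≤ n)
    (t0 t1 : ℝ) (ht : t0 < t1) :
    (n + 1) * (∫ t in t0..t1, V t) ≤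
      ((∫ t in t0..t1, a t) / ballVol (n + 1)) ^ ((1 : ℝ) / (n + 1)) *
        ((∫ t in t0..t1, P t) + a t0 + a t1) := by
  have hω := ballVol_pos (n + 1)
  set κ : ℝ → ℝ := fun ε => (∫ t in (t0 - ε)..(t1 + ε), (a t + ε)) / ballVol (n + 1) with hκ
  have hκe : κ = fun ε => ((∫ t in (0:ℝ)..(t1 + ε), a t) - (∫ t in (0:ℝ)..(t0 - ε), a t) + (t1 + ε - (t0 - ε)) * ε) / ballVol (n + 1) := by
    ext ε
    simp only [hκ]
    rw [intervalIntegral.integral_add (h.ca.intervalIntegrable _ _) (by simp),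
      ← intervalIntegral.integral_interval_sub_left (h.ca.intervalIntegrable 0 _) (h.ca.intervalIntegrable 0 _)]
    simp
  have hc : Continuous κ := by
    rw [hκe]
    have hp : Continuous fun x => ∫ t in (0:ℝ)..x, a t :=
      intervalIntegral.continuous_primitive (fun a b => h.ca.intervalIntegrable _ _) _
    fun_prop
  have hk0 : κ 0 = (∫ t in t0..t1, a t) / ballVol (n + 1) := by simp [hκ]
  rw [← hk0]
  have hlim : Tendsto (fun ε => (κ ε) ^ ((1 : ℝ) / (n + 1)) *
        ((∫ t in t0..t1, P t) + a t0 + a t1)) (nhdsWithin 0 (Ioi 0)) (nhds ((κ 0) ^ ((1 : ℝ) / (n + 1)) *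
        ((∫ t in t0..t1, P t) + a t0 + a t1))) := by
    apply Tendsto.mul_const
    have : Continuous fun ε => (κ ε) ^ ((1 : ℝ) / (n + 1)) :=
      hc.rpow_const (fun _ => Or.inr (by positivity))
    exact this.continuousWithinAt.tendsto
  refine ge_of_tendsto hlim ?_
  filter_upwards [self_mem_nhdsWithin] with ε hε
  exact h.step0 hn t0 t1 ht ε hε (κ ε) (by simp only [hκ]; field_simp)

def RI (n : ℕ) : Prop := ∀ f : Euc n → ℝ, TF f →
  (n : ℝ) * (ballVol n) ^ ((1 : ℝ) / n) * (∫ x, f x ^ 2) ≤ (∫ x, f x) ^ ((1 : ℝ) / n) * ∫ x, kg f x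

lemma RI.SD {n : ℕ} (hR : RI n) (i : Fin (n + 1)) {f : Euc (n + 1) → ℝ} (hf : TF f) :
    SD n (sl i f) (sl i (k1 i f)) (sl i (fun x => f x ^ 2)) (sl i (k2 i f)) (sl i (kg f)) where
  ca := sl_cont i hf.c1.continuous hf.cs
  ca' := sl_cont i (k1_cont i hf) (k1_cs i hf)
  cV := sl_cont i hf.sq_cont hf.sq_cs
  cS := sl_cont i (k2_cont i hf) (k2_cs i hf)
  cP := sl_cont i (kg_cont hf) (kg_cs hf)
  da := fun t => sl_deriv i hf.c1 hf.cs t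
  V0 := fun t => integral_nonneg fun y => sq_nonneg _
  Va := fun t => by
    refine integral_mono (sl_slice_int i hf.sq_cont hf.sq_cs t) (sl_slice_int i hf.c1.continuous hf.cs t) ?_
    intro y
    have h1 := hf.nn (JL i (t, y)); have h2 := hf.le (JL i (t, y))
    simp only
    nlinarith
  S0 := fun t => integral_nonneg fun y => k2_nonneg _ _ _
  iso := fun t => by
    have := hR _ (slice_TF i hf t)
    simp only [slice_kg i hf] at this
    exact this
  Pge := fun t T hT => by
    unfold sl
    rw [← integral_const_mul, ← integral_const_mul, ← integral_neg, ← integral_add]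
    · refine integral_mono ?_ (sl_slice_int i (kg_cont hf) (kg_cs hf) t) ?_
      · exact ((sl_slice_int i (k1_cont i hf) (k1_cs i hf) t).const_mul _).neg.add
          ((sl_slice_int i (k2_cont i hf) (k2_cs i hf) t).const_mul _)
      · intro y
        have := cauchy_def (kg f (JL i (t, y))) (k1 i f (JL i (t, y))) (k2 i f (JL i (t, y))) T
          (kg_nonneg _ _) (k2_nonneg _ _ _) (kg_sq i f _) hT
        have h2 : 0 ≤ 1 / 2 * (kg f (JL i (t, y)) * (T + (k1 i f (JL i (t, y))) / kg f (JL i (t, y))) ^ 2) := by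
          have := kg_nonneg f (JL i (t, y)); positivity
        simp only
        linarith
    · exact ((sl_slice_int i (k1_cont i hf) (k1_cs i hf) t).const_mul _).neg
    · exact ((sl_slice_int i (k2_cont i hf) (k2_cs i hf) t).const_mul _)

lemma ballVol_zero : ballVol 0 = 1 := by
  have : ball (0 : Euc 0) 1 = univ := by ext x; simp [Subsingleton.elim x 0]
  rw [ballVol, this, ← (PiLp.volume_preserving_toLp (Fin 0)).measure_preimage
    MeasurableSet.univ.nullMeasurableSet]
  simp [volume_pi]

lemma RI_one : RI 1 := by
  intro f hf
  obtain ⟨L, hL1, hL, hL'⟩ := hf.supp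
  have hb : ballVol 1 = 2 := by
    have h := integral_wt 0
    have h0 : ballVol 0 = 1 := by
      exact ballVol_zero
    simp only [wt, pow_zero, h0] at h
    norm_num at h
    exact h.symm
  have hv : (volume : Measure (Euc 0)).real univ = 1 := by
    have h0 : ballVol 0 = 1 := by
      exact ballVol_zero
    have : ball (0 : Euc 0) 1 = univ := by ext x; simp [Subsingleton.elim x 0]
    rw [ballVol, this] at h0; exact h0
  have hsl : ∀ k : Euc 1 → ℝ, ∀ t, sl (n := 0) 0 k t = k (JL 0 (t, 0)) := by
    intro k t
    unfold sl
    have : ∀ y : Euc 0, k (JL 0 (t, y)) = k (JL 0 (t, 0)) := fun y => by rw [Subsingleton.elim y 0]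
    simp only [this, integral_const, hv, smul_eq_mul, one_mul]
  have hk : ∀ x, |k1 0 f x| ≤ kg f x := by
    intro x
    have := kg_sq 0 f x
    apply abs_le_of_sq_le_sq _ (kg_nonneg f x)
    nlinarith [sq_nonneg (k2 0 f x)]
  set G : ℝ := ∫ x, kg f x with hG
  have hkgL : ∀ x, L ≤ ‖x‖ → kg f x = 0 := fun x hx => by simp [kg, hL' x hx]
  have hmain : ∀ t ∈ Icc (-L) L, 2 * sl (n := 0) 0 f t ≤ G := by
    intro t ht
    have hci : ∀ a b, IntervalIntegrable (sl 0 (k1 0 f)) volume a b := fun a b =>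
      (sl_cont 0 (k1_cont 0 hf) (k1_cs 0 hf)).intervalIntegrable a b
    have hcg : ∀ a b, IntervalIntegrable (sl 0 (kg f)) volume a b := fun a b =>
      (sl_cont 0 (kg_cont hf) (kg_cs hf)).intervalIntegrable a b
    have f1 := intervalIntegral.integral_eq_sub_of_hasDerivAt (a := -L) (b := t)
      (fun t _ => sl_deriv 0 hf.c1 hf.cs t) (hci _ _)
    have f2 := intervalIntegral.integral_eq_sub_of_hasDerivAt (a := t) (b := L)
      (fun t _ => sl_deriv 0 hf.c1 hf.cs t) (hci _ _)
    rw [sl_zero 0 hL (-L) (by rw [abs_neg]; exact le_abs_self L)] at f1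
    rw [sl_zero 0 hL L (le_abs_self L)] at f2
    have g1 := intervalIntegral.integral_mono_on ht.1 (hci _ _) (hcg _ _) (fun u _ => by
      rw [hsl, hsl]; exact (le_abs_self _).trans (hk _))
    have g2 := intervalIntegral.integral_mono_on ht.2 (hci _ _).neg (hcg _ _) (fun u _ => by
      simp only [Pi.neg_apply]; rw [hsl, hsl]; exact (neg_le_abs _).trans (hk _))
    simp only [Pi.neg_apply, intervalIntegral.integral_neg] at g2
    have s := intervalIntegral.integral_add_adjacent_intervals (hcg (-L) t) (hcg t L)
    rw [sl_integral_interval 0 hf.kg_int hkgL le_rfl le_rfl (by linarith)] at s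
    linarith
  have hmain2 : ∀ x, 2 * f x ^ 2 ≤ G * f x := by
    intro x
    obtain ⟨⟨t, y⟩, rfl⟩ := (JE 0).surjective x
    rw [JE_eq]
    have hy : y = 0 := Subsingleton.elim _ _
    subst hy
    have h0 := hf.nn (JL 0 (t, 0))
    by_cases ht : t ∈ Icc (-L) L
    · have := hmain t ht
      rw [hsl] at this
      nlinarith
    · have : f (JL 0 (t, 0)) = 0 := by
        apply hL
        refine le_trans ?_ (abs_le_JL 0 t 0)
        by_contra hh
        push Not at hh
        exact ht (abs_le.1 hh.le)
      simp [this]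
  have := integral_mono (hf.sq_int.const_mul 2) (hf.int.const_mul G) hmain2
  rw [integral_const_mul, integral_const_mul] at this
  simp only [Nat.cast_one, div_one, Real.rpow_one, hb]
  linarith

lemma RI_step {n : ℕ} (hn : 1 ≤ n) (hR : RI n) : RI (n + 1) := by
  intro f hf
  obtain ⟨L, hL1, hL, hL'⟩ := hf.supp
  have h := (hR.SD 0 hf).step hn (-L) L (by linarith)
  rw [sl_integral_interval 0 hf.sq_int (L := L) (fun x hx => by simp [hL x hx]) le_rfl le_rfl (by linarith),
    sl_integral_interval 0 hf.int hL le_rfl le_rfl (by linarith),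
    sl_integral_interval 0 hf.kg_int (L := L) (fun x hx => by simp [kg, hL' x hx]) le_rfl le_rfl (by linarith),
    sl_zero 0 hL (-L) (by rw [abs_neg]; exact le_abs_self L), sl_zero 0 hL L (le_abs_self L)] at h
  have hω := ballVol_pos (n + 1)
  rw [Real.div_rpow (integral_nonneg hf.nn) hω.le] at h
  have hp : 0 < ballVol (n + 1) ^ ((1 : ℝ) / (n + 1)) := by positivity
  have := mul_le_mul_of_nonneg_left h hp.le
  push_cast
  calc _ = ballVol (n + 1) ^ ((1 : ℝ) / (n + 1)) * ((n + 1) * ∫ x, f x ^ 2) := by ring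
    _ ≤ _ := this
    _ = _ := by field_simp; ring

lemma RI_all (n : ℕ) (hn : 1 ≤ n) : RI n := by
  induction n, hn using Nat.le_induction with
  | base => exact RI_one
  | succ k hk ih => exact RI_step hk ih

def rho (u : ℝ) : ℝ := max 0 (min 1 (3 - |u|))
lemma rho_cont : Continuous rho := by unfold rho; fun_prop
lemma rho_nonneg (u : ℝ) : 0 ≤ rho u := le_max_left _ _
lemma rho_le (u : ℝ) : rho u ≤ 1 := max_le zero_le_one (min_le_left _ _)
lemma rho_one (u : ℝ) (h : |u| ≤ 2) : rho u = 1 := by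
  unfold rho; rw [min_eq_left (by linarith)]; simp
lemma rho_neg (u : ℝ) : rho (-u) = rho u := by simp [rho]
lemma rho_zero (u : ℝ) (h : 3 ≤ |u|) : rho u = 0 := by
  unfold rho; apply max_eq_left; exact (min_le_right _ _).trans (by linarith)
/-- smooth truncation -/
def clp (s : ℝ) : ℝ := ∫ u in (0 : ℝ)..s, rho u
lemma rho_ii (a b : ℝ) : IntervalIntegrable rho volume a b := rho_cont.intervalIntegrable _ _
lemma clp_deriv (s : ℝ) : HasDerivAt clp (rho s) s :=
  intervalIntegral.integral_hasDerivAt_right (rho_ii _ _)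
      (rho_cont.stronglyMeasurableAtFilter _ _) rho_cont.continuousAt
lemma clp_neg (s : ℝ) : clp (-s) = - clp s := by
  unfold clp
  have := intervalIntegral.integral_comp_neg (a := 0) (b := s) rho
  simp only [rho_neg, neg_zero] at this
  rw [this, intervalIntegral.integral_symm]
lemma clp_sub (s t : ℝ) : clp t - clp s = ∫ u in s..t, rho u :=
  intervalIntegral.integral_interval_sub_left (rho_ii 0 t) (rho_ii 0 s)
lemma clp_mono : Monotone clp := by
  intro s t h
  have := clp_sub s t
  have h2 := intervalIntegral.integral_nonneg (μ := volume) h (fun u _ => rho_nonneg u)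
  linarith
lemma clp_lip (s t : ℝ) (h : s ≤ t) : clp t - clp s ≤ t - s := by
  rw [clp_sub]
  have := intervalIntegral.integral_mono_on h (rho_ii s t) (by simp : IntervalIntegrable (fun _ => (1:ℝ)) volume s t) (fun u _ => rho_le u)
  simpa using this
lemma clp_id (s : ℝ) (h : |s| ≤ 2) : clp s = s := by
  unfold clp
  have : ∫ u in (0 : ℝ)..s, rho u = ∫ u in (0 : ℝ)..s, (1 : ℝ) := by
    apply intervalIntegral.integral_congr
    intro u hu
    apply rho_one
    rw [mem_uIcc] at hu
    rw [abs_le] at h ⊢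
    rcases hu with hu | hu <;> constructor <;> linarith
  rw [this]; simp
lemma clp_le (s : ℝ) : clp s ≤ 3 := by
  by_cases h : s ≤ 2
  · have := clp_mono h
    rw [clp_id 2 (by norm_num)] at this; linarith
  push Not at h
  by_cases h3 : s ≤ 3
  · have := clp_lip 2 s h.le
    rw [clp_id 2 (by norm_num)] at this; linarith
  push Not at h3
  have h4 := clp_sub 3 s
  have h5 : ∫ u in (3 : ℝ)..s, rho u = ∫ u in (3 : ℝ)..s, (0 : ℝ) := by
    apply intervalIntegral.integral_congr
    intro u hu
    rw [uIcc_of_le h3.le] at hu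
    apply rho_zero
    rw [abs_of_nonneg (by linarith [hu.1])]; exact hu.1
  rw [h5] at h4
  have := clp_lip 2 3 (by norm_num)
  rw [clp_id 2 (by norm_num)] at this; simp at h4; linarith
lemma clp_abs (s : ℝ) : |clp s| ≤ 3 := by
  rw [abs_le]
  have := clp_le (-s)
  rw [clp_neg] at this
  exact ⟨by linarith, clp_le s⟩
/-- compare truncated and untruncated -/
lemma clp_cmp (s T : ℝ) (hT : T ∈ Icc (-1 : ℝ) 1) : (T - clp s) ^ 2 ≤ (T - s) ^ 2 := by
  obtain ⟨h1, h2⟩ := hT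
  by_cases h : |s| ≤ 2
  · rw [clp_id s h]
  push Not at h
  rcases lt_abs.1 h with h | h
  · have a1 := clp_mono h.le
    have a2 := clp_lip 2 s h.le
    rw [clp_id 2 (by norm_num)] at a1 a2
    nlinarith
  · have a1 := clp_mono h.le
    have a2 := clp_lip 2 (-s) h.le
    rw [clp_id 2 (by norm_num)] at a1 a2
    rw [clp_neg] at a1 a2
    nlinarith
lemma clp_far (s T : ℝ) (hT : T ∈ Icc (-1 : ℝ) 1) (h : 2 < |s|) : 1 ≤ (T - clp s) ^ 2 := by
  obtain ⟨h1, h2⟩ := hT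
  rcases lt_abs.1 h with h | h
  · have a1 := clp_mono h.le
    rw [clp_id 2 (by norm_num)] at a1
    nlinarith
  · have a1 := clp_mono h.le
    rw [clp_id 2 (by norm_num)] at a1
    rw [clp_neg] at a1
    nlinarith
lemma clp_rho (s T : ℝ) (hT : T ∈ Icc (-1 : ℝ) 1) : 1 - rho s ≤ |T - clp s| := by
  by_cases h : |s| ≤ 2
  · rw [rho_one s h]; simp
  push Not at h
  have h1 := clp_far s T hT h
  have h2 := rho_nonneg s
  have : 1 ≤ |T - clp s| := by
    rw [← sq_abs] at h1; nlinarith [abs_nonneg (T - clp s)]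
  linarith

structure QD (n : ℕ) (a a' V S P T : ℝ → ℝ) (M ε e δ b : ℝ) : Prop where
  sd : SD n a a' V S P
  hn : 1 ≤ n
  hM : 2 ≤ M
  supp : ∀ t, M - 1 ≤ |t| → a t = 0 ∧ P t = 0
  ε0 : 0 < ε
  εe : ε ≤ e
  cT : Continuous T
  Tl : T (-M) = -1
  Tr : T M = 1
  TI : ∀ t ∈ Ioo (-M) M, T t ∈ Ioo (-1 : ℝ) 1
  dT : ∀ t ∈ Ioo (-M) M, HasDerivAt T ((a t + ε) / wt n (T t)) t
  mass : ∀ t ∈ Icc (-M) M, ∫ u in (-M)..t, (a u + ε) = ∫ y in (-1)..(T t), wt n y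
  hb : b ∈ Icc (-(M - 1)) (M - 1)
  Tb : T b = 0
  hV : ballVol (n + 1) - e ≤ ∫ t in (-M)..M, V t
  hP : ∫ t in (-M)..M, P t ≤ (n + 1) * ballVol (n + 1) + δ
  δ0 : 0 < δ
  eδ : 2 * (n + 1) * e ≤ δ

section
variable {n : ℕ} {a a' V S P T : ℝ → ℝ} {M ε e δ b : ℝ}

lemma SD.reflect (h : SD n a a' V S P) :
    SD n (fun t => a (-t)) (fun t => - a' (-t)) (fun t => V (-t)) (fun t => S (-t)) (fun t => P (-t)) where
  ca := h.ca.comp continuous_neg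
  ca' := (h.ca'.comp continuous_neg).neg
  cV := h.cV.comp continuous_neg
  cS := h.cS.comp continuous_neg
  cP := h.cP.comp continuous_neg
  da := fun t => by
    have := (h.da (-t)).comp t (hasDerivAt_neg t)
    exact this.congr_deriv (by ring)
  V0 := fun t => h.V0 _
  Va := fun t => h.Va _
  S0 := fun t => h.S0 _
  iso := fun t => h.iso _
  Pge := fun t T hT => by
    have := h.Pge (-t) (-T) ⟨by linarith [hT.2], by linarith [hT.1]⟩
    simp only [neg_sq] at this
    linarith

lemma QD.total (h : QD n a a' V S P T M ε e δ b) : ∫ u in (-M)..M, (a u + ε) = ballVol (n + 1) := by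
  rw [h.mass M ⟨by linarith [h.hM], le_rfl⟩, h.Tr, integral_wt]

lemma SD.cA (h : SD n a a' V S P) (ε : ℝ) : Continuous fun t => a t + ε := h.ca.add continuous_const

lemma QD.mass' (h : QD n a a' V S P T M ε e δ b) (t : ℝ) (ht : t ∈ Icc (-M) M) :
    ∫ u in t..M, (a u + ε) = ∫ y in (T t)..1, wt n y := by
  have h1 := h.mass t ht
  have h2 := h.total
  rw [← integral_wt] at h2
  have h3 := intervalIntegral.integral_add_adjacent_intervals
    ((h.sd.cA ε).intervalIntegrable (-M) t) ((h.sd.cA ε).intervalIntegrable t M) (μ := volume)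
  have h4 := intervalIntegral.integral_add_adjacent_intervals
    (wt_ii n (-1) (T t)) (wt_ii n (T t) 1)
  linarith

lemma QD.reflect (h : QD n a a' V S P T M ε e δ b) :
    QD n (fun t => a (-t)) (fun t => - a' (-t)) (fun t => V (-t)) (fun t => S (-t)) (fun t => P (-t))
      (fun t => - T (-t)) M ε e δ (-b) where
  sd := h.sd.reflect
  hn := h.hn
  hM := h.hM
  supp := fun t ht => h.supp (-t) (by rwa [abs_neg])
  ε0 := h.ε0
  εe := h.εe
  cT := (h.cT.comp continuous_neg).neg
  Tl := by simp [h.Tr]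
  Tr := by simp [h.Tl]
  TI := fun t ht => by
    have := h.TI (-t) ⟨by linarith [ht.2], by linarith [ht.1]⟩
    exact ⟨by linarith [this.2], by linarith [this.1]⟩
  dT := fun t ht => by
    have := ((h.dT (-t) ⟨by linarith [ht.2], by linarith [ht.1]⟩).comp t (hasDerivAt_neg t)).neg
    rw [wt_neg]
    exact this.congr_deriv (by ring)
  mass := fun t ht => by
    have h1 := h.mass' (-t) ⟨by linarith [ht.2], by linarith [ht.1]⟩
    have h2 := intervalIntegral.integral_comp_neg (a := -M) (b := t) (fun u => a u + ε)
    simp only [neg_neg] at h2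
    rw [h2, h1]
    have h3 := intervalIntegral.integral_comp_neg (a := -1) (b := -T (-t)) (wt n)
    simp only [neg_neg, wt_neg] at h3
    exact h3.symm
  hb := ⟨by linarith [h.hb.2], by linarith [h.hb.1]⟩
  Tb := by simp [h.Tb]
  hV := by
    have h2 := intervalIntegral.integral_comp_neg (a := -M) (b := M) V
    simp only [neg_neg] at h2
    rw [h2]; exact h.hV
  hP := by
    have h2 := intervalIntegral.integral_comp_neg (a := -M) (b := M) P
    simp only [neg_neg] at h2
    rw [h2]; exact h.hP
  δ0 := h.δ0
  eδ := h.eδ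

def Tp (n : ℕ) (a T : ℝ → ℝ) (ε t : ℝ) : ℝ := (a t + ε) / wt n (T t)
/-- pointwise deficit -/
def Df (n : ℕ) (a a' V P T : ℝ → ℝ) (ε t : ℝ) : ℝ :=
  P t + T t * a' t + a t * Tp n a T ε t - (n + 1) * V t

lemma SD.a0 (h : SD n a a' V S P) (t : ℝ) : 0 ≤ a t := (h.V0 t).trans (h.Va t)

lemma QD.Tp_pos (h : QD n a a' V S P T M ε e δ b) (t : ℝ) (ht : t ∈ Ioo (-M) M) :
    0 < Tp n a T ε t :=
  div_pos (by linarith [h.sd.a0 t, h.ε0]) (wt_pos n _ (h.TI t ht))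

lemma QD.sub (h : QD n a a' V S P T M ε e δ b) (t : ℝ) (ht : t ∈ Icc (-(M - 1)) (M - 1)) :
    t ∈ Ioo (-M) M := ⟨by linarith [ht.1], by linarith [ht.2]⟩

lemma QD.Tp_cont (h : QD n a a' V S P T M ε e δ b) : ContinuousOn (Tp n a T ε) (Icc (-(M - 1)) (M - 1)) := by
  refine (h.sd.cA ε).continuousOn.div ((wt_cont n).comp h.cT).continuousOn ?_
  intro t ht
  exact (wt_pos n _ (h.TI t (h.sub t ht))).ne'

lemma QD.Df_cont (h : QD n a a' V S P T M ε e δ b) :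
    ContinuousOn (Df n a a' V P T ε) (Icc (-(M - 1)) (M - 1)) := by
  have h1 := h.Tp_cont
  have h2 := h.sd.ca.continuousOn (s := Icc (-(M - 1)) (M - 1))
  have h3 := h.sd.ca'.continuousOn (s := Icc (-(M - 1)) (M - 1))
  have h4 := h.sd.cV.continuousOn (s := Icc (-(M - 1)) (M - 1))
  have h5 := h.sd.cP.continuousOn (s := Icc (-(M - 1)) (M - 1))
  have h6 := h.cT.continuousOn (s := Icc (-(M - 1)) (M - 1))
  unfold Df
  exact ((h5.add (h6.mul h3)).add (h2.mul h1)).sub (continuousOn_const.mul h4)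

lemma trim (F : ℝ → ℝ) (hF : Continuous F) (M : ℝ) (hM : 2 ≤ M) (h0 : ∀ t, M - 1 ≤ |t| → F t = 0) :
    ∫ t in (-(M - 1))..(M - 1), F t = ∫ t in (-M)..M, F t := by
  have hi : ∀ a b, IntervalIntegrable F volume a b := fun a b => hF.intervalIntegrable a b
  rw [← intervalIntegral.integral_add_adjacent_intervals (hi (-M) (-(M-1))) (hi _ M),
    ← intervalIntegral.integral_add_adjacent_intervals (hi (-(M-1)) (M-1)) (hi _ M)]
  have e1 : ∫ t in (-M)..(-(M - 1)), F t = ∫ t in (-M)..(-(M - 1)), (0 : ℝ) := by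
    apply intervalIntegral.integral_congr
    intro u hu
    rw [uIcc_of_le (by linarith)] at hu
    apply h0
    rw [abs_of_nonpos (by linarith [hu.2])]; linarith [hu.2]
  have e2 : ∫ t in (M - 1)..M, F t = ∫ t in (M - 1)..M, (0 : ℝ) := by
    apply intervalIntegral.integral_congr
    intro u hu
    rw [uIcc_of_le (by linarith)] at hu
    apply h0
    rw [abs_of_nonneg (by linarith [hu.1])]; exact hu.1
  rw [e1, e2]; simp

lemma QD.Df_int (h : QD n a a' V S P T M ε e δ b) :
    ∫ t in (-(M - 1))..(M - 1), Df n a a' V P T ε t ≤ 2 * δ := by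
  have hle : -(M - 1) ≤ M - 1 := by linarith [h.hM]
  have hTi : IntervalIntegrable (Tp n a T ε) volume (-(M - 1)) (M - 1) := by
    apply ContinuousOn.intervalIntegrable; rw [uIcc_of_le hle]; exact h.Tp_cont
  have ibp := intervalIntegral.integral_mul_deriv_eq_deriv_mul (a := -(M - 1)) (b := M - 1) (u := T) (v := a)
    (u' := Tp n a T ε) (v' := a')
    (fun t htt => by rw [uIcc_of_le hle] at htt; exact h.dT t (h.sub t htt))
    (fun t _ => h.sd.da t) hTi (h.sd.ca'.intervalIntegrable _ _)
  rw [(h.supp (M - 1) (le_abs_self _)).1, (h.supp (-(M - 1)) (by rw [abs_neg]; exact le_abs_self _)).1] at ibp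
  have i1 : IntervalIntegrable P volume (-(M - 1)) (M - 1) := h.sd.cP.intervalIntegrable _ _
  have i2 : IntervalIntegrable (fun t => T t * a' t) volume (-(M - 1)) (M - 1) :=
    (h.cT.mul h.sd.ca').intervalIntegrable _ _
  have i3 : IntervalIntegrable (fun t => a t * Tp n a T ε t) volume (-(M - 1)) (M - 1) :=
    hTi.continuousOn_mul h.sd.ca.continuousOn
  have i4 : IntervalIntegrable (fun t => ((n : ℝ) + 1) * V t) volume (-(M - 1)) (M - 1) :=
    (h.sd.cV.const_mul _).intervalIntegrable _ _
  unfold Df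
  rw [intervalIntegral.integral_sub ((i1.add i2).add i3) i4, intervalIntegral.integral_add (i1.add i2) i3,
    intervalIntegral.integral_add i1 i2, intervalIntegral.integral_const_mul, ibp,
    trim P h.sd.cP M h.hM (fun t ht => (h.supp t ht).2),
    trim V h.sd.cV M h.hM (fun t ht => le_antisymm ((h.sd.Va t).trans (h.supp t ht).1.le) (h.sd.V0 t))]
  have e : ∫ t in (-(M - 1))..(M - 1), Tp n a T ε t * a t = ∫ t in (-(M - 1))..(M - 1), a t * Tp n a T ε t := by
    simp only [mul_comm]
  rw [e]
  have := h.hV; have := h.hP; have := h.eδ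
  have hn0 : (0 : ℝ) ≤ n := by positivity
  nlinarith [h.δ0]

/-- pointwise decomposition of the deficit -/
lemma QD.split (h : QD n a a' V S P T M ε e δ b) (t : ℝ) (ht : t ∈ Ioo (-M) M) :
    (P t + T t * a' t - √(1 - T t ^ 2) * S t) + (√(1 - T t ^ 2) * S t
      - n * V t * (Tp n a T ε t) ^ (-(1 / (n : ℝ)))) + (a t - V t) * Tp n a T ε t
      + V t * psi n (Tp n a T ε t) = Df n a a' V P T ε t ∧
    0 ≤ P t + T t * a' t - √(1 - T t ^ 2) * S t ∧
    0 ≤ √(1 - T t ^ 2) * S t - n * V t * (Tp n a T ε t) ^ (-(1 / (n : ℝ))) ∧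
    0 ≤ (a t - V t) * Tp n a T ε t ∧ 0 ≤ V t * psi n (Tp n a T ε t) := by
  have hT := h.TI t ht
  have hτ := h.Tp_pos t ht
  refine ⟨?_, ?_, ?_, ?_, ?_⟩
  · unfold Df psi; ring
  · have := h.sd.Pge t (T t) (Ioo_subset_Icc_self hT); linarith
  · have := h.sd.slab h.hn t (a t + ε) 1 (T t) (by linarith [h.sd.a0 t, h.ε0]) (by linarith [h.ε0]) one_pos hT
    simp only [one_mul] at this
    unfold Tp; linarith
  · exact mul_nonneg (by linarith [h.sd.Va t]) hτ.le
  · exact mul_nonneg (h.sd.V0 t) (psi_nonneg n h.hn _ hτ)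
end

def th (n : ℕ) : ℝ := (2 : ℝ) ^ ((1 : ℝ) / (n + 1)) - 1

lemma th_pos (n : ℕ) : 0 < th n := by
  unfold th
  have : (1 : ℝ) < 2 ^ ((1 : ℝ) / (n + 1)) := Real.one_lt_rpow (by norm_num) (by positivity)
  linarith

lemma th_le (n : ℕ) : th n ≤ 1 := by
  unfold th
  have : (2 : ℝ) ^ ((1 : ℝ) / (n + 1)) ≤ 2 ^ (1 : ℝ) := by
    apply Real.rpow_le_rpow_of_exponent_le (by norm_num)
    rw [div_le_one (by positivity)]
    have : (0 : ℝ) ≤ n := by positivity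
    linarith
  rw [Real.rpow_one] at this
  linarith

def cc1 (n : ℕ) : ℝ := (n + 1) * th n / 4
lemma cc1_pos (n : ℕ) : 0 < cc1 n := by unfold cc1; have := th_pos n; positivity

section
variable {n : ℕ} {a a' V S P T : ℝ → ℝ} {M ε e δ b : ℝ}

lemma sub_int {F : ℝ → ℝ} {x0 x1 y0 y1 : ℝ} (hF : IntervalIntegrable F volume x0 x1) (h0 : x0 ≤ y0) (h1 : y0 ≤ y1)
    (h2 : y1 ≤ x1) (hn : ∀ t ∈ Icc x0 x1, 0 ≤ F t) : ∫ t in y0..y1, F t ≤ ∫ t in x0..x1, F t := by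
  have i1 : IntervalIntegrable F volume x0 y0 := hF.mono_set (by
    rw [uIcc_of_le h0, uIcc_of_le (by linarith)]; exact Icc_subset_Icc le_rfl (by linarith))
  have i2 : IntervalIntegrable F volume y0 y1 := hF.mono_set (by
    rw [uIcc_of_le h1, uIcc_of_le (by linarith)]; exact Icc_subset_Icc (by linarith) (by linarith))
  have i3 : IntervalIntegrable F volume y1 x1 := hF.mono_set (by
    rw [uIcc_of_le h2, uIcc_of_le (by linarith)]; exact Icc_subset_Icc (by linarith) le_rfl)
  rw [← intervalIntegral.integral_add_adjacent_intervals i1 (i2.trans i3),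
    ← intervalIntegral.integral_add_adjacent_intervals i2 i3]
  have p1 := intervalIntegral.integral_nonneg (μ := volume) h0 (fun t ht => hn t ⟨ht.1, by linarith [ht.2]⟩)
  have p3 := intervalIntegral.integral_nonneg (μ := volume) h2 (fun t ht => hn t ⟨by linarith [ht.1], ht.2⟩)
  linarith

lemma QD.AV (h : QD n a a' V S P T M ε e δ b) {y0 y1 : ℝ} (h0 : -M ≤ y0) (h1 : y0 ≤ y1) (h2 : y1 ≤ M) :
    ∫ t in y0..y1, (a t + ε - V t) ≤ e := by
  have hc : Continuous fun t => a t + ε - V t := (h.sd.cA ε).sub h.sd.cV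
  refine (sub_int (hc.intervalIntegrable (-M) M) h0 h1 h2 ?_).trans ?_
  · intro t _; linarith [h.sd.Va t, h.ε0]
  · rw [intervalIntegral.integral_sub ((h.sd.cA ε).intervalIntegrable _ _) (h.sd.cV.intervalIntegrable _ _), h.total]
    linarith [h.hV]

lemma QD.cut (h : QD n a a' V S P T M ε e δ b) (t : ℝ) (ht : t ∈ Ioo (-M) M)
    (hm : ∫ u in t..M, (a u + ε) ≤ ballVol (n + 1) / 2) :
    4 * cc1 n * (∫ u in t..M, (a u + ε)) ≤ 2 * (a t + ε) + 2 * δ := by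
  have hω := ballVol_pos (n + 1)
  have hiA : ∀ x y, IntervalIntegrable (fun u => a u + ε) volume x y := fun x y => (h.sd.cA ε).intervalIntegrable _ _
  have hia : ∀ x y, IntervalIntegrable a volume x y := fun x y => h.sd.ca.intervalIntegrable _ _
  have hiP : ∀ x y, IntervalIntegrable P volume x y := fun x y => h.sd.cP.intervalIntegrable _ _
  have hiV : ∀ x y, IntervalIntegrable V volume x y := fun x y => h.sd.cV.intervalIntegrable _ _
  have s1 := h.sd.step h.hn t M ht.2
  have s2 := h.sd.step h.hn (-M) t ht.1
  have z1 : a M = 0 := (h.supp M (by rw [abs_of_nonneg (by linarith [h.hM])]; linarith)).1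
  have z2 : a (-M) = 0 := (h.supp (-M) (by rw [abs_neg, abs_of_nonneg (by linarith [h.hM])]; linarith)).1
  have hP0 : ∀ t, 0 ≤ P t := fun t => by
    have := h.sd.Pge t 0 (by constructor <;> norm_num)
    simp at this; linarith [h.sd.S0 t]
  have m1 : (∫ u in t..M, a u) ≤ ∫ u in t..M, (a u + ε) :=
    intervalIntegral.integral_mono_on ht.2.le (hia _ _) (hiA _ _) (fun u _ => by linarith [h.ε0])
  have m2 : (∫ u in (-M)..t, a u) ≤ ballVol (n + 1) := by
    have q := intervalIntegral.integral_mono_on ht.1.le (hia _ _) (hiA _ _) (fun u _ => by linarith [h.ε0] : ∀ u ∈ Icc (-M) t, a u ≤ a u + ε)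
    have q2 := sub_int (hiA (-M) M) le_rfl ht.1.le ht.2.le (fun u _ => by linarith [h.sd.a0 u, h.ε0])
    linarith [h.total]
  have n1 : 0 ≤ ∫ u in t..M, a u := intervalIntegral.integral_nonneg ht.2.le (fun u _ => h.sd.a0 u)
  have n2 : 0 ≤ ∫ u in (-M)..t, a u := intervalIntegral.integral_nonneg ht.1.le (fun u _ => h.sd.a0 u)
  have p1 : 0 ≤ ∫ u in t..M, P u := intervalIntegral.integral_nonneg ht.2.le (fun u _ => hP0 u)
  have p2 : 0 ≤ ∫ u in (-M)..t, P u := intervalIntegral.integral_nonneg ht.1.le (fun u _ => hP0 u)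
  have v1 : 0 ≤ ∫ u in t..M, V u := intervalIntegral.integral_nonneg ht.2.le (fun u _ => h.sd.V0 u)
  have hat := h.sd.a0 t
  have r1 : ((∫ u in t..M, a u) / ballVol (n + 1)) ^ ((1 : ℝ) / (n + 1)) ≤ (1 / 2 : ℝ) ^ ((1 : ℝ) / (n + 1)) := by
    apply Real.rpow_le_rpow (by positivity) _ (by positivity)
    rw [div_le_iff₀ hω]; linarith
  have r2 : ((∫ u in (-M)..t, a u) / ballVol (n + 1)) ^ ((1 : ℝ) / (n + 1)) ≤ 1 := by
    apply Real.rpow_le_one (by positivity) _ (by positivity)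
    rw [div_le_one hω]; exact m2
  have r3 : (1 / 2 : ℝ) ^ ((1 : ℝ) / (n + 1)) * (1 + th n) = 1 := by
    unfold th
    rw [add_sub_cancel, ← Real.mul_rpow (by norm_num) (by norm_num)]; norm_num
  have t1 : (n + 1) * (∫ u in t..M, V u) * (1 + th n) ≤ (∫ u in t..M, P u) + a t := by
    have q : (n + 1) * (∫ u in t..M, V u) ≤ (1 / 2 : ℝ) ^ ((1 : ℝ) / (n + 1)) * ((∫ u in t..M, P u) + a t) := by
      refine s1.trans ?_
      rw [z1, add_zero]
      exact mul_le_mul_of_nonneg_right r1 (by linarith)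
    have := mul_le_mul_of_nonneg_right q (by linarith [th_pos n] : 0 ≤ 1 + th n)
    calc _ ≤ _ := this
      _ = ((1 / 2 : ℝ) ^ ((1 : ℝ) / (n + 1)) * (1 + th n)) * ((∫ u in t..M, P u) + a t) := by ring
      _ = _ := by rw [r3, one_mul]
  have t2 : (n + 1) * (∫ u in (-M)..t, V u) ≤ (∫ u in (-M)..t, P u) + a t := by
    refine s2.trans ?_
    rw [z2, add_zero]
    have := mul_le_mul_of_nonneg_right r2 (by linarith : 0 ≤ (∫ u in (-M)..t, P u) + a t)
    linarith
  have sP := intervalIntegral.integral_add_adjacent_intervals (hiP (-M) t) (hiP t M)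
  have sV := intervalIntegral.integral_add_adjacent_intervals (hiV (-M) t) (hiV t M)
  have av := h.AV ht.1.le ht.2.le le_rfl
  rw [intervalIntegral.integral_sub (hiA _ _) (hiV _ _)] at av
  have hV := h.hV; have hP := h.hP; have he := h.eδ
  set μ := ∫ u in t..M, (a u + ε)
  set Vp := ∫ u in t..M, V u
  set Vm := ∫ u in (-M)..t, V u
  have hth := th_pos n
  have hth1 := th_le n
  have hn0 : (0 : ℝ) ≤ n := by positivity
  have he0 : 0 ≤ e := h.ε0.le.trans h.εe
  have k1 : (n + 1) * th n * Vp ≤ 2 * a t + δ + (n + 1) * e := by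
    have : (n + 1) * (ballVol (n + 1) - e) ≤ (n + 1) * (Vm + Vp) :=
      mul_le_mul_of_nonneg_left (by linarith) (by linarith)
    nlinarith
  have k2 : (n + 1) * th n * μ ≤ (n + 1) * th n * (Vp + e) :=
    mul_le_mul_of_nonneg_left (by linarith) (by positivity)
  have k3 : (n + 1) * th n * e ≤ (n + 1) * e := by
    have : 0 ≤ (n + 1 : ℝ) * e := by positivity
    nlinarith
  unfold cc1
  have := h.ε0
  nlinarith

/-- Hardy type inequality -/
lemma hardy (A μ T T' : ℝ → ℝ) (b t1 : ℝ) (hbt : b ≤ t1) (hA : ContinuousOn A (Icc b t1))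
    (hT' : ContinuousOn T' (Icc b t1)) (hT : ∀ t ∈ Icc b t1, HasDerivAt T (T' t) t)
    (hμ : ∀ t ∈ Icc b t1, HasDerivAt μ (-(A t)) t) (hA0 : ∀ t ∈ Icc b t1, 0 < A t) (hμ1 : 0 ≤ μ t1)
    (hTb : T b = 0) :
    ∫ t in b..t1, A t * (T t - (t - b)) ^ 2 ≤ 4 * ∫ t in b..t1, μ t ^ 2 * (T' t - 1) ^ 2 / A t := by
  have cT : ContinuousOn T (Icc b t1) := fun t ht => (hT t ht).continuousAt.continuousWithinAt
  have cμ : ContinuousOn μ (Icc b t1) := fun t ht => (hμ t ht).continuousAt.continuousWithinAt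
  have cg : ContinuousOn (fun t => T t - (t - b)) (Icc b t1) := cT.sub (by fun_prop)
  have dG : ∀ t ∈ uIcc b t1, HasDerivAt (fun t => μ t * (T t - (t - b)) ^ 2)
      (-(A t) * (T t - (t - b)) ^ 2 + μ t * (2 * (T t - (t - b)) * (T' t - 1))) t := by
    intro t ht
    rw [uIcc_of_le hbt] at ht
    have d1 := (hT t ht).sub ((hasDerivAt_id t).sub_const b)
    have d2 := (hμ t ht).mul (d1.pow 2)
    refine (d2.congr_deriv ?_)
    simp
  have hi : IntervalIntegrable (fun t => -(A t) * (T t - (t - b)) ^ 2 + μ t * (2 * (T t - (t - b)) * (T' t - 1))) volume b t1 := by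
    apply ContinuousOn.intervalIntegrable; rw [uIcc_of_le hbt]
    exact (hA.neg.mul (cg.pow 2)).add (cμ.mul ((continuousOn_const.mul cg).mul (hT'.sub continuousOn_const)))
  have ftc := intervalIntegral.integral_eq_sub_of_hasDerivAt dG hi
  have i1 : IntervalIntegrable (fun t => A t * (T t - (t - b)) ^ 2) volume b t1 := by
    apply ContinuousOn.intervalIntegrable; rw [uIcc_of_le hbt]
    exact hA.mul (cg.pow 2)
  have i2 : IntervalIntegrable (fun t => μ t ^ 2 * (T' t - 1) ^ 2 / A t) volume b t1 := by
    apply ContinuousOn.intervalIntegrable; rw [uIcc_of_le hbt]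
    exact ((cμ.pow 2).mul ((hT'.sub continuousOn_const).pow 2)).div hA (fun t ht => (hA0 t ht).ne')
  have mono := intervalIntegral.integral_mono_on hbt hi ((i1.const_mul (-(1/2))).add (i2.const_mul 2)) (by
    intro t ht
    have hAt := hA0 t ht
    rw [← sub_nonneg]
    have : -(1/2) * (A t * (T t - (t - b)) ^ 2) + 2 * (μ t ^ 2 * (T' t - 1) ^ 2 / A t) -
      (-(A t) * (T t - (t - b)) ^ 2 + μ t * (2 * (T t - (t - b)) * (T' t - 1))) =
      (A t * (T t - (t - b)) - 2 * μ t * (T' t - 1)) ^ 2 / (2 * A t) := by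
      field_simp; ring
    rw [this]; positivity)
  rw [ftc] at mono
  have e2 := intervalIntegral.integral_add (i1.const_mul (-(1/2))) (i2.const_mul 2)
  rw [e2, intervalIntegral.integral_const_mul, intervalIntegral.integral_const_mul, hTb] at mono
  simp only [sub_self, ne_eq, OfNat.ofNat_ne_zero, not_false_eq_true, zero_pow, mul_zero, sub_zero] at mono
  have : 0 ≤ μ t1 * (T t1 - (t1 - b)) ^ 2 := mul_nonneg hμ1 (sq_nonneg _)
  linarith

lemma wt_le (n : ℕ) (y : ℝ) : wt n y ≤ ballVol n := by
  unfold wt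
  have h1 : √(1 - y ^ 2) ≤ 1 := by
    rw [Real.sqrt_le_one]; nlinarith [sq_nonneg y]
  have := pow_le_one₀ (n := n) (Real.sqrt_nonneg _) h1
  nlinarith [ballVol_pos n]

lemma wt_anti (n : ℕ) (y z : ℝ) (h0 : 0 ≤ y) (h : y ≤ z) : wt n z ≤ wt n y := by
  unfold wt
  apply mul_le_mul_of_nonneg_left _ (ballVol_pos n).le
  apply pow_le_pow_left₀ (Real.sqrt_nonneg _)
  apply Real.sqrt_le_sqrt
  nlinarith

lemma wt_tail (n : ℕ) (y : ℝ) (h0 : 0 ≤ y) (h1 : y ≤ 1) : ∫ z in y..1, wt n z ≤ wt n y := by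
  have := intervalIntegral.integral_mono_on h1 (wt_ii n y 1) (by simp : IntervalIntegrable (fun _ => wt n y) volume y 1)
    (fun z hz => wt_anti n y z h0 hz.1)
  rw [intervalIntegral.integral_const, smul_eq_mul] at this
  nlinarith [wt_nonneg n y]

lemma wt_half (n : ℕ) : ∫ z in (0:ℝ)..1, wt n z = ballVol (n + 1) / 2 := by
  have h1 := intervalIntegral.integral_add_adjacent_intervals (wt_ii n (-1) 0) (wt_ii n 0 1)
  rw [integral_wt] at h1
  have h2 := intervalIntegral.integral_comp_neg (a := 0) (b := 1) (wt n)
  simp only [wt_neg, neg_zero] at h2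
  linarith

def CH1 (n : ℕ) : ℝ := 8 * n ^ 2 + 6 * n / cc1 n ^ 2
def CH (n : ℕ) : ℝ := 28 * CH1 n + 16 / cc1 n
lemma CH1_nonneg (n : ℕ) : 0 ≤ CH1 n := by unfold CH1; positivity
lemma CH_nonneg (n : ℕ) : 0 ≤ CH n := by
  unfold CH; have := CH1_nonneg n; have := cc1_pos n; positivity

lemma hardy_pt (n : ℕ) (hn : 1 ≤ n) (A μ τ : ℝ) (hA : 0 < A) (hμ : 0 ≤ μ) (hτ : 0 < τ)
    (h1 : cc1 n * μ ≤ A) (h2 : μ * τ ≤ A) :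
    μ ^ 2 * (τ - 1) ^ 2 / A ≤ CH1 n * (A * psi n τ) := by
  have hψ := psi_nonneg n hn τ hτ
  have hc := cc1_pos n
  rw [div_le_iff₀ hA]
  by_cases h : 1 / 2 ≤ τ
  · have p := psi_lower1 n hn τ h
    have q : μ ^ 2 * (τ - 1) ^ 2 ≤ 8 * n ^ 2 * (A ^ 2 * psi n τ) := by
      have q1 : (μ * τ) ^ 2 ≤ A ^ 2 := pow_le_pow_left₀ (by positivity) h2 2
      have q2 : μ ^ 2 * τ ≤ 2 * A ^ 2 := by nlinarith [sq_nonneg μ]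
      calc μ ^ 2 * (τ - 1) ^ 2 ≤ μ ^ 2 * (4 * n ^ 2 * (τ * psi n τ)) := mul_le_mul_of_nonneg_left p (sq_nonneg _)
        _ = (μ ^ 2 * τ) * (4 * n ^ 2 * psi n τ) := by ring
        _ ≤ (2 * A ^ 2) * (4 * n ^ 2 * psi n τ) := mul_le_mul_of_nonneg_right q2 (by positivity)
        _ = _ := by ring
    have : 0 ≤ 6 * n / cc1 n ^ 2 * (A ^ 2 * psi n τ) := by positivity
    unfold CH1; nlinarith
  · push Not at h
    have p := psi_lower2 n hn τ hτ h.le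
    have q1 : μ ^ 2 ≤ A ^ 2 / cc1 n ^ 2 := by
      rw [le_div_iff₀ (by positivity)]
      have := pow_le_pow_left₀ (by positivity) h1 2
      nlinarith
    have q2 : (τ - 1) ^ 2 ≤ 1 := by nlinarith
    have q : μ ^ 2 * (τ - 1) ^ 2 ≤ 6 * n / cc1 n ^ 2 * (A ^ 2 * psi n τ) := by
      calc μ ^ 2 * (τ - 1) ^ 2 ≤ A ^ 2 / cc1 n ^ 2 * 1 := mul_le_mul q1 q2 (sq_nonneg _) (by positivity)
        _ ≤ A ^ 2 / cc1 n ^ 2 * (6 * n * psi n τ) := mul_le_mul_of_nonneg_left p (by positivity)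
        _ = _ := by ring
    have : 0 ≤ 8 * n ^ 2 * (A ^ 2 * psi n τ) := by positivity
    unfold CH1; nlinarith

lemma QD.right (h : QD n a a' V S P T M ε e δ b) (hδ : δ / cc1 n ≤ ballVol (n + 1) / 2)
    (he : n * (δ / ballVol n) ^ (-(1 / (n : ℝ))) * e ≤ δ) :
    ∫ t in b..(M - 1), (a t + ε) * (T t - clp (t - b)) ^ 2 ≤ CH n * δ := by
  have hc := cc1_pos n
  have hω := ballVol_pos (n + 1)
  have hωn := ballVol_pos n
  have hδ0 := h.δ0
  have hM := h.hM
  set μ : ℝ → ℝ := fun t => ∫ u in t..M, (a u + ε) with hμ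
  have hiA : ∀ x y, IntervalIntegrable (fun u => a u + ε) volume x y := fun x y => (h.sd.cA ε).intervalIntegrable _ _
  have hApos : ∀ t, 0 < a t + ε := fun t => by linarith [h.sd.a0 t, h.ε0]
  have dμ : ∀ t, HasDerivAt μ (-(a t + ε)) t := fun t =>
    intervalIntegral.integral_hasDerivAt_left (hiA _ _)
      ((h.sd.cA ε).stronglyMeasurableAtFilter _ _) (h.sd.cA ε).continuousAt
  have cμ : Continuous μ := continuous_iff_continuousAt.2 fun t => (dμ t).continuousAt
  have anti : ∀ s t, s ≤ t → t ≤ M → μ t ≤ μ s := fun s t hst htM =>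
    sub_int (hiA s M) hst htM le_rfl (fun u _ => (hApos u).le)
  have hbM : b ∈ Icc (-M) M := ⟨by linarith [h.hb.1], by linarith [h.hb.2]⟩
  have μb : μ b = ballVol (n + 1) / 2 := by
    simp only [hμ]; rw [h.mass' b hbM, h.Tb, wt_half]
  have hth1 := th_le n
  have hn0 : (1 : ℝ) ≤ n := by exact_mod_cast h.hn
  have hεδ : ε ≤ δ / cc1 n := by
    rw [le_div_iff₀ hc]
    have h1 := h.eδ; have h2 := h.εe; have h3 := h.ε0
    have h4 : cc1 n ≤ n + 1 := by unfold cc1; nlinarith [th_pos n]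
    nlinarith
  have μl : μ (M - 1) ≤ δ / cc1 n := by
    have : μ (M - 1) = ∫ u in (M - 1)..M, ε := by
      simp only [hμ]
      apply intervalIntegral.integral_congr
      intro u hu
      rw [uIcc_of_le (by linarith)] at hu
      simp only
      rw [(h.supp u (by rw [abs_of_nonneg (by linarith [hu.1])]; exact hu.1)).1, zero_add]
    rw [this]; simp; exact hεδ
  obtain ⟨t1, ht1, ht1'⟩ : ∃ t1 ∈ Icc b (M - 1), μ t1 = δ / cc1 n :=
    intermediate_value_Icc' h.hb.2 cμ.continuousOn ⟨μl, by rw [μb]; exact hδ⟩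
  have hsub : ∀ t ∈ Icc b t1, t ∈ Icc (-(M - 1)) (M - 1) := fun t ht =>
    ⟨by linarith [ht.1, h.hb.1], by linarith [ht.2, ht1.2]⟩
  have Tmono : ∀ t ∈ Icc b t1, 0 ≤ T t := by
    intro t ht
    have hm : MonotoneOn T (Icc b t1) := by
      apply monotoneOn_of_deriv_nonneg (convex_Icc _ _) h.cT.continuousOn
      · intro s hs
        rw [interior_Icc] at hs
        exact (h.dT s (h.sub s (hsub s (Ioo_subset_Icc_self hs)))).differentiableAt.differentiableWithinAt
      · intro s hs
        rw [interior_Icc] at hs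
        have hs' := h.sub s (hsub s (Ioo_subset_Icc_self hs))
        rw [(h.dT s hs').deriv]
        exact (h.Tp_pos s hs').le
    have := hm (left_mem_Icc.2 ht1.1) ht ht.1
    rwa [h.Tb] at this
  have hgood : ∀ t ∈ Icc b t1, cc1 n * μ t ≤ a t + ε ∧ μ t * Tp n a T ε t ≤ a t + ε ∧
      δ / ballVol n ≤ Tp n a T ε t ∧ 0 ≤ μ t := by
    intro t ht
    have ht' := h.sub t (hsub t ht)
    have hge : δ / cc1 n ≤ μ t := by rw [← ht1']; exact anti t t1 ht.2 (by linarith [ht1.2])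
    have hle : μ t ≤ ballVol (n + 1) / 2 := by rw [← μb]; exact anti b t ht.1 ht'.2.le
    have cut := h.cut t ht' hle
    have hge' : δ ≤ cc1 n * μ t := by rwa [div_le_iff₀' hc] at hge
    have g1 : cc1 n * μ t ≤ a t + ε := by
      have : 4 * cc1 n * μ t ≤ 2 * (a t + ε) + 2 * δ := cut
      nlinarith
    have hw := wt_pos n _ (h.TI t ht')
    refine ⟨g1, ?_, ?_, le_trans (by positivity) hge⟩
    · unfold Tp
      have m1 : μ t ≤ wt n (T t) := by
        simp only [hμ]
        rw [h.mass' t (Ioo_subset_Icc_self ht')]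
        exact wt_tail n _ (Tmono t ht) (h.TI t ht').2.le
      calc _ ≤ wt n (T t) * ((a t + ε) / wt n (T t)) :=
            mul_le_mul_of_nonneg_right m1 (h.Tp_pos t ht').le
        _ = _ := by field_simp
    · unfold Tp
      exact div_le_div₀ (hApos t).le (hge'.trans g1) hw (wt_le n _)
  have cTp : ContinuousOn (Tp n a T ε) (Icc b t1) := h.Tp_cont.mono hsub
  have H := hardy (fun t => a t + ε) μ T (Tp n a T ε) b t1 ht1.1 (h.sd.cA ε).continuousOn cTp
    (fun t ht => h.dT t (h.sub t (hsub t ht))) (fun t _ => dμ t) (fun t _ => hApos t) (hgood t1 (right_mem_Icc.2 ht1.1)).2.2.2 h.Tb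
  set lam := (δ / ballVol n) ^ (-(1 / (n : ℝ))) with hlam
  have cD : ContinuousOn (Df n a a' V P T ε) (Icc b t1) := h.Df_cont.mono hsub
  have iD : IntervalIntegrable (Df n a a' V P T ε) volume b t1 := by
    apply ContinuousOn.intervalIntegrable; rwa [uIcc_of_le ht1.1]
  have iT : IntervalIntegrable (Tp n a T ε) volume b t1 := by
    apply ContinuousOn.intervalIntegrable; rwa [uIcc_of_le ht1.1]
  have iAV : IntervalIntegrable (fun t => a t + ε - V t) volume b t1 :=
    ((h.sd.cA ε).sub h.sd.cV).intervalIntegrable _ _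
  have iH : IntervalIntegrable (fun t => μ t ^ 2 * (Tp n a T ε t - 1) ^ 2 / (a t + ε)) volume b t1 := by
    apply ContinuousOn.intervalIntegrable; rw [uIcc_of_le ht1.1]
    exact ((cμ.pow 2).continuousOn.mul ((cTp.sub continuousOn_const).pow 2)).div (h.sd.cA ε).continuousOn (fun t _ => (hApos t).ne')
  have B := intervalIntegral.integral_mono_on ht1.1 iH
    ((((iD.const_mul 2).add (iT.const_mul ε)).add (iAV.const_mul (n * lam))).const_mul (CH1 n)) (by
    intro t ht
    have ht' := h.sub t (hsub t ht)
    obtain ⟨g1, g2, g3, g4⟩ := hgood t ht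
    have hτ := h.Tp_pos t ht'
    refine (hardy_pt n h.hn (a t + ε) (μ t) _ (hApos t) g4 hτ g1 g2).trans ?_
    apply mul_le_mul_of_nonneg_left _ (CH1_nonneg n)
    obtain ⟨s0, s1, s2, s3, s4⟩ := h.split t ht'
    have hlam' : (Tp n a T ε t) ^ (-(1 / (n : ℝ))) ≤ lam := by
      rw [hlam, Real.rpow_neg hτ.le, Real.rpow_neg (by positivity)]
      apply inv_anti₀ (by positivity)
      exact Real.rpow_le_rpow (by positivity) g3 (by positivity)
    have hAV : 0 ≤ a t + ε - V t := by linarith [h.sd.Va t, h.ε0]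
    have k1 : (a t + ε - V t) * psi n (Tp n a T ε t) ≤ (a t + ε - V t) * (Tp n a T ε t + n * lam) := by
      apply mul_le_mul_of_nonneg_left _ hAV
      unfold psi
      nlinarith
    nlinarith)
  have j1 : ∫ t in b..t1, Df n a a' V P T ε t ≤ 2 * δ := by
    refine (sub_int (x0 := -(M - 1)) (x1 := M - 1) ?_ h.hb.1 ht1.1 ht1.2 ?_).trans h.Df_int
    · apply ContinuousOn.intervalIntegrable; rw [uIcc_of_le (by linarith)]; exact h.Df_cont
    · intro t ht
      obtain ⟨s0, s1, s2, s3, s4⟩ := h.split t (h.sub t ht)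
      linarith
  have j2 : ∫ t in b..t1, Tp n a T ε t ≤ 1 := by
    rw [intervalIntegral.integral_eq_sub_of_hasDerivAt (f := T) (fun t ht => by
      rw [uIcc_of_le ht1.1] at ht; exact h.dT t (h.sub t (hsub t ht))) iT, h.Tb]
    linarith [(h.TI t1 (h.sub t1 (hsub t1 (right_mem_Icc.2 ht1.1)))).2]
  have j3 : ∫ t in b..t1, (a t + ε - V t) ≤ e := h.AV (by linarith [h.hb.1]) ht1.1 (by linarith [ht1.2])
  rw [intervalIntegral.integral_const_mul, intervalIntegral.integral_add ((iD.const_mul 2).add (iT.const_mul ε)) (iAV.const_mul (n * lam)),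
    intervalIntegral.integral_add (iD.const_mul 2) (iT.const_mul ε), intervalIntegral.integral_const_mul,
    intervalIntegral.integral_const_mul, intervalIntegral.integral_const_mul] at B
  have hlam0 : 0 ≤ lam := by positivity
  have j4 : 2 * (∫ t in b..t1, Df n a a' V P T ε t) + ε * (∫ t in b..t1, Tp n a T ε t) +
      n * lam * (∫ t in b..t1, (a t + ε - V t)) ≤ 7 * δ := by
    have k2 : ε * (∫ t in b..t1, Tp n a T ε t) ≤ ε * 1 := mul_le_mul_of_nonneg_left j2 h.ε0.le
    have k3 : n * lam * (∫ t in b..t1, (a t + ε - V t)) ≤ n * lam * e := mul_le_mul_of_nonneg_left j3 (by positivity)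
    have := h.εe; have := h.eδ; have := h.ε0
    nlinarith
  have B2 := B.trans (mul_le_mul_of_nonneg_left j4 (CH1_nonneg n))
  have chT : Continuous fun t => (T t - clp (t - b)) ^ 2 := by
    have : Continuous clp := continuous_iff_continuousAt.2 fun t => (clp_deriv t).continuousAt
    exact (h.cT.sub (this.comp (by fun_prop))).pow 2
  have ih : ∀ x y, IntervalIntegrable (fun t => (a t + ε) * (T t - clp (t - b)) ^ 2) volume x y := fun x y =>
    ((h.sd.cA ε).mul chT).intervalIntegrable _ _
  have ig : ∀ x y, IntervalIntegrable (fun t => (a t + ε) * (T t - (t - b)) ^ 2) volume x y := fun x y =>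
    ((h.sd.cA ε).mul ((h.cT.sub (by fun_prop)).pow 2)).intervalIntegrable _ _
  have R1 := intervalIntegral.integral_mono_on ht1.1 (ih b t1) (ig b t1) (fun t ht =>
    mul_le_mul_of_nonneg_left (clp_cmp (t - b) (T t) (Ioo_subset_Icc_self (h.TI t (h.sub t (hsub t ht))))) (hApos t).le)
  have R2 := intervalIntegral.integral_mono_on ht1.2 (ih t1 (M - 1)) ((hiA t1 (M - 1)).const_mul 16) (fun t ht => by
    have hT := h.TI t (h.sub t ⟨by linarith [ht.1, ht1.1, h.hb.1], ht.2⟩)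
    have hcl := abs_le.1 (clp_abs (t - b))
    have : (T t - clp (t - b)) ^ 2 ≤ 16 := by nlinarith [hT.1, hT.2, hcl.1, hcl.2]
    have := mul_le_mul_of_nonneg_left this (hApos t).le
    linarith)
  rw [intervalIntegral.integral_const_mul] at R2
  have R3 : ∫ t in t1..(M - 1), (a t + ε) ≤ δ / cc1 n := by
    rw [← ht1']
    exact sub_int (hiA t1 M) le_rfl ht1.2 (by linarith) (fun u _ => (hApos u).le)
  rw [← intervalIntegral.integral_add_adjacent_intervals (ih b t1) (ih t1 (M - 1))]
  have : CH n * δ = 4 * (CH1 n * (7 * δ)) + 16 * (δ / cc1 n) := by unfold CH; ring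
  rw [this]
  linarith
end

section
variable {n : ℕ} {a a' V S P T : ℝ → ℝ} {M ε e δ b : ℝ}

lemma QD.both (h : QD n a a' V S P T M ε e δ b) (hδ : δ / cc1 n ≤ ballVol (n + 1) / 2)
    (he : n * (δ / ballVol n) ^ (-(1 / (n : ℝ))) * e ≤ δ) :
    ∫ t in (-(M - 1))..(M - 1), (a t + ε) * (T t - clp (t - b)) ^ 2 ≤ 2 * CH n * δ := by
  have h1 := h.right hδ he
  have h2 := h.reflect.right hδ he
  have hc : Continuous fun t => (a t + ε) * (T t - clp (t - b)) ^ 2 := by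
    have : Continuous clp := continuous_iff_continuousAt.2 fun s => (clp_deriv s).continuousAt
    have := h.sd.cA ε
    have := h.cT
    fun_prop
  have h3 := intervalIntegral.integral_comp_neg (a := -b) (b := M - 1)
    (fun t => (a t + ε) * (T t - clp (t - b)) ^ 2)
  rw [neg_neg] at h3
  have e1 : ∀ t, (a (-t) + ε) * (-T (-t) - clp (t - -b)) ^ 2 = (a (-t) + ε) * (T (-t) - clp (-t - b)) ^ 2 := by
    intro t
    have : t - -b = -(-t - b) := by ring
    rw [this, clp_neg]; ring
  simp only [e1] at h2
  rw [h3] at h2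
  rw [← intervalIntegral.integral_add_adjacent_intervals (hc.intervalIntegrable _ b) (hc.intervalIntegrable _ _)]
  linarith

lemma psi_mix (n : ℕ) (hn : 1 ≤ n) (τ η : ℝ) (hτ : 0 < τ) (hη : |η| ≤ 4) :
    2 * |η| * |τ - 1| ≤ η ^ 2 + 64 * n ^ 2 * psi n τ := by
  have h0 := psi_nonneg n hn τ hτ
  have hn1 : (1 : ℝ) ≤ n := by exact_mod_cast hn
  have hη0 := abs_nonneg η
  have hn2 : (n : ℝ) ≤ n ^ 2 := by nlinarith
  have hnp := mul_nonneg (sub_nonneg.2 hn2) h0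
  rcases lt_or_ge τ (1/2) with h | h
  · have := psi_lower2 n hn τ hτ h.le
    rw [abs_of_nonpos (by linarith : τ - 1 ≤ 0)]
    nlinarith [sq_nonneg η, mul_nonneg hη0 hτ.le]
  · have := psi_lower1 n hn τ h
    rcases le_or_gt τ 2 with h2 | h2
    · have := mul_nonneg (mul_nonneg (sq_nonneg (n : ℝ)) h0) (sub_nonneg.2 h2)
      have := mul_nonneg (sq_nonneg (n : ℝ)) h0
      nlinarith [sq_nonneg (|η| - |τ - 1|), sq_abs η, sq_abs (τ - 1)]
    · rw [abs_of_nonneg (by linarith : 0 ≤ τ - 1)]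
      have hp := mul_nonneg (sq_nonneg (n : ℝ)) h0
      have : τ - 1 ≤ 8 * n ^ 2 * psi n τ := by
        have h3 : (τ - 1) * (τ - 1) ≤ (8 * n ^ 2 * psi n τ) * (τ - 1) := by nlinarith
        exact le_of_mul_le_mul_right h3 (by linarith)
      nlinarith [sq_nonneg η, mul_nonneg (sub_nonneg.2 hη) (by linarith : 0 ≤ τ - 1)]

lemma trace_pt (n : ℕ) (hn : 1 ≤ n) (a a' V P T τ c ρ D : ℝ) (hT : T ∈ Icc (-1:ℝ) 1) (hc : |c| ≤ 3)
    (hV : 0 ≤ V) (hVa : V ≤ a) (hτ : 0 < τ) (hρ : 1 - ρ ≤ |T - c|) (hρ1 : ρ ≤ 1)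
    (hD : D = P + T * a' + a * τ - (n + 1) * V) (hD1 : (a - V) * τ ≤ D) (hD2 : V * psi n τ ≤ D) (hD0 : 0 ≤ D) :
    (T - c) ^ 2 * P ≤ (24 + 64 * n ^ 2) * D + 8 * (a - V) + (n + 4) * ((T - c) ^ 2 * a) -
      (2 * (T - c) * (τ - ρ) * (T * a) + (T - c) ^ 2 * (τ * a + T * a')) := by
  set η := T - c with hη
  have hT1 : |T| ≤ 1 := abs_le.2 hT
  have hη4 : |η| ≤ 4 := by
    have := abs_sub T c
    rw [hη]; linarith
  have hη0 := abs_nonneg η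
  have ha0 : 0 ≤ a := hV.trans hVa
  have hηs : η ^ 2 ≤ 16 := by rw [← sq_abs]; nlinarith
  have h0 := psi_mix n hn τ η hτ hη4
  have k1 : 2 * η * (τ - ρ) * (T * a) ≤ (2 * |η| * |τ - 1| + 2 * η ^ 2) * a := by
    have e1 : |2 * η * (τ - ρ) * T| ≤ 2 * |η| * |τ - 1| + 2 * η ^ 2 := by
      rw [abs_mul, abs_mul, abs_mul, abs_two]
      have e2 : |τ - ρ| ≤ |τ - 1| + |η| := by
        have := abs_add_le (τ - 1) (1 - ρ)
        rw [abs_of_nonneg (by linarith : 0 ≤ 1 - ρ)] at this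
        have e : τ - 1 + (1 - ρ) = τ - ρ := by ring
        rw [e] at this; linarith
      have e3 : 2 * |η| * |τ - ρ| ≤ 2 * |η| * (|τ - 1| + |η|) := by gcongr
      have e4 : 2 * |η| * |τ - ρ| * |T| ≤ 2 * |η| * |τ - ρ| * 1 := by gcongr
      rw [← sq_abs η]
      nlinarith
    have := mul_le_mul_of_nonneg_right ((le_abs_self _).trans e1) ha0
    linarith [this]
  have k2 : 2 * |η| * |τ - 1| * a ≤ η ^ 2 * a + 64 * n ^ 2 * D + 8 * D + 8 * (a - V) := by
    have e1 := mul_le_mul_of_nonneg_right h0 hV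
    have e2 : |τ - 1| ≤ τ + 1 := abs_le.2 ⟨by linarith, by linarith⟩
    have e3 : 2 * |η| * |τ - 1| ≤ 8 * (τ + 1) := by
      have : 2 * |η| * |τ - 1| ≤ 2 * 4 * (τ + 1) := by gcongr
      linarith
    have e4 := mul_le_mul_of_nonneg_right e3 (sub_nonneg.2 hVa)
    have e5 := mul_le_mul_of_nonneg_left hD2 (by positivity : (0:ℝ) ≤ 64 * n ^ 2)
    have e6 := mul_le_mul_of_nonneg_left hVa (sq_nonneg η)
    linarith
  have k3 : η ^ 2 * D ≤ 16 * D := mul_le_mul_of_nonneg_right hηs hD0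
  have k4 : (n + 1) * (η ^ 2 * V) ≤ (n + 1) * (η ^ 2 * a) := by gcongr
  have e : η ^ 2 * P = η ^ 2 * D - η ^ 2 * (τ * a + T * a') + (n + 1) * (η ^ 2 * V) := by rw [hD]; ring
  rw [e]
  linarith

def CT (n : ℕ) : ℝ := 2 * (24 + 64 * n ^ 2) + 8 + (n + 4) * (2 * CH n)
lemma CT_nonneg (n : ℕ) : 0 ≤ CT n := by have := CH_nonneg n; unfold CT; positivity

lemma clp_cont : Continuous clp := continuous_iff_continuousAt.2 fun s => (clp_deriv s).continuousAt

lemma QD.trace (h : QD n a a' V S P T M ε e δ b) (hδ : δ / cc1 n ≤ ballVol (n + 1) / 2)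
    (he : n * (δ / ballVol n) ^ (-(1 / (n : ℝ))) * e ≤ δ) :
    ∫ t in (-(M - 1))..(M - 1), (T t - clp (t - b)) ^ 2 * P t ≤ CT n * δ := by
  have hM := h.hM
  have hle : -(M - 1) ≤ M - 1 := by linarith
  have cI : ∀ {F : ℝ → ℝ}, ContinuousOn F (Icc (-(M-1)) (M-1)) → IntervalIntegrable F volume (-(M-1)) (M-1) := by
    intro F hF; apply ContinuousOn.intervalIntegrable; rwa [uIcc_of_le hle]
  set η : ℝ → ℝ := fun t => T t - clp (t - b) with hη
  have cη : Continuous η := h.cT.sub (clp_cont.comp (continuous_id.sub continuous_const))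
  have cTp := h.Tp_cont
  have cr : Continuous fun t => rho (t - b) := rho_cont.comp (continuous_id.sub continuous_const)
  have dη : ∀ t ∈ Icc (-(M-1)) (M-1), HasDerivAt η (Tp n a T ε t - rho (t - b)) t := by
    intro t ht
    have h1 := (clp_deriv (t - b)).comp t ((hasDerivAt_id t).sub_const b)
    exact ((h.dT t (h.sub t ht)).sub h1).congr_deriv (by simp [Tp])
  set G' : ℝ → ℝ := fun t => 2 * η t * (Tp n a T ε t - rho (t - b)) * (T t * a t) +
    η t ^ 2 * (Tp n a T ε t * a t + T t * a' t) with hG'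
  have dG : ∀ t ∈ Icc (-(M-1)) (M-1), HasDerivAt (fun t => η t ^ 2 * (T t * a t)) (G' t) t := by
    intro t ht
    have h1 := ((dη t ht).pow 2).mul ((h.dT t (h.sub t ht)).mul (h.sd.da t))
    refine h1.congr_deriv ?_
    simp only [hG', Tp, Pi.pow_apply, Pi.mul_apply]
    push_cast; ring
  have cG' : ContinuousOn G' (Icc (-(M-1)) (M-1)) := by
    have c1 := cη.continuousOn (s := Icc (-(M-1)) (M-1))
    have c2 := cr.continuousOn (s := Icc (-(M-1)) (M-1))
    have c3 := h.cT.continuousOn (s := Icc (-(M-1)) (M-1))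
    have c4 := h.sd.ca.continuousOn (s := Icc (-(M-1)) (M-1))
    have c5 := h.sd.ca'.continuousOn (s := Icc (-(M-1)) (M-1))
    exact (((continuousOn_const.mul c1).mul (cTp.sub c2)).mul (c3.mul c4)).add
      ((c1.pow 2).mul ((cTp.mul c4).add (c3.mul c5)))
  have iG : ∫ t in (-(M-1))..(M-1), G' t = 0 := by
    rw [intervalIntegral.integral_eq_sub_of_hasDerivAt (f := fun t => η t ^ 2 * (T t * a t))
      (fun t ht => dG t (by rwa [uIcc_of_le hle] at ht)) (cI cG')]
    rw [(h.supp (M - 1) (le_abs_self _)).1, (h.supp (-(M - 1)) (by rw [abs_neg]; exact le_abs_self _)).1]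
    simp
  have j1 : IntervalIntegrable (fun t => (24 + 64 * (n:ℝ) ^ 2) * Df n a a' V P T ε t) volume (-(M-1)) (M-1) :=
    cI (continuousOn_const.mul h.Df_cont)
  have j2 : IntervalIntegrable (fun t => 8 * (a t + ε - V t)) volume (-(M-1)) (M-1) :=
    (((h.sd.cA ε).sub h.sd.cV).const_mul 8).intervalIntegrable _ _
  have cb : Continuous fun t => (a t + ε) * η t ^ 2 := (h.sd.cA ε).mul (cη.pow 2)
  have j3 : IntervalIntegrable (fun t => ((n:ℝ) + 4) * ((a t + ε) * η t ^ 2)) volume (-(M-1)) (M-1) :=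
    (cb.const_mul _).intervalIntegrable _ _
  have main : ∫ t in (-(M-1))..(M-1), η t ^ 2 * P t ≤ ∫ t in (-(M-1))..(M-1),
      ((24 + 64 * (n:ℝ) ^ 2) * Df n a a' V P T ε t + 8 * (a t + ε - V t) + (n + 4) * ((a t + ε) * η t ^ 2) - G' t) := by
    apply intervalIntegral.integral_mono_on hle (((cη.pow 2).mul h.sd.cP).intervalIntegrable _ _)
      (((j1.add j2).add j3).sub (cI cG'))
    intro t ht
    have ht' := h.sub t ht
    obtain ⟨s0, s1, s2, s3, s4⟩ := h.split t ht'
    have hT := Ioo_subset_Icc_self (h.TI t ht')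
    have := trace_pt n h.hn (a t) (a' t) (V t) (P t) (T t) (Tp n a T ε t) (clp (t - b)) (rho (t - b))
      (Df n a a' V P T ε t) hT (clp_abs _) (h.sd.V0 t) (h.sd.Va t) (h.Tp_pos t ht') (clp_rho _ _ hT) (rho_le _)
      rfl (by linarith) (by linarith) (by linarith)
    have hε := h.ε0
    have hh : (n + 4) * (η t ^ 2 * a t) ≤ (n + 4) * ((a t + ε) * η t ^ 2) := by
      have : 0 ≤ (n + 4) * (ε * η t ^ 2) := by positivity
      linarith
    show η t ^ 2 * P t ≤ _
    simp only [hG']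
    simp only [hη] at hh ⊢
    linarith
  rw [intervalIntegral.integral_sub ((j1.add j2).add j3) (cI cG'), intervalIntegral.integral_add (j1.add j2) j3,
    intervalIntegral.integral_add j1 j2, intervalIntegral.integral_const_mul, intervalIntegral.integral_const_mul,
    intervalIntegral.integral_const_mul, iG] at main
  refine main.trans ?_
  have m1 := h.Df_int
  have m2 := h.AV (y0 := -(M-1)) (y1 := M-1) (by linarith) hle (by linarith)
  have m3 := h.both hδ he
  have e1 : e ≤ δ := by
    have := h.eδ
    have := h.ε0.trans_le h.εe
    have hn0 : (0 : ℝ) ≤ n := by positivity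
    nlinarith
  have m1' := mul_le_mul_of_nonneg_left m1 (by positivity : (0:ℝ) ≤ 24 + 64 * n ^ 2)
  have m3' := mul_le_mul_of_nonneg_left m3 (by positivity : (0:ℝ) ≤ n + 4)
  unfold CT
  simp only [hη]
  linarith

lemma QD.E_int (h : QD n a a' V S P T M ε e δ b) :
    ∫ t in (-(M - 1))..(M - 1), (P t + T t * a' t - √(1 - T t ^ 2) * S t) ≤ 2 * δ := by
  have hle : -(M - 1) ≤ M - 1 := by linarith [h.hM]
  refine le_trans ?_ h.Df_int
  apply intervalIntegral.integral_mono_on hle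
  · apply Continuous.intervalIntegrable
    have := h.sd.cP; have := h.cT; have := h.sd.ca'; have := h.sd.cS
    fun_prop
  · apply ContinuousOn.intervalIntegrable; rw [uIcc_of_le hle]; exact h.Df_cont
  · intro t ht
    obtain ⟨s0, s1, s2, s3, s4⟩ := h.split t (h.sub t ht)
    linarith
end

lemma e_small (n : ℕ) {e δ : ℝ} (hδ : δ / cc1 n ≤ ballVol (n + 1) / 2) (eδ : 2 * (n + 1) * e ≤ δ) :
    e ≤ ballVol (n + 1) / 8 := by
  have hc := cc1_pos n
  have hω := ballVol_pos (n + 1)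
  rw [div_le_iff₀ hc] at hδ
  have h1 : cc1 n ≤ (n + 1) / 4 := by
    unfold cc1
    have := th_le n
    have hn0 : (0 : ℝ) ≤ n := by positivity
    nlinarith
  have hn0 : (0 : ℝ) < n + 1 := by positivity
  have : ballVol (n+1) / 2 * cc1 n ≤ ballVol (n+1) / 2 * ((n + 1) / 4) := by gcongr
  nlinarith

lemma wt_half' (n : ℕ) : ∫ z in (-1:ℝ)..0, wt n z = ballVol (n + 1) / 2 := by
  have h1 := wt_half n
  have h2 := integral_wt n
  rw [← intervalIntegral.integral_add_adjacent_intervals (wt_ii n (-1) 0) (wt_ii n 0 1)] at h2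
  linarith

lemma exists_QD (n : ℕ) (hn : 1 ≤ n) (i : Fin (n + 1)) {f : Euc (n + 1) → ℝ} (hf : TF f) (δ e : ℝ) (hδ0 : 0 < δ)
    (hδ : δ / cc1 n ≤ ballVol (n + 1) / 2) (eδ : 2 * (n + 1) * e ≤ δ)
    (h1 : ∫ x, f x < ballVol (n + 1)) (h2 : ballVol (n + 1) - e ≤ ∫ x, f x ^ 2)
    (h3 : ∫ x, kg f x ≤ (n + 1) * ballVol (n + 1) + δ) :
    ∃ (T : ℝ → ℝ) (M ε b : ℝ), QD n (sl i f) (sl i (k1 i f)) (sl i (fun x => f x ^ 2)) (sl i (k2 i f)) (sl i (kg f))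
      T M ε e δ b ∧ (∀ x, M - 1 ≤ ‖x‖ → f x = 0) ∧ (∀ x, M - 1 ≤ ‖x‖ → fderiv ℝ f x = 0) := by
  obtain ⟨L, hL1, hLf, hLd⟩ := hf.supp
  have sd := (RI_all n hn).SD i hf
  have hω := ballVol_pos (n + 1)
  have he8 := e_small n hδ eδ
  have hLk : ∀ x, L ≤ ‖x‖ → kg f x = 0 := fun x hx => by unfold kg; rw [hLd x hx]; simp
  have hLs : ∀ x, L ≤ ‖x‖ → f x ^ 2 = 0 := fun x hx => by rw [hLf x hx]; simp
  obtain ⟨M, rfl⟩ : ∃ M, L = M - 1 := ⟨L + 1, by ring⟩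
  set a := sl i f with ha
  set ε := (ballVol (n + 1) - ∫ x, f x) / (2 * M) with hε
  have hM0 : 0 < 2 * M := by linarith
  have ε0 : 0 < ε := div_pos (by linarith) hM0
  have hff : ∫ x, f x ^ 2 ≤ ∫ x, f x := integral_mono hf.sq_int hf.int fun x => by
    have := hf.nn x; have := hf.le x; simp only; nlinarith
  have εe : ε ≤ e := by
    rw [hε, div_le_iff₀ hM0]
    have : 0 ≤ e := by linarith
    nlinarith
  have hi : ∫ t in (-M)..M, a t = ∫ x, f x :=
    sl_integral_interval i hf.int hLf (by linarith) (by linarith) (by linarith)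
  have iA : ∫ t in (-M)..M, (a t + ε) = ballVol (n + 1) := by
    rw [intervalIntegral.integral_add (sd.ca.intervalIntegrable _ _) (by simp), hi]
    simp only [intervalIntegral.integral_const, smul_eq_mul]
    have : (M - -M) * ε = ballVol (n + 1) - ∫ x, f x := by
      rw [hε, show M - -M = 2 * M by ring, mul_div_cancel₀ _ hM0.ne']
    linarith
  obtain ⟨T, cT, Tl, Tr, hT, hm⟩ := exists_T n (fun t => a t + ε) (sd.cA ε) (fun t => by linarith [sd.a0 t])
    (-M) M 1 (by linarith) one_pos (by rw [integral_wt, one_mul, iA])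
  simp only [one_mul] at hT hm
  have hz : ∀ t, M - 1 ≤ |t| → a t = 0 := fun t ht => sl_zero i hLf t ht
  have hTI : ∀ t ∈ Icc (-M) M, T t ∈ Icc (-1:ℝ) 1 := by
    intro t ht
    rcases eq_or_lt_of_le ht.1 with h | h
    · rw [← h, Tl]; simp
    rcases eq_or_lt_of_le ht.2 with h' | h'
    · rw [h', Tr]; simp
    · exact Ioo_subset_Icc_self (hT t ⟨h, h'⟩).1
  have T0 : T (-(M-1)) ≤ 0 := by
    have mem : -(M-1) ∈ Icc (-M) M := ⟨by linarith, by linarith⟩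
    have := hm (-(M-1)) mem
    have e1 : ∫ u in (-M)..(-(M-1)), (a u + ε) = ∫ u in (-M)..(-(M-1)), ε := by
      apply intervalIntegral.integral_congr
      intro u hu
      rw [uIcc_of_le (by linarith)] at hu
      simp only
      rw [hz u (by rw [abs_of_nonpos (by linarith [hu.2])]; linarith [hu.2])]; simp
    rw [e1] at this
    simp only [intervalIntegral.integral_const, smul_eq_mul] at this
    by_contra hcon
    push Not at hcon
    have h4 := intervalIntegral.integral_add_adjacent_intervals (wt_ii n (-1) 0) (wt_ii n 0 (T (-(M-1))))
    have h5 := intervalIntegral.integral_nonneg (μ := volume) hcon.le (fun u _ => wt_nonneg n u)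
    rw [wt_half'] at h4
    nlinarith
  have T1 : 0 ≤ T (M-1) := by
    have mem : (M-1) ∈ Icc (-M) M := ⟨by linarith, by linarith⟩
    have := hm (M-1) mem
    have e1 : ∫ u in (M-1)..M, (a u + ε) = ∫ u in (M-1)..M, ε := by
      apply intervalIntegral.integral_congr
      intro u hu
      rw [uIcc_of_le (by linarith)] at hu
      simp only
      rw [hz u (by rw [abs_of_nonneg (by linarith [hu.1])]; linarith [hu.1])]; simp
    simp only [intervalIntegral.integral_const, smul_eq_mul] at e1
    have h6 := intervalIntegral.integral_add_adjacent_intervals ((sd.cA ε).intervalIntegrable (-M) (M-1) (μ := volume))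
      ((sd.cA ε).intervalIntegrable (M-1) M)
    by_contra hcon
    push Not at hcon
    have h4 := intervalIntegral.integral_add_adjacent_intervals (wt_ii n (-1) (T (M-1))) (wt_ii n (T (M-1)) 0)
    have h5 := intervalIntegral.integral_nonneg (μ := volume) hcon.le (fun u _ => wt_nonneg n u)
    rw [wt_half'] at h4
    nlinarith
  obtain ⟨b, hb, Tb⟩ := intermediate_value_Icc (by linarith : -(M-1) ≤ M-1) cT.continuousOn ⟨T0, T1⟩
  refine ⟨T, M, ε, b, ⟨sd, hn, by linarith, ?_, ε0, εe, cT, Tl, Tr, fun t ht => (hT t ht).1, fun t ht => (hT t ht).2,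
    hm, hb, Tb, ?_, ?_, hδ0, eδ⟩, hLf, hLd⟩
  · intro t ht
    exact ⟨hz t ht, sl_zero i hLk t ht⟩
  · rw [sl_integral_interval i hf.sq_int hLs (by linarith) (by linarith) (by linarith)]; exact h2
  · rw [sl_integral_interval i hf.kg_int hLk (by linarith) (by linarith) (by linarith)]; exact_mod_cast h3

lemma sl_mul {n : ℕ} (i : Fin (n + 1)) (c : ℝ → ℝ) (k : Euc (n + 1) → ℝ) (t : ℝ) :
    sl i (fun x => c (x i) * k x) t = c t * sl i k t := by
  unfold sl
  simp only [JL_same]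
  exact integral_const_mul _ _

def CQ (n : ℕ) : ℝ := 2 * CT n + 8 + 2 * CH n
lemma CQ_nonneg (n : ℕ) : 0 ≤ CQ n := by have := CH_nonneg n; have := CT_nonneg n; unfold CQ; positivity

lemma QI1 (n : ℕ) (hn : 1 ≤ n) (i : Fin (n + 1)) {f : Euc (n + 1) → ℝ} (hf : TF f) (δ e : ℝ) (hδ0 : 0 < δ)
    (hδ : δ / cc1 n ≤ ballVol (n + 1) / 2) (eδ : 2 * (n + 1) * e ≤ δ)
    (he : n * (δ / ballVol n) ^ (-(1 / (n : ℝ))) * e ≤ δ)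
    (h1 : ∫ x, f x < ballVol (n + 1)) (h2 : ballVol (n + 1) - e ≤ ∫ x, f x ^ 2)
    (h3 : ∫ x, kg f x ≤ (n + 1) * ballVol (n + 1) + δ) :
    ∃ (b : ℝ) (G : Euc (n + 1) → ℝ), Continuous G ∧ Integrable G ∧ (∀ x, 0 ≤ G x) ∧
      ∫ x, G x ≤ CQ n * δ ∧ (∀ x, kg f x * (clp (x i - b) + k1 i f x / kg f x) ^ 2 ≤ G x) ∧
      (∀ x, 2 < |x i - b| → f x ≤ G x) := by
  obtain ⟨T0, M, ε, b, h, hLf, hLd⟩ := exists_QD n hn i hf δ e hδ0 hδ eδ h1 h2 h3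
  have hM := h.hM
  have hle : -(M-1) ≤ M-1 := by linarith
  set T : ℝ → ℝ := fun t => max (-1) (min 1 (T0 t)) with hTdef
  have cT0 := h.cT
  have cT : Continuous T := by fun_prop
  have hTI : ∀ t, T t ∈ Icc (-1:ℝ) 1 := fun t => ⟨le_max_left _ _, max_le (by norm_num) (min_le_left _ _)⟩
  have hTe : ∀ t ∈ Icc (-(M-1)) (M-1), T t = T0 t := by
    intro t ht
    have := h.TI t (h.sub t ht)
    simp only [hTdef]
    rw [min_eq_right this.2.le, max_eq_right this.1.le]
  have hLk : ∀ x, M - 1 ≤ ‖x‖ → kg f x = 0 := fun x hx => by unfold kg; rw [hLd x hx]; simp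
  have hLk1 : ∀ x, M - 1 ≤ ‖x‖ → k1 i f x = 0 := fun x hx => by unfold k1; rw [hLd x hx]; simp
  have hLk2 : ∀ x, M - 1 ≤ ‖x‖ → k2 i f x = 0 := fun x hx => by unfold k2; rw [hLd x hx]; simp
  have ccl := clp_cont
  have ci : Continuous fun x : Euc (n+1) => x i := by fun_prop
  -- generic slice facts
  have gen : ∀ (c : ℝ → ℝ) (k : Euc (n+1) → ℝ), Continuous c → Continuous k → HasCompactSupport k →
      (∀ x, M - 1 ≤ ‖x‖ → k x = 0) →
      Integrable (fun x : Euc (n+1) => c (x i) * k x) ∧ ∫ x : Euc (n+1), c (x i) * k x = ∫ t in (-(M-1))..(M-1), c t * sl i k t := by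
    intro c k hc hk hks hk0
    have hI : Integrable (fun x : Euc (n+1) => c (x i) * k x) :=
      ((hc.comp ci).mul hk).integrable_of_hasCompactSupport hks.mul_left
    refine ⟨hI, ?_⟩
    rw [← sl_integral_interval i hI (L := M - 1) (fun x hx => by rw [hk0 x hx, mul_zero]) le_rfl le_rfl hle]
    simp only [sl_mul]
  set hh : ℝ → ℝ := fun t => (T t - clp (t - b)) ^ 2 with hhh
  have chh : Continuous hh := by fun_prop
  obtain ⟨i1, I1⟩ := gen hh (kg f) chh (kg_cont hf) (kg_cs hf) hLk
  obtain ⟨i2, I2⟩ := gen (fun _ => 1) (kg f) continuous_const (kg_cont hf) (kg_cs hf) hLk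
  obtain ⟨i3, I3⟩ := gen T (k1 i f) cT (k1_cont i hf) (k1_cs i hf) hLk1
  obtain ⟨i4, I4⟩ := gen (fun t => √(1 - T t ^ 2)) (k2 i f) (by fun_prop) (k2_cont i hf) (k2_cs i hf) hLk2
  obtain ⟨i5, I5⟩ := gen hh f chh hf.c1.continuous hf.cs hLf
  have hcd : ∀ x : Euc (n+1), 1 / 2 * (kg f x * (T (x i) + k1 i f x / kg f x) ^ 2) ≤
      1 * kg f x + T (x i) * k1 i f x - √(1 - T (x i) ^ 2) * k2 i f x := fun x => by
    rw [one_mul]; exact cauchy_def _ _ _ _ (kg_nonneg f x) (k2_nonneg i f x) (kg_sq i f x) (hTI _)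
  have hE0 : ∀ x : Euc (n+1), 0 ≤ 1 * kg f x + T (x i) * k1 i f x - √(1 - T (x i) ^ 2) * k2 i f x := fun x => by
    have := kg_nonneg f x
    exact le_trans (by positivity) (hcd x)
  have p1 : ∀ x : Euc (n+1), 0 ≤ hh (x i) * kg f x := fun x => mul_nonneg (sq_nonneg _) (kg_nonneg f x)
  have p5 : ∀ x : Euc (n+1), 0 ≤ hh (x i) * f x := fun x => mul_nonneg (sq_nonneg _) (hf.nn x)
  have iE := ((i2.add i3).sub i4)
  refine ⟨b, fun x => 2 * (hh (x i) * kg f x) + 4 * (1 * kg f x + T (x i) * k1 i f x - √(1 - T (x i) ^ 2) * k2 i f x)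
    + hh (x i) * f x, ?_, ((i1.const_mul 2).add (iE.const_mul 4)).add i5, ?_, ?_, ?_, ?_⟩
  · have := kg_cont hf; have := k1_cont i hf; have := k2_cont i hf; have := hf.c1.continuous
    fun_prop
  · intro x; linarith [p1 x, p5 x, hE0 x]
  · have e1 : ∫ x : Euc (n+1), hh (x i) * kg f x ≤ CT n * δ := by
      rw [I1]
      refine le_trans (le_of_eq ?_) (h.trace hδ he)
      apply intervalIntegral.integral_congr
      intro t ht
      rw [uIcc_of_le hle] at ht
      simp only [hhh, hTe t ht]
    have e5 : ∫ x : Euc (n+1), hh (x i) * f x ≤ 2 * CH n * δ := by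
      rw [I5]
      refine le_trans ?_ (h.both hδ he)
      apply intervalIntegral.integral_mono_on hle
      · have := h.sd.ca
        apply Continuous.intervalIntegrable; fun_prop
      · have := h.sd.ca
        apply Continuous.intervalIntegrable; fun_prop
      · intro t ht
        simp only [hhh, hTe t ht]
        have := mul_nonneg h.ε0.le (sq_nonneg (T0 t - clp (t - b)))
        linarith
    have e2 : ∫ x : Euc (n+1), (1 * kg f x + T (x i) * k1 i f x - √(1 - T (x i) ^ 2) * k2 i f x) ≤ 2 * δ := by
      have q1 := integral_sub (i2.add i3) i4
      simp only [Pi.add_apply] at q1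
      rw [q1, integral_add i2 i3, I2, I3, I4]
      have cP := h.sd.cP; have ca' := h.sd.ca'; have cS := h.sd.cS
      rw [← intervalIntegral.integral_add, ← intervalIntegral.integral_sub]
      · refine le_trans (le_of_eq ?_) h.E_int
        apply intervalIntegral.integral_congr
        intro t ht
        rw [uIcc_of_le hle] at ht
        simp only [hTe t ht, one_mul]
      all_goals (apply Continuous.intervalIntegrable; fun_prop)
    have := integral_add ((i1.const_mul 2).add (iE.const_mul 4)) i5
    simp only [Pi.add_apply, Pi.sub_apply] at this
    rw [this]
    have := integral_add (i1.const_mul 2) (iE.const_mul 4)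
    simp only [Pi.add_apply, Pi.sub_apply] at this
    rw [this, integral_const_mul, integral_const_mul]
    unfold CQ; linarith
  · intro x
    have g0 := kg_nonneg f x
    have := hcd x
    have e1 : kg f x * (clp (x i - b) + k1 i f x / kg f x) ^ 2 ≤
        2 * (hh (x i) * kg f x) + 2 * (kg f x * (T (x i) + k1 i f x / kg f x) ^ 2) := by
      have : (clp (x i - b) + k1 i f x / kg f x) ^ 2 ≤ 2 * hh (x i) + 2 * (T (x i) + k1 i f x / kg f x) ^ 2 := by
        simp only [hhh]
        nlinarith [sq_nonneg ((T (x i) - clp (x i - b)) + (T (x i) + k1 i f x / kg f x))]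
      have := mul_le_mul_of_nonneg_left this g0
      linarith
    linarith [p5 x]
  · intro x hx
    have := clp_far (x i - b) (T (x i)) (hTI _) hx
    have := mul_le_mul_of_nonneg_right this (hf.nn x)
    have h3 : hh (x i) = (T (x i) - clp (x i - b)) ^ 2 := rfl
    rw [← h3] at this
    have h4 := p1 x
    have := hE0 x
    linarith

def thk (k u : ℝ) : ℝ := min 1 (max 0 (k * (u - 1)))
lemma thk_cont (k : ℝ) : Continuous (thk k) := by unfold thk; fun_prop
lemma thk_nonneg (k u : ℝ) : 0 ≤ thk k u := le_min zero_le_one (le_max_left _ _)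
lemma thk_le (k u : ℝ) : thk k u ≤ 1 := min_le_left _ _
lemma thk_one (k u : ℝ) (h : 1 ≤ k * (u - 1)) : thk k u = 1 := min_eq_left (h.trans (le_max_right _ _))
lemma thk_zero (k u : ℝ) (hk : 0 ≤ k) (h : u ≤ 1) : thk k u = 0 := by
  unfold thk
  rw [max_eq_left (by nlinarith)]; simp
def theta (k s : ℝ) : ℝ := ∫ u in (0:ℝ)..s, thk k u
lemma theta_deriv (k s : ℝ) : HasDerivAt (theta k) (thk k s) s :=
  intervalIntegral.integral_hasDerivAt_right ((thk_cont k).intervalIntegrable _ _)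
    ((thk_cont k).stronglyMeasurableAtFilter _ _) (thk_cont k).continuousAt
lemma theta_cont (k : ℝ) : Continuous (theta k) := continuous_iff_continuousAt.2 fun s => (theta_deriv k s).continuousAt
lemma theta_nonneg (k s : ℝ) (hs : 0 ≤ s) : 0 ≤ theta k s :=
  intervalIntegral.integral_nonneg hs fun u _ => thk_nonneg k u
lemma theta_zero (k s : ℝ) (hk : 0 ≤ k) (hs0 : 0 ≤ s) (hs : s ≤ 1) : theta k s = 0 := by
  unfold theta
  rw [intervalIntegral.integral_congr (g := fun _ => (0:ℝ))]
  · simp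
  · intro u hu
    rw [uIcc_of_le hs0] at hu
    exact thk_zero k u hk (hu.2.trans hs)
lemma theta_le (k s : ℝ) (hk : 0 ≤ k) (hs : 1 ≤ s) : theta k s ≤ s - 1 := by
  have h0 := theta_zero k 1 hk zero_le_one le_rfl
  have h1 := intervalIntegral.integral_add_adjacent_intervals ((thk_cont k).intervalIntegrable (μ := volume) 0 1)
    ((thk_cont k).intervalIntegrable 1 s)
  have h2 : ∫ u in (1:ℝ)..s, thk k u ≤ ∫ u in (1:ℝ)..s, (1:ℝ) :=
    intervalIntegral.integral_mono_on hs ((thk_cont k).intervalIntegrable _ _) (by simp) fun u _ => thk_le k u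
  simp only [intervalIntegral.integral_const, smul_eq_mul, mul_one] at h2
  unfold theta at *
  linarith

lemma dual_sum {N : ℕ} (ℓ : Euc N →L[ℝ] ℝ) (v : Euc N) : ℓ v = ∑ i, v i * ℓ (EuclideanSpace.single i 1) := by
  conv_lhs => rw [← (EuclideanSpace.basisFun (Fin N) ℝ).sum_repr v]
  simp [map_sum]

lemma ibp_one {N : ℕ} {f X D : Euc N → ℝ} (hf : TF f) (e : Euc N) (X' : Euc N → (Euc N →L[ℝ] ℝ))
    (hX : ∀ x, HasFDerivAt X (X' x) x) (hD : ∀ x, X' x e = D x) (cD : Continuous D) :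
    Integrable (fun x => f x * D x) ∧ Integrable (fun x => fderiv ℝ f x e * X x) ∧
    ∫ x, f x * D x = - ∫ x, fderiv ℝ f x e * X x := by
  have cX : Continuous X := continuous_iff_continuousAt.2 fun x => (hX x).continuousAt
  have cf := hf.c1.continuous
  have cf' : Continuous fun x => fderiv ℝ f x e := (hf.c1.continuous_fderiv (by simp)).clm_apply continuous_const
  have sf' : HasCompactSupport fun x => fderiv ℝ f x e := hf.cs.fderiv_apply (𝕜 := ℝ) e
  have e1 : ∀ x, fderiv ℝ X x e = D x := fun x => by rw [(hX x).fderiv, hD]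
  have i1 : Integrable (fun x => f x * D x) := (cf.mul cD).integrable_of_hasCompactSupport hf.cs.mul_right
  have i2 : Integrable (fun x => fderiv ℝ f x e * X x) := (cf'.mul cX).integrable_of_hasCompactSupport sf'.mul_right
  refine ⟨i1, i2, ?_⟩
  have := integral_mul_fderiv_eq_neg_fderiv_mul_of_integrable (μ := volume) (f := f) (g := X) (v := e) i2
    (by simpa only [e1] using i1) ((cf.mul cX).integrable_of_hasCompactSupport hf.cs.mul_right)
    (fun x _ => (hf.c1.differentiable (by simp)).differentiableAt) (fun x _ => (hX x).differentiableAt)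
  simpa only [e1] using this

/-- truncated position -/
def pv {N : ℕ} (b : Euc N) (x : Euc N) : Euc N := WithLp.toLp 2 fun j => clp (x j - b j)
@[simp] lemma pv_apply {N : ℕ} (b x : Euc N) (j : Fin N) : pv b x j = clp (x j - b j) := rfl
lemma pv_sq {N : ℕ} (b x : Euc N) : ‖pv b x‖ ^ 2 = ∑ j, clp (x j - b j) ^ 2 := by
  rw [EuclideanSpace.real_norm_sq_eq]; rfl
lemma pv_cont {N : ℕ} (b : Euc N) : Continuous (pv b) := by
  unfold pv
  have := clp_cont
  fun_prop
lemma pv_le {N : ℕ} (b x : Euc N) : ‖pv b x‖ ≤ 3 * N := by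
  have h1 : ‖pv b x‖ ^ 2 ≤ (3 * N) ^ 2 := by
    rw [pv_sq]
    calc ∑ j, clp (x j - b j) ^ 2 ≤ ∑ j : Fin N, (9 : ℝ) := Finset.sum_le_sum fun j _ => by
            rw [← sq_abs]; nlinarith [clp_abs (x j - b j), abs_nonneg (clp (x j - b j))]
      _ = 9 * N := by simp [mul_comm]
      _ ≤ (3 * N) ^ 2 := by
        have : (N : ℝ) ≤ N ^ 2 := by
          rcases Nat.eq_zero_or_pos N with h | h
          · simp [h]
          · have : (1 : ℝ) ≤ N := by exact_mod_cast h
            nlinarith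
        nlinarith
  exact (le_abs_self _).trans (abs_le_of_sq_le_sq h1 (by positivity))

lemma pv_fderiv {N : ℕ} (b : Euc N) (x : Euc N) (k : ℝ) (i : Fin N) :
    HasFDerivAt (fun x => theta k (∑ j, clp (x j - b j) ^ 2) * clp (x i - b i))
      (theta k (∑ j, clp (x j - b j) ^ 2) • (rho (x i - b i) • (EuclideanSpace.proj i : Euc N →L[ℝ] ℝ)) +
        clp (x i - b i) • (thk k (∑ j, clp (x j - b j) ^ 2) •
          ∑ j, (2 * clp (x j - b j) * rho (x j - b j)) • (EuclideanSpace.proj j : Euc N →L[ℝ] ℝ))) x := by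
  have h1 : ∀ j, HasFDerivAt (fun x : Euc N => clp (x j - b j)) (rho (x j - b j) • (EuclideanSpace.proj j : Euc N →L[ℝ] ℝ)) x := by
    intro j
    have hp : HasFDerivAt (fun x : Euc N => x j - b j) (EuclideanSpace.proj j : Euc N →L[ℝ] ℝ) x :=
      (EuclideanSpace.proj j : Euc N →L[ℝ] ℝ).hasFDerivAt.sub_const _
    exact (clp_deriv (x j - b j)).comp_hasFDerivAt x hp
  have h2 : HasFDerivAt (fun x : Euc N => ∑ j, clp (x j - b j) ^ 2)
      (∑ j, (2 * clp (x j - b j) * rho (x j - b j)) • (EuclideanSpace.proj j : Euc N →L[ℝ] ℝ)) x := by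
    have := HasFDerivAt.fun_sum (u := Finset.univ) (fun j _ => (h1 j).pow 2)
    refine this.congr_fderiv ?_
    apply Finset.sum_congr rfl
    intro j _
    rw [smul_smul]
    congr 1
    simp
  exact ((theta_deriv k _).comp_hasFDerivAt x h2).mul (h1 i)

lemma pv_div {N : ℕ} (b : Euc N) (x : Euc N) (k : ℝ) (i : Fin N) :
    (theta k (∑ j, clp (x j - b j) ^ 2) • (rho (x i - b i) • (EuclideanSpace.proj i : Euc N →L[ℝ] ℝ)) +
        clp (x i - b i) • (thk k (∑ j, clp (x j - b j) ^ 2) •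
          ∑ j, (2 * clp (x j - b j) * rho (x j - b j)) • (EuclideanSpace.proj j : Euc N →L[ℝ] ℝ)))
        (EuclideanSpace.single i 1) =
      theta k (∑ j, clp (x j - b j) ^ 2) * rho (x i - b i) +
        thk k (∑ j, clp (x j - b j) ^ 2) * (2 * clp (x i - b i) ^ 2 * rho (x i - b i)) := by
  simp [Pi.single_apply]
  ring

lemma shell_le (N : ℕ) (t : ℝ) (h0 : 0 ≤ t) (h1 : t ≤ 1) : (1 + t) ^ N ≤ 1 + (2 ^ N - 1) * t := by
  induction N with
  | zero => simp
  | succ N ih =>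
    have h2 : (1 : ℝ) ≤ 2 ^ N := one_le_pow₀ (by norm_num)
    rw [pow_succ, pow_succ]
    have : (1 + t) ^ N * (1 + t) ≤ (1 + (2 ^ N - 1) * t) * (1 + t) := by gcongr
    nlinarith [mul_nonneg (sub_nonneg.2 h2) (mul_nonneg h0 (sub_nonneg.2 h1))]

lemma kg_pv {N : ℕ} (f : Euc N → ℝ) (b x : Euc N) (G : Fin N → ℝ)
    (hG : ∀ i, kg f x * (clp (x i - b i) + fderiv ℝ f x (EuclideanSpace.single i 1) / kg f x) ^ 2 ≤ G i) (hG0 : ∀ i, 0 ≤ G i) :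
    kg f x * (‖pv b x‖ - 1) ^ 2 ≤ ∑ i, G i := by
  rcases eq_or_lt_of_le (kg_nonneg f x) with h | h
  · rw [← h]; simp; exact Finset.sum_nonneg fun i _ => hG0 i
  refine le_trans ?_ (Finset.sum_le_sum fun i _ => hG i)
  rw [← Finset.mul_sum]
  refine mul_le_mul_of_nonneg_left ?_ h.le
  set u : Euc N := WithLp.toLp 2 fun i => fderiv ℝ f x (EuclideanSpace.single i 1) / kg f x with hu
  have hu1 : ‖u‖ ^ 2 = 1 := by
    rw [EuclideanSpace.real_norm_sq_eq]
    simp only [hu, div_pow]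
    rw [← Finset.sum_div, ← norm_dual_sq]
    exact div_self (pow_ne_zero _ h.ne')
  have hu2 : ‖u‖ = 1 := by
    have := norm_nonneg u
    nlinarith
  have e1 : ∑ i, (clp (x i - b i) + fderiv ℝ f x (EuclideanSpace.single i 1) / kg f x) ^ 2 = ‖pv b x + u‖ ^ 2 := by
    rw [EuclideanSpace.real_norm_sq_eq]; rfl
  rw [e1, ← sq_abs]
  have h3 : |‖pv b x‖ - 1| ≤ ‖pv b x + u‖ := by
    have := abs_norm_sub_norm_le (pv b x) (-u)
    rwa [norm_neg, hu2, sub_neg_eq_add] at this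
  exact pow_le_pow_left₀ (abs_nonneg _) h3 2

lemma pv_cube {N : ℕ} (b x : Euc N) (h : ∀ i, |x i - b i| ≤ 2) : pv b x = x - b := by
  ext j
  simp [clp_id _ (h j)]

lemma theta_bd {N : ℕ} (k : ℝ) (hk : 0 ≤ k) (b x : Euc N) :
    theta k (‖pv b x‖ ^ 2) * ‖pv b x‖ ≤ (3 * N + 1) * (3 * N) * |‖pv b x‖ - 1| := by
  set r := ‖pv b x‖ with hr
  have hr0 : 0 ≤ r := norm_nonneg _
  have hrN : r ≤ 3 * N := pv_le b x
  rcases le_or_gt r 1 with h | h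
  · rw [theta_zero k _ hk (by positivity) (by nlinarith)]
    simp only [zero_mul]; positivity
  · have h1 := theta_le k (r ^ 2) hk (by nlinarith)
    rw [abs_of_pos (by linarith)]
    have : theta k (r^2) * r ≤ (r^2 - 1) * r := by gcongr
    have h2 : (r ^ 2 - 1) * r = (r + 1) * r * (r - 1) := by ring
    have h3 : (r + 1) * r * (r - 1) ≤ (3 * N + 1) * (3 * N) * (r - 1) := by
      have : 0 ≤ r - 1 := by linarith
      gcongr
    linarith

def CI (n : ℕ) : ℝ := (n + 1) * CQ n + (3 * (n + 1) + 1) * (3 * (n + 1)) *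
  ((n + 1) * ballVol (n + 1) + 1 + (n + 1) * CQ n) + ballVol (n + 1) * 2 ^ (n + 1)

lemma QI (n : ℕ) (hn : 1 ≤ n) {f : Euc (n + 1) → ℝ} (hf : TF f) (δ e : ℝ) (hδ0 : 0 < δ) (hδ1 : δ ≤ 1)
    (hδ : δ / cc1 n ≤ ballVol (n + 1) / 2) (eδ : 2 * (n + 1) * e ≤ δ)
    (he : n * (δ / ballVol n) ^ (-(1 / (n : ℝ))) * e ≤ δ)
    (h1 : ∫ x, f x < ballVol (n + 1)) (h2 : ballVol (n + 1) - e ≤ ∫ x, f x ^ 2)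
    (h3 : ∫ x, kg f x ≤ (n + 1) * ballVol (n + 1) + δ) :
    ∃ b : Euc (n + 1), ∫ x in (closedBall b 1)ᶜ, f x ≤ CI n * √δ := by
  choose b0 G cG iG G0 GI Gk Gf using fun i => QI1 n hn i hf δ e hδ0 hδ eδ he h1 h2 h3
  set b : Euc (n + 1) := WithLp.toLp 2 b0 with hb
  have hbi : ∀ i, b i = b0 i := fun i => rfl
  set t := √δ with ht
  have ht0 : 0 < t := Real.sqrt_pos.2 hδ0
  have htt : t * t = δ := Real.mul_self_sqrt hδ0.le
  have ht1 : t ≤ 1 := by nlinarith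
  have hδt : δ ≤ t := by nlinarith
  have hω := ballVol_pos (n + 1)
  have hCQ := CQ_nonneg n
  set k := 1 / t with hk
  have hk0 : 0 ≤ k := by positivity
  set Gs : Euc (n + 1) → ℝ := fun x => ∑ i, G i x with hGs
  have iGs : Integrable Gs := integrable_finsetSum _ fun i _ => iG i
  have Gs0 : ∀ x, 0 ≤ Gs x := fun x => Finset.sum_nonneg fun i _ => G0 i x
  have IGs : ∫ x, Gs x ≤ (n + 1) * CQ n * δ := by
    rw [hGs, integral_finsetSum _ fun i _ => iG i]
    refine (Finset.sum_le_sum fun i _ => GI i).trans (le_of_eq ?_)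
    simp; ring
  set r : Euc (n + 1) → ℝ := fun x => ‖pv b x‖ with hr
  have hGr : ∀ x, kg f x * (r x - 1) ^ 2 ≤ Gs x := fun x =>
    kg_pv f b x (fun i => G i x) (fun i => Gk i x) (fun i => G0 i x)
  -- divergence
  set Q : Euc (n + 1) → ℝ := fun x => ∑ j, clp (x j - b j) ^ 2 with hQ
  have hQr : ∀ x, Q x = r x ^ 2 := fun x => (pv_sq b x).symm
  set D : Fin (n + 1) → Euc (n + 1) → ℝ := fun i x => theta k (Q x) * rho (x i - b i) +
        thk k (Q x) * (2 * clp (x i - b i) ^ 2 * rho (x i - b i)) with hD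
  have Q0 : ∀ x, 0 ≤ Q x := fun x => by rw [hQr]; positivity
  have D0 : ∀ i x, 0 ≤ D i x := by
    intro i x
    have := theta_nonneg k _ (Q0 x)
    have := thk_nonneg k (Q x)
    have := rho_nonneg (x i - b i)
    positivity
  have cD : ∀ i, Continuous (D i) := by
    intro i
    have := clp_cont; have := theta_cont k; have := thk_cont k; have := rho_cont
    simp only [hD, hQ]
    fun_prop
  have ibp := fun i => ibp_one hf (EuclideanSpace.single i 1) _ (fun x => pv_fderiv b x k i)
    (fun x => pv_div b x k i) (cD i)
  have ID : ∑ i, ∫ x, f x * D i x ≤ (3 * (n + 1) + 1) * (3 * (n + 1)) *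
      (((n + 1) * ballVol (n + 1) + 1 + (n + 1) * CQ n) * t) := by
    have ng : ∀ i, Integrable (fun x => -(fderiv ℝ f x (EuclideanSpace.single i 1) * (theta k (Q x) * clp (x i - b i)))) :=
      fun i => (ibp i).2.1.neg
    have e0 : ∑ i, ∫ x, f x * D i x = ∫ x, ∑ i, -(fderiv ℝ f x (EuclideanSpace.single i 1) * (theta k (Q x) * clp (x i - b i))) := by
      rw [integral_finsetSum _ fun i _ => ng i]
      refine Finset.sum_congr rfl fun i _ => ?_
      rw [(ibp i).2.2, integral_neg]
    rw [e0]
    set c0 : ℝ := (3 * (n + 1) + 1) * (3 * (n + 1)) with hc0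
    have hc00 : 0 ≤ c0 := by positivity
    have hle : ∀ x, ∑ i, -(fderiv ℝ f x (EuclideanSpace.single i 1) * (theta k (Q x) * clp (x i - b i))) ≤
        c0 * (t * kg f x + k * Gs x) := by
      intro x
      have q1 : ∑ i, -(fderiv ℝ f x (EuclideanSpace.single i 1) * (theta k (Q x) * clp (x i - b i))) =
          fderiv ℝ f x (-(theta k (Q x) • pv b x)) := by
        rw [dual_sum]
        refine Finset.sum_congr rfl fun i _ => ?_
        simp; ring
      rw [q1]
      refine (le_abs_self _).trans ?_
      rw [← Real.norm_eq_abs]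
      refine ((fderiv ℝ f x).le_opNorm _).trans ?_
      have q2 : ‖-(theta k (Q x) • pv b x)‖ ≤ c0 * |r x - 1| := by
        rw [norm_neg, norm_smul, Real.norm_eq_abs, abs_of_nonneg (theta_nonneg k _ (Q0 x)), hQr]
        have := theta_bd k hk0 b x
        push_cast at this
        exact this
      have q3 : kg f x * |r x - 1| ≤ t * kg f x + k * Gs x := by
        have g0 := kg_nonneg f x
        have q4 : |r x - 1| ≤ t + k * (r x - 1) ^ 2 := by
          rw [← sq_abs, hk]
          have : |r x - 1| * t ≤ t * t + |r x - 1| ^ 2 := by nlinarith [sq_nonneg (t - |r x - 1|), abs_nonneg (r x - 1), sq_nonneg t]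
          have e : t + 1 / t * |r x - 1| ^ 2 = (t * t + |r x - 1| ^ 2) / t := by field_simp
          rw [e, le_div_iff₀ ht0]; exact this
        have q5 := mul_le_mul_of_nonneg_left q4 g0
        have q6 := mul_le_mul_of_nonneg_left (hGr x) hk0
        linarith
      calc ‖fderiv ℝ f x‖ * ‖-(theta k (Q x) • pv b x)‖ ≤ ‖fderiv ℝ f x‖ * (c0 * |r x - 1|) := by gcongr
        _ = c0 * (kg f x * |r x - 1|) := by unfold kg; ring
        _ ≤ _ := by gcongr
    refine (integral_mono (integrable_finsetSum _ fun i _ => (ibp i).2.1.neg)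
      (((hf.kg_int.const_mul t).add (iGs.const_mul k)).const_mul c0) hle).trans ?_
    simp only [Pi.add_apply]
    rw [integral_const_mul, integral_add (hf.kg_int.const_mul t) (iGs.const_mul k), integral_const_mul, integral_const_mul]
    refine mul_le_mul_of_nonneg_left ?_ hc00
    have q1 : t * ∫ x, kg f x ≤ t * ((n + 1) * ballVol (n + 1) + 1) := by gcongr; linarith
    have q2 : k * ∫ x, Gs x ≤ k * ((n + 1) * CQ n * δ) := by gcongr
    have q3 : k * ((n + 1) * CQ n * δ) = (n + 1) * CQ n * t := by
      rw [hk, ← htt]; field_simp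
    linarith
  -- pointwise
  set Sh : Set (Euc (n + 1)) := ball b (1 + t) \ closedBall b 1 with hSh
  have mSh : MeasurableSet Sh := measurableSet_ball.diff measurableSet_closedBall
  have vSh : (volume Sh).toReal ≤ ballVol (n + 1) * 2 ^ (n + 1) * t := by
    have hsub : closedBall b 1 ⊆ ball b (1 + t) := closedBall_subset_ball (by linarith)
    have hfin : volume (closedBall b (1:ℝ)) ≠ ∞ := measure_closedBall_lt_top.ne
    rw [hSh, measure_sdiff hsub measurableSet_closedBall.nullMeasurableSet hfin,
      ENNReal.toReal_sub_of_le (measure_mono hsub) measure_ball_lt_top.ne,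
      Measure.addHaar_closedBall _ _ zero_le_one, Measure.addHaar_ball _ _ (by linarith)]
    simp only [finrank_euclideanSpace, Fintype.card_fin, one_pow, ENNReal.ofReal_one, one_mul, ENNReal.toReal_mul]
    rw [ENNReal.toReal_ofReal (by positivity)]
    have := shell_le (n + 1) t ht0.le ht1
    change (1 + t) ^ (n + 1) * ballVol (n + 1) - ballVol (n + 1) ≤ _
    have h4 := mul_le_mul_of_nonneg_right this hω.le
    have := mul_nonneg hω.le ht0.le
    linarith
  have hfin : volume Sh ≠ ∞ := ((measure_mono diff_subset).trans_lt measure_ball_lt_top).ne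
  have iSh : Integrable (Sh.indicator (fun _ => (1:ℝ))) := (integrable_indicator_iff mSh).2 (integrableOn_const hfin)
  have iDs : Integrable (fun x => ∑ i, f x * D i x) := integrable_finsetSum _ fun i _ => (ibp i).1
  have Ds0 : ∀ x, 0 ≤ ∑ i, f x * D i x := fun x => Finset.sum_nonneg fun i _ => mul_nonneg (hf.nn x) (D0 i x)
  have pt : ∀ x ∈ (closedBall b 1)ᶜ, f x ≤ Gs x + ∑ i, f x * D i x + Sh.indicator (fun _ => (1:ℝ)) x := by
    intro x hx
    have hx1 : 1 < ‖x - b‖ := by simpa [dist_eq_norm] using hx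
    have i0 : 0 ≤ Sh.indicator (fun _ => (1:ℝ)) x := indicator_nonneg (fun _ _ => zero_le_one) x
    by_cases hc : ∃ i, 2 < |x i - b i|
    · obtain ⟨i, hi⟩ := hc
      have q1 := Gf i x hi
      have q2 : G i x ≤ Gs x := Finset.single_le_sum (f := fun i => G i x) (fun j _ => G0 j x) (Finset.mem_univ i)
      linarith [Ds0 x]
    · push Not at hc
      by_cases hs : ‖x - b‖ < 1 + t
      · have : x ∈ Sh := ⟨by simpa [dist_eq_norm] using hs, hx⟩
        rw [indicator_of_mem this]
        linarith [hf.le x, Gs0 x, Ds0 x]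
      · push Not at hs
        have hrx : r x = ‖x - b‖ := by simp only [hr]; rw [pv_cube b x hc]
        have hQ1 : 1 + t ≤ Q x := by rw [hQr, hrx]; nlinarith
        have hth : thk k (Q x) = 1 := thk_one _ _ (by
          rw [hk, div_mul_eq_mul_div, one_mul, le_div_iff₀ ht0]; linarith)
        have : 1 ≤ ∑ i, D i x := by
          have q1 : ∀ i, clp (x i - b i) ^ 2 ≤ D i x := by
            intro i
            simp only [hD]
            rw [hth, rho_one _ (hc i)]
            nlinarith [theta_nonneg k _ (Q0 x), sq_nonneg (clp (x i - b i))]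
          have q2 := Finset.sum_le_sum (s := Finset.univ) fun i (_ : i ∈ Finset.univ) => q1 i
          have q3 : 1 + t ≤ ∑ i, D i x := hQ1.trans q2
          linarith
        rw [← Finset.mul_sum]
        have := mul_le_mul_of_nonneg_left this (hf.nn x)
        linarith [Gs0 x]
  refine ⟨b, ?_⟩
  have itot := (iGs.add iDs).add iSh
  calc ∫ x in (closedBall b 1)ᶜ, f x ≤ ∫ x in (closedBall b 1)ᶜ, (Gs x + ∑ i, f x * D i x + Sh.indicator (fun _ => (1:ℝ)) x) :=
        setIntegral_mono_on hf.int.integrableOn itot.integrableOn measurableSet_closedBall.compl pt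
    _ ≤ ∫ x, (Gs x + ∑ i, f x * D i x + Sh.indicator (fun _ => (1:ℝ)) x) :=
        setIntegral_le_integral itot (ae_of_all _ fun x => by
          have i0 : 0 ≤ Sh.indicator (fun _ => (1:ℝ)) x := indicator_nonneg (fun _ _ => zero_le_one) x
          have := Gs0 x; have := Ds0 x
          simp only [Pi.zero_apply, Pi.add_apply]
          linarith)
    _ = (∫ x, Gs x) + ∑ i, (∫ x, f x * D i x) + (volume Sh).toReal := by
        have q1 := integral_add (iGs.add iDs) iSh
        simp only [Pi.add_apply] at q1
        rw [q1, integral_add iGs iDs, integral_finsetSum _ fun i _ => (ibp i).1, integral_indicator mSh]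
        simp only [integral_const, smul_eq_mul, mul_one, measureReal_restrict_apply_univ]
        rfl
    _ ≤ CI n * t := by
        have : (n + 1) * CQ n * δ ≤ (n + 1) * CQ n * t := by gcongr
        unfold CI
        linarith

lemma comp_fderiv {N : ℕ} {G : Euc N → Euc N} (hG : ContDiff ℝ 1 G) (i : Fin N) (x e : Euc N) :
    fderiv ℝ (fun y => G y i) x e = fderiv ℝ G x e i := by
  have h1 := (hG.differentiable (by simp) x).hasFDerivAt
  have h2 := (EuclideanSpace.proj i : Euc N →L[ℝ] ℝ).hasFDerivAt.comp x h1
  have := h2.fderiv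
  change fderiv ℝ (fun y => G y i) x = _ at this
  rw [this]; rfl

lemma comp_C1 {N : ℕ} {G : Euc N → Euc N} (hG : ContDiff ℝ 1 G) (i : Fin N) : ContDiff ℝ 1 (fun y => G y i) :=
  (EuclideanSpace.proj i : Euc N →L[ℝ] ℝ).contDiff.comp hG

lemma divg_cont {N : ℕ} {G : Euc N → Euc N} (hG : ContDiff ℝ 1 G) : Continuous (divg G) := by
  unfold divg
  refine continuous_finsetSum _ fun i _ => ?_
  have h : Continuous fun x => fderiv ℝ G x (EuclideanSpace.single i 1) :=
    (hG.continuous_fderiv (by simp)).clm_apply continuous_const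
  exact (EuclideanSpace.proj i : Euc N →L[ℝ] ℝ).continuous.comp h

lemma divg_cs {N : ℕ} {G : Euc N → Euc N} (hGs : HasCompactSupport G) : HasCompactSupport (divg G) := by
  have := hGs.fderiv (𝕜 := ℝ)
  refine this.comp_left (g := fun ℓ : Euc N →L[ℝ] Euc N => ∑ i : Fin N, ℓ (EuclideanSpace.single i 1) i) ?_
  simp

lemma divg_ibp {N : ℕ} {f : Euc N → ℝ} (hf : ContDiff ℝ 1 f) {G : Euc N → Euc N} (hG : ContDiff ℝ 1 G)
    (hGs : HasCompactSupport G) : ∫ x, f x * divg G x = - ∫ x, fderiv ℝ f x (G x) := by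
  have cs : ∀ i, HasCompactSupport fun y => G y i := fun i => hGs.comp_left (g := fun v : Euc N => v i) rfl
  have cG := fun i => (comp_C1 hG i)
  have cf' : ∀ e, Continuous fun x => fderiv ℝ f x e := fun e => (hf.continuous_fderiv (by simp)).clm_apply continuous_const
  have cG' : ∀ i e, Continuous fun x => fderiv ℝ (fun y => G y i) x e := fun i e =>
    ((cG i).continuous_fderiv (by simp)).clm_apply continuous_const
  have sG' : ∀ i e, HasCompactSupport fun x => fderiv ℝ (fun y => G y i) x e := fun i e => (cs i).fderiv_apply (𝕜 := ℝ) e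
  have I1 : ∀ i, Integrable (fun x => f x * fderiv ℝ (fun y => G y i) x (EuclideanSpace.single i 1)) := fun i =>
    (hf.continuous.mul (cG' i _)).integrable_of_hasCompactSupport (sG' i _).mul_left
  have I2 : ∀ i, Integrable (fun x => fderiv ℝ f x (EuclideanSpace.single i 1) * G x i) := fun i =>
    ((cf' _).mul (cG i).continuous).integrable_of_hasCompactSupport (cs i).mul_left
  have I3 : ∀ i, Integrable (fun x => f x * G x i) := fun i =>
    (hf.continuous.mul (cG i).continuous).integrable_of_hasCompactSupport (cs i).mul_left
  have key : ∀ i, ∫ x, f x * fderiv ℝ (fun y => G y i) x (EuclideanSpace.single i 1) =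
      - ∫ x, fderiv ℝ f x (EuclideanSpace.single i 1) * G x i := fun i =>
    integral_mul_fderiv_eq_neg_fderiv_mul_of_integrable (μ := volume) (I2 i) (I1 i) (I3 i)
      (fun x _ => (hf.differentiable (by simp)).differentiableAt) (fun x _ => ((cG i).differentiable (by simp)).differentiableAt)
  have e1 : ∀ x, f x * divg G x = ∑ i, f x * fderiv ℝ (fun y => G y i) x (EuclideanSpace.single i 1) := by
    intro x
    unfold divg
    rw [Finset.mul_sum]
    simp only [comp_fderiv hG]
  have e2 : ∀ x, fderiv ℝ f x (G x) = ∑ i, fderiv ℝ f x (EuclideanSpace.single i 1) * G x i := by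
    intro x
    rw [dual_sum]
    simp only [mul_comm]
  simp only [e1, e2]
  rw [integral_finsetSum _ fun i _ => I1 i, integral_finsetSum _ fun i _ => I2 i, ← Finset.sum_neg_distrib]
  exact Finset.sum_congr rfl fun i _ => key i

set_option maxHeartbeats 2000000 in
/-- If `∫ f div G ≤ P` for all admissible fields then weighted gradient integral is at most `P`. -/
lemma grad_le {N : ℕ} {f : Euc N → ℝ} (hf : ContDiff ℝ 2 f) (P : ℝ)
    (hP : ∀ G : Euc N → Euc N, ContDiff ℝ 1 G → HasCompactSupport G → (∀ x, ‖G x‖ ≤ 1) → ∫ x, f x * divg G x ≤ P)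
    {ψ : Euc N → ℝ} (hψ : ContDiff ℝ 1 ψ) (hψs : HasCompactSupport ψ) (h0 : ∀ x, 0 ≤ ψ x) (h1 : ∀ x, ψ x ≤ 1) :
    ∫ x, ψ x * kg f x ≤ P := by
  have hf1 : ContDiff ℝ 1 f := hf.of_le (by norm_num)
  have cf' : ContDiff ℝ 1 (fderiv ℝ f) := hf.fderiv_right (by norm_num)
  have ckg : Continuous (kg f) := cf'.continuous.norm
  have iψ : Integrable ψ := hψ.continuous.integrable_of_hasCompactSupport hψs
  have ik : Integrable (fun x => ψ x * kg f x) :=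
    (hψ.continuous.mul ckg).integrable_of_hasCompactSupport hψs.mul_right
  have step : ∀ σ : ℝ, 0 < σ → ∫ x, ψ x * kg f x ≤ P + σ * ∫ x, ψ x := by
    intro σ hσ
    set w : Euc N → Euc N := fun x => WithLp.toLp 2 fun i => fderiv ℝ f x (EuclideanSpace.single i 1) with hw
    have cw : ContDiff ℝ 1 w := by
      rw [contDiff_euclidean]
      intro i
      exact cf'.clm_apply contDiff_const
    have nw : ∀ x, ‖w x‖ ^ 2 = kg f x ^ 2 := by
      intro x
      unfold kg
      rw [EuclideanSpace.real_norm_sq_eq, norm_dual_sq]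
    have nw' : ∀ x, ‖w x‖ = kg f x := fun x => by
      have := nw x
      exact (pow_left_inj₀ (norm_nonneg _) (kg_nonneg f x) two_ne_zero).1 this
    set q : Euc N → ℝ := fun x => √(‖w x‖ ^ 2 + σ ^ 2) with hq
    have cq : ContDiff ℝ 1 q := (((contDiff_norm_sq ℝ).comp cw).add contDiff_const).sqrt fun x => by
      have : 0 < ‖w x‖ ^ 2 + σ ^ 2 := by positivity
      exact this.ne'
    have q0 : ∀ x, 0 < q x := fun x => Real.sqrt_pos.2 (by positivity)
    have qs : ∀ x, q x ^ 2 = kg f x ^ 2 + σ ^ 2 := fun x => by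
      rw [hq]; simp only; rw [Real.sq_sqrt (by positivity), nw]
    have qk : ∀ x, kg f x ≤ q x := fun x => by
      have := qs x; have := q0 x; have := kg_nonneg f x
      nlinarith
    set G : Euc N → Euc N := fun x => (-(ψ x / q x)) • w x with hG
    have cG : ContDiff ℝ 1 G := by
      have h1 : ContDiff ℝ 1 (fun x => -(ψ x / q x)) := (hψ.div cq fun x => (q0 x).ne').neg
      exact h1.smul cw
    have sG : HasCompactSupport G := by
      refine hψs.mono ?_
      intro x hx
      rw [Function.mem_support] at hx ⊢
      contrapose! hx
      simp only [hG, hx, zero_div, neg_zero, zero_smul]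
    have bG : ∀ x, ‖G x‖ ≤ 1 := by
      intro x
      simp only [hG]
      rw [norm_smul, norm_neg, Real.norm_eq_abs, abs_of_nonneg (div_nonneg (h0 x) (q0 x).le), nw', div_mul_eq_mul_div,
        div_le_one (q0 x)]
      have := h0 x; have := h1 x; have := qk x; have := kg_nonneg f x
      nlinarith
    have := hP G cG sG bG
    rw [divg_ibp hf1 cG sG, ← integral_neg] at this
    have e1 : ∀ x, - fderiv ℝ f x (G x) = ψ x * (kg f x ^ 2 / q x) := by
      intro x
      rw [dual_sum, ← nw, EuclideanSpace.real_norm_sq_eq, Finset.sum_div, Finset.mul_sum, ← Finset.sum_neg_distrib]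
      refine Finset.sum_congr rfl fun i _ => ?_
      simp only [hG, hw, PiLp.smul_apply, smul_eq_mul]
      ring
    simp only [e1] at this
    have cq' : Continuous q := cq.continuous
    have hle : ∫ x, (ψ x * kg f x - σ * ψ x) ≤ ∫ x, ψ x * (kg f x ^ 2 / q x) := by
      refine integral_mono (ik.sub (iψ.const_mul σ)) ?_ ?_
      · refine (hψ.continuous.mul ((ckg.pow 2).div cq' fun x => (q0 x).ne')).integrable_of_hasCompactSupport hψs.mul_right
      · intro x
        have k0 := kg_nonneg f x
        have : kg f x - σ ≤ kg f x ^ 2 / q x := by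
          rw [le_div_iff₀ (q0 x)]
          have h2 := qs x; have h3 := q0 x; have h4 := qk x
          have h5 : q x ≤ kg f x + σ := by nlinarith
          rcases le_or_gt (kg f x) σ with h | h
          · nlinarith
          · nlinarith
        have := mul_le_mul_of_nonneg_left this (h0 x)
        simp only
        linarith
    rw [integral_sub ik (iψ.const_mul σ), integral_const_mul] at hle
    linarith
  have hI : 0 ≤ ∫ x, ψ x := integral_nonneg h0
  refine le_of_forall_pos_le_add fun ε hε => ?_
  refine (step (ε / (1 + ∫ x, ψ x)) (by positivity)).trans ?_
  have : ε / (1 + ∫ x, ψ x) * ∫ x, ψ x ≤ ε := by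
    rw [div_mul_eq_mul_div, div_le_iff₀ (by positivity)]
    nlinarith
  linarith

lemma chi_nn {N : ℕ} (F : Set (Euc N)) (x : Euc N) : 0 ≤ chi F x := by
  unfold chi; by_cases h : x ∈ F <;> simp [h]
lemma chi_le {N : ℕ} (F : Set (Euc N)) (x : Euc N) : chi F x ≤ 1 := by
  unfold chi; by_cases h : x ∈ F <;> simp [h]
lemma chi_int {N : ℕ} {F : Set (Euc N)} (hF : MeasurableSet F) (hv : volume F ≠ ⊤) : Integrable (chi F) := by
  unfold chi
  exact (integrable_indicator_iff hF).2 (integrableOn_const (C := (1 : ℝ)) hv)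
lemma chi_integral {N : ℕ} {F : Set (Euc N)} (hF : MeasurableSet F) : ∫ x, chi F x = (volume F).toReal := by
  unfold chi
  rw [integral_indicator_one hF]; rfl
lemma chi_mul {N : ℕ} {F : Set (Euc N)} (hF : MeasurableSet F) (g : Euc N → ℝ) :
    ∫ x, chi F x * g x = ∫ x in F, g x := by
  rw [← integral_indicator hF]
  congr 1; ext x
  unfold chi; by_cases h : x ∈ F <;> simp [h]

lemma divg_trans {N : ℕ} {G : Euc N → Euc N} (hG : ContDiff ℝ 1 G) (t x : Euc N) :
    divg (fun y => G (y + t)) x = divg G (x + t) := by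
  unfold divg
  rw [fderiv_comp_add_right]

lemma le_perim {N : ℕ} {F : Set (Euc N)} (hP : HasFinitePerim F) {G : Euc N → Euc N} (hG : ContDiff ℝ 1 G)
    (hGs : HasCompactSupport G) (hb : ∀ x, ‖G x‖ ≤ 1) : ∫ x in F, divg G x ≤ perim F :=
  le_csSup hP ⟨G, hG, hGs, hb, rfl⟩

lemma perim_nn {N : ℕ} {F : Set (Euc N)} (hP : HasFinitePerim F) : 0 ≤ perim F := by
  have := le_perim hP (G := fun _ => 0) contDiff_const HasCompactSupport.zero (by simp)
  simpa [divg] using this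

lemma mol {N : ℕ} {F : Set (Euc N)} (hF : MeasurableSet F) (hv : volume F ≠ ⊤) (hP : HasFinitePerim F)
    (φ : ContDiffBump (0 : Euc N)) (f : Euc N → ℝ)
    (hf : f = convolution (φ.normed volume) (chi F) (ContinuousLinearMap.lsmul ℝ ℝ) volume) :
    ContDiff ℝ 2 f ∧ (∀ x, 0 ≤ f x) ∧ (∀ x, f x ≤ 1) ∧ Integrable f ∧ ∫ x, f x = (volume F).toReal ∧
    (∀ G : Euc N → Euc N, ContDiff ℝ 1 G → HasCompactSupport G → (∀ x, ‖G x‖ ≤ 1) → ∫ x, f x * divg G x ≤ perim F) := by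
  have ci := chi_int hF hv
  have hex : ∀ x, f x = ∫ t, φ.normed volume t * chi F (x - t) := fun x => by rw [hf]; rfl
  have ρi : Integrable (φ.normed volume) := φ.integrable_normed
  have ρ0 := φ.nonneg_normed (μ := volume)
  have cm : Measurable (chi F) := measurable_one.indicator hF
  have fint : Integrable f := by
    rw [hf]; exact Integrable.integrable_convolution _ ρi ci
  refine ⟨?_, ?_, ?_, fint, ?_, ?_⟩
  · rw [hf]
    exact HasCompactSupport.contDiff_convolution_left _ φ.hasCompactSupport_normed φ.contDiff_normed ci.locallyIntegrable
  · intro x; rw [hex]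
    exact integral_nonneg fun t => mul_nonneg (ρ0 t) (chi_nn _ _)
  · intro x; rw [hex, ← φ.integral_normed (μ := volume)]
    refine integral_mono_of_nonneg (Eventually.of_forall fun t => mul_nonneg (ρ0 t) (chi_nn _ _)) ρi
      (Eventually.of_forall fun t => mul_le_of_le_one_right (ρ0 t) (chi_le _ _))
  · rw [hf, integral_convolution _ ρi ci, φ.integral_normed, chi_integral hF]
    simp
  · intro G hG hGs hb
    have dc := divg_cont hG
    have di : Integrable (divg G) := dc.integrable_of_hasCompactSupport (divg_cs hGs)
    obtain ⟨M, hM⟩ := dc.bounded_above_of_compact_support (divg_cs hGs)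
    have e1 : ∀ x, f x * divg G x = ∫ t, φ.normed volume t * chi F (x - t) * divg G x := fun x => by
      rw [hex, integral_mul_const]
    simp only [e1]
    have I2 : Integrable (Function.uncurry fun x t => φ.normed volume t * chi F (x - t) * divg G x)
        ((volume : Measure (Euc N)).prod volume) := by
      have hi := (di.norm.mul_prod ρi.norm)
      refine hi.mono' ?_ ?_
      · refine Measurable.aestronglyMeasurable ?_
        have := φ.continuous_normed (μ := volume)
        exact ((this.measurable.comp measurable_snd).mul (cm.comp (measurable_fst.sub measurable_snd))).mul
          (dc.measurable.comp measurable_fst)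
      · refine Eventually.of_forall fun z => ?_
        simp only [Function.uncurry, norm_mul]
        have h1 := chi_nn F (z.1 - z.2); have h2 := chi_le F (z.1 - z.2)
        have h3 : ‖chi F (z.1 - z.2)‖ ≤ 1 := by rw [Real.norm_eq_abs, abs_le]; constructor <;> linarith
        have := mul_le_mul_of_nonneg_left h3 (mul_nonneg (norm_nonneg (divg G z.1)) (norm_nonneg (φ.normed volume z.2)))
        linarith
    rw [integral_integral_swap I2]
    have e2 : ∀ t, ∫ x, φ.normed volume t * chi F (x - t) * divg G x =
        φ.normed volume t * ∫ y in F, divg (fun y => G (y + t)) y := by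
      intro t
      rw [← chi_mul hF, ← integral_const_mul,
        ← integral_sub_right_eq_self (fun y => φ.normed volume t * (chi F y * divg (fun y => G (y + t)) y)) t]
      congr 1; ext x
      rw [divg_trans hG, sub_add_cancel]
      ring
    simp only [e2]
    have : perim F = ∫ t, φ.normed volume t * perim F := by
      rw [integral_mul_const, φ.integral_normed, one_mul]
    rw [this]
    refine integral_mono ?_ (ρi.mul_const _) ?_
    · have := I2.integral_prod_right
      refine this.congr (Eventually.of_forall fun t => ?_)
      simp only [Function.uncurry, e2]
    · intro t
      refine mul_le_mul_of_nonneg_left ?_ (ρ0 t)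
      refine le_perim hP (hG.comp (contDiff_id.add contDiff_const)) ?_ fun x => hb _
      exact hGs.comp_homeomorph (Homeomorph.addRight t)

lemma kg_mul_le {N : ℕ} {f g : Euc N → ℝ} (hf : ContDiff ℝ 1 f) (hg : ContDiff ℝ 1 g) (x : Euc N) :
    kg (fun y => f y * g y) x ≤ |f x| * kg g x + |g x| * kg f x := by
  unfold kg
  rw [show (fun y => f y * g y) = f * g from rfl,
    fderiv_mul (hf.differentiable (by simp) x) (hg.differentiable (by simp) x)]
  refine (norm_add_le _ _).trans ?_
  rw [norm_smul, norm_smul]; rfl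

lemma kg_dil {N : ℕ} {f : Euc N → ℝ} (hf : ContDiff ℝ 1 f) (a : ℝ) (x : Euc N) :
    kg (fun y => f (a • y)) x = |a| * kg f (a • x) := by
  unfold kg
  have h1 := (hf.differentiable (by simp) (a • x)).hasFDerivAt
  have h2 : HasFDerivAt (fun y : Euc N => a • y) (a • ContinuousLinearMap.id ℝ (Euc N)) x :=
    (hasFDerivAt_id x).const_smul a
  have h3 := (h1.comp x h2).fderiv
  change fderiv ℝ (fun y => f (a • y)) x = _ at h3
  rw [h3]
  simp [norm_smul]

lemma approx {N : ℕ} {F : Set (Euc N)} (hF : MeasurableSet F) (hv : volume F ≠ ⊤) (hP : HasFinitePerim F)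
    {ε : ℝ} (hε : 0 < ε) : ∃ f : Euc N → ℝ, TF f ∧ ∫ x, |f x - chi F x| ≤ ε ∧ ∫ x, kg f x ≤ perim F + ε := by
  have ci := chi_int hF hv
  have cm : Measurable (chi F) := measurable_one.indicator hF
  let η : ContDiffBump (0 : Euc N) := ⟨1, 2, one_pos, one_lt_two⟩
  have ηc : ContDiff ℝ 1 η := η.contDiff
  have ηs : HasCompactSupport η := η.hasCompactSupport
  obtain ⟨M, hM⟩ := (ηc.continuous_fderiv (by simp)).bounded_above_of_compact_support (ηs.fderiv (𝕜 := ℝ))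
  let a : ℕ → ℝ := fun j => 1 / ((j : ℝ) + 1)
  have a0 : ∀ j, 0 < a j := fun j => by positivity
  have alim : Tendsto a atTop (nhds 0) := tendsto_one_div_add_atTop_nhds_zero_nat
  let φ : ℕ → ContDiffBump (0 : Euc N) := fun j => ⟨a j, 2 * a j, a0 j, by have := a0 j; linarith⟩
  let f0 : ℕ → Euc N → ℝ := fun j =>
    convolution ((φ j).normed volume) (chi F) (ContinuousLinearMap.lsmul ℝ ℝ) volume
  have hm := fun j => mol hF hv hP (φ j) (f0 j) rfl
  let ηj : ℕ → Euc N → ℝ := fun j x => η (a j • x)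
  have ηjc : ∀ j, ContDiff ℝ 1 (ηj j) := fun j => ηc.comp (contDiff_const_smul (a j))
  have ηjs : ∀ j, HasCompactSupport (ηj j) := fun j =>
    ηs.comp_homeomorph (Homeomorph.smulOfNeZero (a j) (a0 j).ne')
  have ηj0 : ∀ j x, 0 ≤ ηj j x := fun j x => η.nonneg
  have ηj1 : ∀ j x, ηj j x ≤ 1 := fun j x => η.le_one
  let f : ℕ → Euc N → ℝ := fun j x => ηj j x * f0 j x
  have hTF : ∀ j, TF (f j) := fun j =>
    ⟨(ηjc j).mul ((hm j).1.of_le (by norm_num)), (ηjs j).mul_right, fun x => mul_nonneg (ηj0 j x) ((hm j).2.1 x),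
      fun x => mul_le_one₀ (ηj1 j x) ((hm j).2.1 x) ((hm j).2.2.1 x)⟩
  have hk : ∀ j, ∫ x, kg (f j) x ≤ perim F + a j * M * (volume F).toReal := by
    intro j
    obtain ⟨c2, h0, h1, hi, hI, hG⟩ := hm j
    have c1 : ContDiff ℝ 1 (f0 j) := c2.of_le (by norm_num)
    have g := grad_le c2 (perim F) hG (ηjc j) (ηjs j) (ηj0 j) (ηj1 j)
    have gi : Integrable (fun x => ηj j x * kg (f0 j) x) :=
      ((ηjc j).continuous.mul (c1.continuous_fderiv (by simp)).norm).integrable_of_hasCompactSupport (ηjs j).mul_right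
    have : ∫ x, kg (f j) x ≤ ∫ x, (ηj j x * kg (f0 j) x + a j * M * f0 j x) := by
      refine integral_mono (hTF j).kg_int (gi.add (hi.const_mul _)) fun x => ?_
      refine (kg_mul_le (ηjc j) c1 x).trans ?_
      rw [kg_dil ηc, abs_of_nonneg (ηj0 j x), abs_of_nonneg (h0 x), abs_of_pos (a0 j)]
      have : kg η (a j • x) ≤ M := hM _
      have := mul_le_mul_of_nonneg_left this (mul_nonneg (h0 x) (a0 j).le)
      linarith
    rw [integral_add gi (hi.const_mul _), integral_const_mul, hI] at this
    linarith
  have hlim : ∀ᵐ x, Tendsto (fun j => f j x) atTop (nhds (chi F x)) := by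
    have h1 := ContDiffBump.ae_convolution_tendsto_right_of_locallyIntegrable (φ := φ) (l := atTop) (K := 2) (μ := volume)
      (g := chi F) (by simpa using alim.const_mul 2) (Eventually.of_forall fun j => le_rfl) ci.locallyIntegrable
    filter_upwards [h1] with x hx
    have h2 : Tendsto (fun j => ηj j x) atTop (nhds 1) := by
      have : Tendsto (fun j => η (a j • x)) atTop (nhds (η ((0 : ℝ) • x))) :=
        (ηc.continuous.tendsto _).comp (alim.smul_const x)
      rwa [zero_smul, η.one_of_mem_closedBall (mem_closedBall_self η.rIn_pos.le)] at this
    have := h2.mul hx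
    rwa [one_mul] at this
  have hL : Tendsto (fun j => ∫ x, max (chi F x - f j x) 0) atTop (nhds (∫ x : Euc N, (0 : ℝ))) := by
    refine tendsto_integral_of_dominated_convergence (chi F) ?_ ci ?_ ?_
    · intro j
      exact ((cm.sub (hTF j).c1.continuous.measurable).max measurable_const).aestronglyMeasurable
    · intro j
      refine Eventually.of_forall fun x => ?_
      rw [Real.norm_of_nonneg (le_max_right _ _)]
      exact max_le (by have := (hTF j).nn x; linarith) (chi_nn F x)
    · filter_upwards [hlim] with x hx
      have := ((tendsto_const_nhds (x := chi F x)).sub hx).max (tendsto_const_nhds (x := (0 : ℝ)))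
      simpa using this
  rw [integral_zero] at hL
  have hB : Tendsto (fun j => a j * M * (volume F).toReal) atTop (nhds 0) := by
    simpa using (alim.mul_const M).mul_const (volume F).toReal
  obtain ⟨j, hj1, hj2⟩ := ((hL.eventually (gt_mem_nhds (half_pos hε))).and (hB.eventually (gt_mem_nhds hε))).exists
  refine ⟨f j, hTF j, ?_, (hk j).trans (by linarith)⟩
  have fi := (hTF j).int
  have mi : Integrable (fun x => max (chi F x - f j x) 0) := (ci.sub fi).pos_part
  have e : ∀ x, |f j x - chi F x| = 2 * max (chi F x - f j x) 0 + (f j x - chi F x) := by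
    intro x
    rcases le_total (chi F x) (f j x) with h | h
    · rw [abs_of_nonneg (by linarith), max_eq_right (by linarith)]; ring
    · rw [abs_of_nonpos (by linarith), max_eq_left (by linarith)]; ring
  simp only [e]
  have di : Integrable (fun x => f j x - chi F x) := fi.sub ci
  rw [integral_add (mi.const_mul 2) di, integral_const_mul, integral_sub fi ci, chi_integral hF]
  have : ∫ x, f j x ≤ (volume F).toReal := by
    rw [← (hm j).2.2.2.2.1]
    exact integral_mono fi (hm j).2.2.2.1 fun x => mul_le_of_le_one_left ((hm j).2.1 x) (ηj1 j x)
  linarith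

lemma iso {N : ℕ} (hN : 1 ≤ N) {F : Set (Euc N)} (hF : MeasurableSet F) (hv : volume F ≠ ⊤) (hP : HasFinitePerim F) :
    (N : ℝ) * (ballVol N) ^ ((1 : ℝ) / N) * (volume F).toReal ≤ (volume F).toReal ^ ((1 : ℝ) / N) * perim F := by
  set V := (volume F).toReal with hV
  have V0 : 0 ≤ V := ENNReal.toReal_nonneg
  have P0 := perim_nn hP
  have hN' : (0 : ℝ) < 1 / N := by positivity
  have hω := ballVol_pos N
  have key : ∀ ε : ℝ, 0 < ε → (N : ℝ) * (ballVol N) ^ ((1 : ℝ) / N) * (V - 2 * ε) ≤ (V + ε) ^ ((1 : ℝ) / N) * (perim F + ε) := by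
    intro ε hε
    obtain ⟨f, hf, h1, h2⟩ := approx hF hv hP hε
    have ci := chi_int hF hv
    have ai : Integrable (fun x => |f x - chi F x|) := (hf.int.sub ci).abs
    have e1 : V - 2 * ε ≤ ∫ x, f x ^ 2 := by
      have : ∫ x, (chi F x - 2 * |f x - chi F x|) ≤ ∫ x, f x ^ 2 := by
        refine integral_mono (ci.sub (ai.const_mul 2)) hf.sq_int fun x => ?_
        have h0 := hf.nn x; have h1 := hf.le x
        simp only
        by_cases hx : x ∈ F
        · simp only [chi, hx, indicator_of_mem, Pi.one_apply]
          rw [abs_of_nonpos (by linarith)]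
          nlinarith
        · simp only [chi, hx, not_false_eq_true, indicator_of_notMem]
          rw [abs_of_nonneg (by linarith)]
          nlinarith
      rw [integral_sub ci (ai.const_mul 2), chi_integral hF, integral_const_mul] at this
      linarith
    have e2 : ∫ x, f x ≤ V + ε := by
      have : ∫ x, f x ≤ ∫ x, (chi F x + |f x - chi F x|) :=
        integral_mono hf.int (ci.add ai) fun x => by
          have := le_abs_self (f x - chi F x)
          simp only; linarith
      rw [integral_add ci ai, chi_integral hF] at this
      linarith
    have r := RI_all N hN f hf
    have e0 : 0 ≤ ∫ x, f x := integral_nonneg hf.nn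
    calc _ ≤ (N : ℝ) * (ballVol N) ^ ((1 : ℝ) / N) * ∫ x, f x ^ 2 := by gcongr
      _ ≤ _ := r
      _ ≤ _ := by
        have := integral_nonneg (μ := volume) (f := kg f) (kg_nonneg f)
        gcongr
  have l1 : Tendsto (fun ε : ℝ => (N : ℝ) * (ballVol N) ^ ((1 : ℝ) / N) * (V - 2 * ε)) (nhdsWithin 0 (Ioi 0))
      (nhds ((N : ℝ) * (ballVol N) ^ ((1 : ℝ) / N) * (V - 2 * 0))) := by
    refine Tendsto.mono_left (Continuous.tendsto ?_ _) nhdsWithin_le_nhds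
    fun_prop
  have l2 : Tendsto (fun ε : ℝ => (V + ε) ^ ((1 : ℝ) / N) * (perim F + ε)) (nhdsWithin 0 (Ioi 0))
      (nhds ((V + 0) ^ ((1 : ℝ) / N) * (perim F + 0))) := by
    refine Tendsto.mono_left (Continuous.tendsto ?_ _) nhdsWithin_le_nhds
    have : Continuous fun ε : ℝ => (V + ε) ^ ((1 : ℝ) / N) :=
      (continuous_const.add continuous_id).rpow_const fun x => Or.inr hN'.le
    fun_prop
  have := le_of_tendsto_of_tendsto l1 l2 (eventually_mem_nhdsWithin.mono fun ε hε => key ε hε)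
  simpa using this

lemma vol_ball {N : ℕ} (c : Euc N) {r : ℝ} (hr : 0 < r) : (volume (ball c r)).toReal = r ^ N * ballVol N := by
  unfold ballVol
  rw [Measure.addHaar_ball_of_pos _ _ hr, ENNReal.toReal_mul, ENNReal.toReal_ofReal (by positivity)]
  simp

/-- radial cutoffs -/
lemma rad_cut {N : ℕ} {r h : ℝ} (hr : 0 < r) (hh : 0 < h) : ∃ f : Euc N → ℝ, TF f ∧ (∀ x ∈ ball (0 : Euc N) r, f x = 1) ∧
    (∀ x, x ∉ ball (0 : Euc N) (r + h) → f x = 0) ∧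
    ∫ x, kg f x ≤ N * ((r + h) ^ N * ballVol N) / r := by
  set d := (r + h) ^ 2 - r ^ 2 with hd
  have d0 : 0 < d := by rw [hd]; nlinarith
  set f : Euc N → ℝ := fun x => Real.smoothTransition (((r + h) ^ 2 - ‖x‖ ^ 2) / d) with hf
  have fz : ∀ x, x ∉ ball (0 : Euc N) (r + h) → f x = 0 := by
    intro x hx
    rw [mem_ball_zero_iff, not_lt] at hx
    refine Real.smoothTransition.zero_of_nonpos (div_nonpos_of_nonpos_of_nonneg ?_ d0.le)
    nlinarith
  have fo : ∀ x : Euc N, ‖x‖ ≤ r → f x = 1 := by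
    intro x hx
    refine Real.smoothTransition.one_of_one_le ((one_le_div d0).2 ?_)
    rw [hd]
    nlinarith [norm_nonneg x]
  have fc : ContDiff ℝ 1 f := by
    have : ContDiff ℝ 1 fun x : Euc N => ((r + h) ^ 2 - ‖x‖ ^ 2) / d :=
      (contDiff_const.sub (contDiff_norm_sq ℝ)).div_const _
    exact (Real.smoothTransition.contDiff (n := 1)).comp this
  have hT : TF f := by
    refine ⟨fc, ?_, fun x => Real.smoothTransition.nonneg _, fun x => Real.smoothTransition.le_one _⟩
    refine HasCompactSupport.intro (isCompact_closedBall (0 : Euc N) (r + h)) fun x hx => fz x fun hx' => hx (ball_subset_closedBall hx')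
  refine ⟨f, hT, fun x hx => fo x (by rw [mem_ball_zero_iff] at hx; exact hx.le), fz, ?_⟩
  set w : Euc N → ℝ := fun x => deriv Real.smoothTransition (((r + h) ^ 2 - ‖x‖ ^ 2) / d) * (2 / d) with hw
  have w0 : ∀ x, 0 ≤ w x := fun x => mul_nonneg Real.smoothTransition.monotone.deriv_nonneg (by positivity)
  have hfd : ∀ x, fderiv ℝ f x = - (w x • (innerSL ℝ x : Euc N →L[ℝ] ℝ)) := by
    intro x
    have h1 : HasFDerivAt (fun x : Euc N => ((r + h) ^ 2 - ‖x‖ ^ 2) * d⁻¹) (d⁻¹ • (-((2 : ℕ) • (innerSL ℝ x : Euc N →L[ℝ] ℝ)))) x :=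
      (((hasStrictFDerivAt_norm_sq x).hasFDerivAt).const_sub ((r + h) ^ 2)).mul_const d⁻¹
    have h2 : HasDerivAt Real.smoothTransition (deriv Real.smoothTransition (((r + h) ^ 2 - ‖x‖ ^ 2) / d))
        (((r + h) ^ 2 - ‖x‖ ^ 2) * d⁻¹) :=
      ((Real.smoothTransition.contDiff (n := 1)).differentiable (by simp) _).hasDerivAt
    have := (h2.comp_hasFDerivAt x h1).fderiv
    change fderiv ℝ f x = _ at this
    rw [this, hw]
    ext v
    simp
    ring
  have kf : ∀ x, kg f x = w x * ‖x‖ := by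
    intro x
    unfold kg
    rw [hfd, norm_neg, norm_smul, innerSL_apply_norm, Real.norm_of_nonneg (w0 x)]
  have ki := hT.kg_int
  have hxi : ∀ i, Integrable (fun x => f x * 1) ∧ Integrable (fun x => fderiv ℝ f x (EuclideanSpace.single i 1) * x i) ∧
      ∫ x, f x * 1 = - ∫ x, fderiv ℝ f x (EuclideanSpace.single i 1) * x i := fun i =>
    ibp_one hT (EuclideanSpace.single i 1) (fun _ => (EuclideanSpace.proj i : Euc N →L[ℝ] ℝ))
      (fun x => (EuclideanSpace.proj i : Euc N →L[ℝ] ℝ).hasFDerivAt) (fun x => by simp) continuous_const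
  have hsum : (N : ℝ) * ∫ x, f x = ∫ x, w x * ‖x‖ ^ 2 := by
    have e : ∀ x, w x * ‖x‖ ^ 2 = ∑ i, - (fderiv ℝ f x (EuclideanSpace.single i 1) * x i) := by
      intro x
      rw [EuclideanSpace.real_norm_sq_eq, Finset.mul_sum]
      refine Finset.sum_congr rfl fun i _ => ?_
      rw [hfd]
      simp [EuclideanSpace.inner_single_right]
      ring
    simp only [e]
    have ii : ∀ i, Integrable (fun x => -(fderiv ℝ f x (EuclideanSpace.single i 1) * x i)) := fun i => (hxi i).2.1.neg
    rw [integral_finsetSum _ fun i _ => ii i]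
    simp only [integral_neg, ← (hxi _).2.2, mul_one]
    simp
  have wi : Integrable (fun x => w x * ‖x‖ ^ 2) := by
    have : Continuous fun x => kg f x * ‖x‖ := (kg_cont hT).mul continuous_norm
    have := this.integrable_of_hasCompactSupport (μ := volume) (kg_cs hT).mul_right
    refine this.congr (Eventually.of_forall fun x => ?_)
    simp only [kf]; ring
  have h1 : ∫ x, kg f x ≤ ∫ x, (w x * ‖x‖ ^ 2) / r := by
    refine integral_mono ki (wi.div_const r) fun x => ?_
    simp only
    rw [kf, le_div_iff₀ hr]
    rcases lt_or_ge ‖x‖ r with hx | hx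
    · have hw0 : w x * ‖x‖ = 0 := by
        rw [← kf]; unfold kg
        have : f =ᶠ[nhds x] fun _ => 1 := by
          filter_upwards [(isOpen_lt continuous_norm continuous_const).mem_nhds hx] with y hy
          exact fo y (le_of_lt hy)
        rw [this.fderiv_eq]; simp
      rw [hw0, zero_mul]
      have := w0 x
      positivity
    · nlinarith [mul_nonneg (mul_nonneg (w0 x) (norm_nonneg x)) (sub_nonneg.2 hx)]
  rw [integral_div, ← hsum] at h1
  refine h1.trans ?_
  have h2 : ∫ x, f x ≤ (r + h) ^ N * ballVol N := by
    rw [← vol_ball (0 : Euc N) (by linarith), ← chi_integral measurableSet_ball]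
    refine integral_mono hT.int (chi_int measurableSet_ball measure_ball_lt_top.ne) fun x => ?_
    by_cases hx : x ∈ ball (0 : Euc N) (r + h)
    · simp only [chi, hx, indicator_of_mem, Pi.one_apply]; exact hT.le x
    · rw [fz x hx]; exact chi_nn _ _
  gcongr

lemma ball_le {N : ℕ} {r : ℝ} (hr : 0 < r) {G : Euc N → Euc N} (hG : ContDiff ℝ 1 G) (hGs : HasCompactSupport G)
    (hb : ∀ x, ‖G x‖ ≤ 1) : ∫ x in ball (0 : Euc N) r, divg G x ≤ N * (r ^ N * ballVol N) / r := by
  have dc := divg_cont hG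
  have di : Integrable (divg G) := dc.integrable_of_hasCompactSupport (divg_cs hGs)
  obtain ⟨M, hM⟩ := dc.bounded_above_of_compact_support (divg_cs hGs)
  have key : ∀ h : ℝ, 0 < h → ∫ x in ball (0 : Euc N) r, divg G x ≤
      N * ((r + h) ^ N * ballVol N) / r + M * ((r + h) ^ N * ballVol N - r ^ N * ballVol N) := by
    intro h hh
    obtain ⟨f, hT, f1, f0, hk⟩ := rad_cut (N := N) hr hh
    rw [← chi_mul measurableSet_ball]
    have c1 := chi_int (measurableSet_ball (x := (0 : Euc N)) (ε := r)) measure_ball_lt_top.ne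
    have c2 := chi_int (measurableSet_ball (x := (0 : Euc N)) (ε := r + h)) measure_ball_lt_top.ne
    have ifd : Integrable (fun x => f x * divg G x) :=
      (hT.c1.continuous.mul dc).integrable_of_hasCompactSupport hT.cs.mul_right
    have sd : Integrable (fun x => M * (chi (ball (0 : Euc N) (r + h)) x - chi (ball (0 : Euc N) r) x)) := (c2.sub c1).const_mul M
    have h1 : ∫ x, chi (ball (0 : Euc N) r) x * divg G x ≤ ∫ x, (f x * divg G x +
        M * (chi (ball (0 : Euc N) (r + h)) x - chi (ball (0 : Euc N) r) x)) := by
      refine integral_mono ?_ (ifd.add sd) fun x => ?_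
      · refine di.norm.mono' ((measurable_one.indicator measurableSet_ball).mul dc.measurable).aestronglyMeasurable
          (Eventually.of_forall fun x => ?_)
        rw [norm_mul]
        refine mul_le_of_le_one_left (norm_nonneg _) ?_
        rw [Real.norm_of_nonneg (chi_nn _ x)]
        exact chi_le _ x
      · have hm := hM x
        rw [Real.norm_eq_abs] at hm
        have hm' := abs_le.1 hm
        simp only
        by_cases hx : x ∈ ball (0 : Euc N) r
        · have hx2 : x ∈ ball (0 : Euc N) (r + h) := ball_subset_ball (by linarith) hx
          rw [f1 x hx]
          simp [chi, hx, hx2]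
        · by_cases hx2 : x ∈ ball (0 : Euc N) (r + h)
          · simp only [chi, hx, hx2, not_false_eq_true, indicator_of_notMem, indicator_of_mem, Pi.one_apply]
            have := hT.nn x; have := hT.le x
            nlinarith
          · rw [f0 x hx2]
            simp [chi, hx, hx2]
    rw [integral_add ifd sd, integral_const_mul, integral_sub c2 c1, chi_integral measurableSet_ball,
      chi_integral measurableSet_ball, vol_ball _ (by linarith), vol_ball _ hr, divg_ibp hT.c1 hG hGs] at h1
    have h2 : - ∫ x, fderiv ℝ f x (G x) ≤ ∫ x, kg f x := by
      rw [← integral_neg]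
      refine integral_mono ?_ hT.kg_int fun x => ?_
      · have : Continuous fun x => fderiv ℝ f x (G x) := (hT.c1.continuous_fderiv (by simp)).clm_apply hG.continuous
        refine (this.integrable_of_hasCompactSupport ?_).neg
        refine hGs.mono fun x hx => ?_
        rw [Function.mem_support] at hx ⊢
        contrapose! hx
        rw [hx, map_zero]
      · have h3 := (fderiv ℝ f x).le_opNorm (G x)
        have h4 := neg_abs_le (fderiv ℝ f x (G x))
        rw [Real.norm_eq_abs] at h3
        have h5 := mul_le_of_le_one_right (kg_nonneg f x) (hb x)
        unfold kg at h5 ⊢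
        simp only
        linarith
    linarith
  have l2 : Tendsto (fun h : ℝ => N * ((r + h) ^ N * ballVol N) / r + M * ((r + h) ^ N * ballVol N - r ^ N * ballVol N))
      (nhdsWithin 0 (Ioi 0)) (nhds (N * ((r + 0) ^ N * ballVol N) / r + M * ((r + 0) ^ N * ballVol N - r ^ N * ballVol N))) := by
    refine Tendsto.mono_left (Continuous.tendsto ?_ _) nhdsWithin_le_nhds
    fun_prop
  have := ge_of_tendsto l2 (eventually_mem_nhdsWithin.mono fun ε hε => key ε hε)
  simpa using this

lemma ball_perim {N : ℕ} (hN : 1 ≤ N) {r : ℝ} (hr : 0 < r) :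
    HasFinitePerim (ball (0 : Euc N) r) ∧ perim (ball (0 : Euc N) r) = N * (r ^ N * ballVol N) / r := by
  have hb : ∀ y ∈ perimVals (ball (0 : Euc N) r), y ≤ N * (r ^ N * ballVol N) / r := by
    rintro y ⟨G, h1, h2, h3, rfl⟩
    exact ball_le hr h1 h2 h3
  have hP : HasFinitePerim (ball (0 : Euc N) r) := ⟨_, hb⟩
  refine ⟨hP, le_antisymm (csSup_le ⟨_, fun _ => 0, contDiff_const, HasCompactSupport.zero, by simp, rfl⟩ hb) ?_⟩
  have h := iso hN measurableSet_ball measure_ball_lt_top.ne hP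
  have hω := ballVol_pos N
  rw [vol_ball _ hr, Real.mul_rpow (by positivity) hω.le, ← Real.rpow_natCast r N, ← Real.rpow_mul hr.le,
    mul_one_div_cancel (by positivity), Real.rpow_one, Real.rpow_natCast] at h
  have h2 : 0 < ballVol N ^ (1 / (N : ℝ)) := by positivity
  rw [div_le_iff₀ hr]
  have := le_of_mul_le_mul_left (a := ballVol N ^ (1 / (N : ℝ))) (b := N * (r ^ N * ballVol N))
    (c := perim (ball (0 : Euc N) r) * r) (by linarith) h2
  exact this

lemma lint_rad {N : ℕ} (hN : 1 ≤ N) (g : ℝ → ℝ) (hg : ∀ t, 0 ≤ t → 0 ≤ g t) (k : ℝ → ℝ) (A : Set ℝ) (hA : MeasurableSet A)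
    (hA0 : A ⊆ Ioi 0) (hk : IntegrableOn k A) (he : ∀ t, 0 < t → t ^ (N - 1) * g t = A.indicator k t) :
    ∫⁻ z : Euc N, ENNReal.ofReal (g ‖z‖) = ENNReal.ofReal (N * ballVol N * ∫ t in A, k t) := by
  haveI : Nonempty (Fin N) := ⟨⟨0, hN⟩⟩
  have hi : IntegrableOn (fun y : ℝ => y ^ (Module.finrank ℝ (Euc N) - 1) • g y) (Ioi 0) := by
    have h1 : IntegrableOn (A.indicator k) (Ioi 0) := ((integrable_indicator_iff hA).2 hk).integrableOn
    refine h1.congr_fun (fun t ht => ?_) measurableSet_Ioi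
    rw [finrank_euclideanSpace_fin, smul_eq_mul, he t ht]
  have hi2 : Integrable (fun z : Euc N => g ‖z‖) := (integrable_fun_norm_addHaar (volume : Measure (Euc N)) (f := g)).2 hi
  rw [← ofReal_integral_eq_lintegral_ofReal hi2 (Eventually.of_forall fun z => hg _ (norm_nonneg z))]
  congr 1
  rw [integral_fun_norm_addHaar, finrank_euclideanSpace_fin, nsmul_eq_mul, smul_eq_mul, ← mul_assoc]
  have e : ∫ y in Ioi (0 : ℝ), y ^ (N - 1) • g y = ∫ t in A, k t := by
    rw [← integral_indicator hA]
    have : ∫ t, A.indicator k t = ∫ t in Ioi 0, A.indicator k t := by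
      rw [setIntegral_eq_integral_of_forall_compl_eq_zero]
      intro t ht
      exact indicator_of_notMem (fun h => ht (hA0 h)) _
    rw [this]
    exact setIntegral_congr_fun measurableSet_Ioi fun t ht => by rw [smul_eq_mul, he t ht]
  rw [e]; rfl

lemma pow_id {N : ℕ} (hN : 1 ≤ N) {t : ℝ} (ht : 0 < t) (p : ℝ) : t ^ (N - 1) * t ^ p = t ^ ((N : ℝ) - 1 + p) := by
  rw [← Real.rpow_natCast, ← Real.rpow_add ht, Nat.cast_sub hN]; simp

lemma near_int {N : ℕ} (hN : 1 ≤ N) {s R : ℝ} (hs1 : s < 1) (hR : 0 < R) :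
    ∫⁻ z : Euc N, ENNReal.ofReal ((Iio R).indicator (fun t => t ^ (-((N : ℝ) + s))) ‖z‖) * ENNReal.ofReal ‖z‖ =
      ENNReal.ofReal (N * ballVol N * (R ^ (1 - s) / (1 - s))) := by
  have h := lint_rad (N := N) hN (fun t => (Iio R).indicator (fun t => t ^ (-((N : ℝ) + s))) t * t)
    (fun t ht => mul_nonneg (indicator_apply_nonneg fun _ => Real.rpow_nonneg ht _) ht) (fun t => t ^ (-s)) (Ioo 0 R)
    measurableSet_Ioo (fun t ht => ht.1) ?_ ?_
  · have e : ∫ t in Ioo 0 R, t ^ (-s) = R ^ (1 - s) / (1 - s) := by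
      rw [← integral_Ioc_eq_integral_Ioo, ← intervalIntegral.integral_of_le hR.le, integral_rpow (Or.inl (by linarith)),
        Real.zero_rpow (by linarith), sub_zero]
      ring_nf
    rw [e] at h
    rw [← h]
    refine lintegral_congr fun z => ?_
    have i0 : 0 ≤ (Iio R).indicator (fun t : ℝ => t ^ (-((N : ℝ) + s))) ‖z‖ :=
      indicator_apply_nonneg fun _ => Real.rpow_nonneg (norm_nonneg z) _
    rw [ENNReal.ofReal_mul i0]
  · have := (intervalIntegral.intervalIntegrable_rpow' (a := 0) (b := R) (r := -s) (by linarith))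
    exact ((intervalIntegrable_iff_integrableOn_Ioc_of_le hR.le).1 this).mono_set Ioo_subset_Ioc_self
  · intro t ht
    by_cases h : t < R
    · rw [indicator_of_mem (by exact h), indicator_of_mem (by exact ⟨ht, h⟩), ← mul_assoc, pow_id hN ht]
      conv_lhs => rw [← Real.rpow_one t, ← Real.rpow_mul ht.le, ← Real.rpow_add ht]
      congr 1; ring
    · rw [indicator_of_notMem (by exact h), indicator_of_notMem (fun hh => h hh.2)]; simp

lemma far_int {N : ℕ} (hN : 1 ≤ N) {s R : ℝ} (hs0 : 0 < s) (hR : 0 < R) :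
    ∫⁻ z : Euc N, ENNReal.ofReal ((Ici R).indicator (fun t => t ^ (-((N : ℝ) + s))) ‖z‖) =
      ENNReal.ofReal (N * ballVol N * (R ^ (-s) / s)) := by
  have h := lint_rad (N := N) hN ((Ici R).indicator (fun t => t ^ (-((N : ℝ) + s))))
    (fun t ht => indicator_apply_nonneg fun _ => Real.rpow_nonneg ht _) (fun t => t ^ (-s - 1)) (Ici R)
    measurableSet_Ici (fun t ht => lt_of_lt_of_le hR ht) ?_ ?_
  · have e : ∫ t in Ici R, t ^ (-s - 1) = R ^ (-s) / s := by
      rw [integral_Ici_eq_integral_Ioi, integral_Ioi_rpow_of_lt (by linarith) hR]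
      rw [sub_add_cancel, neg_div_neg_eq]
    rw [e] at h
    exact h
  · rw [integrableOn_Ici_iff_integrableOn_Ioi]
    exact integrableOn_Ioi_rpow_of_lt (by linarith) hR
  · intro t ht
    by_cases h : R ≤ t
    · rw [indicator_of_mem (by exact h), indicator_of_mem (by exact h), pow_id hN ht]
      congr 1; ring
    · rw [indicator_of_notMem (by exact h), indicator_of_notMem (by exact h), mul_zero]

lemma avg_unit {N : ℕ} {κ : Euc N → ℝ≥0∞} (hκ : ∀ x y, ‖x‖ = ‖y‖ → κ x = κ y) {u v : Euc N} (h : ‖u‖ = ‖v‖) :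
    ∫⁻ z, κ z * ENNReal.ofReal |inner ℝ u z| = ∫⁻ z, κ z * ENNReal.ofReal |inner ℝ v z| := by
  let T := (Submodule.span ℝ {u - v})ᗮ.reflection
  have hT : T u = v := Submodule.reflection_sub h
  have hm : MeasurePreserving T := T.measurePreserving
  rw [← hm.lintegral_comp_emb T.toHomeomorph.measurableEmbedding (fun z => κ z * ENNReal.ofReal |inner ℝ v z|)]
  refine lintegral_congr fun z => ?_
  rw [← hT, T.inner_map_map, hκ (T z) z (T.norm_map z)]

lemma avg_one {N : ℕ} (hN : 1 ≤ N) {κ : Euc N → ℝ≥0∞} (hm : Measurable κ) (hκ : ∀ x y, ‖x‖ = ‖y‖ → κ x = κ y) {u : Euc N}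
    (h : ‖u‖ = 1) :
    ∫⁻ z, κ z * ENNReal.ofReal |inner ℝ u z| ≤ ENNReal.ofReal (1 / √N) * ∫⁻ z, κ z * ENNReal.ofReal ‖z‖ := by
  have h1 : (N : ℝ≥0∞) * ∫⁻ z, κ z * ENNReal.ofReal |inner ℝ u z| ≤ ENNReal.ofReal (√N) * ∫⁻ z, κ z * ENNReal.ofReal ‖z‖ := by
    have : (N : ℝ≥0∞) * ∫⁻ z, κ z * ENNReal.ofReal |inner ℝ u z| =
        ∑ i : Fin N, ∫⁻ z, κ z * ENNReal.ofReal |z i| := by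
      have e : ∀ i : Fin N, ∫⁻ z, κ z * ENNReal.ofReal |z i| = ∫⁻ z, κ z * ENNReal.ofReal |inner ℝ u z| := by
        intro i
        rw [avg_unit hκ (u := u) (v := EuclideanSpace.single i 1) (by simp [h])]
        simp [EuclideanSpace.inner_single_left]
      simp only [e]; simp
    rw [this, ← lintegral_finsetSum _ (fun i _ => by fun_prop), ← lintegral_const_mul _ (by fun_prop)]
    refine lintegral_mono fun z => ?_
    simp only
    rw [← Finset.mul_sum, mul_left_comm]
    gcongr
    rw [← ENNReal.ofReal_sum_of_nonneg (fun i _ => abs_nonneg _), ← ENNReal.ofReal_mul (Real.sqrt_nonneg _)]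
    apply ENNReal.ofReal_le_ofReal
    rw [EuclideanSpace.norm_eq, ← Real.sqrt_mul (by positivity)]
    apply Real.le_sqrt_of_sq_le
    have := sq_sum_le_card_mul_sum_sq (s := (Finset.univ : Finset (Fin N))) (f := fun i => |z i|)
    simpa using this
  have hN0 : (0 : ℝ) < N := by exact_mod_cast hN
  have h2 : ENNReal.ofReal (1 / N) * (N : ℝ≥0∞) = 1 := by
    rw [← ENNReal.ofReal_natCast, ← ENNReal.ofReal_mul (by positivity), one_div_mul_cancel hN0.ne', ENNReal.ofReal_one]
  have h3 : ENNReal.ofReal (1 / √N) = ENNReal.ofReal (1 / N) * ENNReal.ofReal (√N) := by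
    rw [← ENNReal.ofReal_mul (by positivity)]
    congr 1
    have := Real.mul_self_sqrt hN0.le
    have : 0 < √(N : ℝ) := Real.sqrt_pos.2 hN0
    field_simp
    rw [Real.sq_sqrt hN0.le]
  calc _ = ENNReal.ofReal (1 / N) * ((N : ℝ≥0∞) * ∫⁻ z, κ z * ENNReal.ofReal |inner ℝ u z|) := by
        rw [← mul_assoc, h2, one_mul]
    _ ≤ ENNReal.ofReal (1 / N) * (ENNReal.ofReal (√N) * ∫⁻ z, κ z * ENNReal.ofReal ‖z‖) := by gcongr
    _ = _ := by rw [h3, mul_assoc]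

lemma avg {N : ℕ} (hN : 1 ≤ N) {κ : Euc N → ℝ≥0∞} (hm : Measurable κ) (hκ : ∀ x y, ‖x‖ = ‖y‖ → κ x = κ y)
    (ℓ : Euc N →L[ℝ] ℝ) :
    ∫⁻ z, κ z * ENNReal.ofReal |ℓ z| ≤ ENNReal.ofReal ‖ℓ‖ * (ENNReal.ofReal (1 / √N) * ∫⁻ z, κ z * ENNReal.ofReal ‖z‖) := by
  rcases eq_or_ne ℓ 0 with rfl | h
  · simp
  · set v := (InnerProductSpace.toDual ℝ (Euc N)).symm ℓ with hv
    have hl : ∀ z, ℓ z = inner ℝ v z := fun z => (InnerProductSpace.toDual_symm_apply).symm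
    have hn : ‖v‖ = ‖ℓ‖ := LinearIsometryEquiv.norm_map _ _
    have h0 : 0 < ‖ℓ‖ := norm_pos_iff.2 h
    have hu : ‖(‖ℓ‖⁻¹ • v)‖ = 1 := by rw [norm_smul, hn, norm_inv, norm_norm, inv_mul_cancel₀ h0.ne']
    refine le_trans (le_of_eq ?_) (mul_le_mul_right (avg_one hN hm hκ hu) (ENNReal.ofReal ‖ℓ‖))
    rw [← lintegral_const_mul _ (by fun_prop)]
    refine lintegral_congr fun z => ?_
    rw [mul_left_comm, ← ENNReal.ofReal_mul h0.le, hl, real_inner_smul_left, abs_mul, abs_of_pos (inv_pos.2 h0), ← mul_assoc,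
      mul_inv_cancel₀ h0.ne', one_mul]

lemma diff_le {N : ℕ} {f : Euc N → ℝ} (hf : TF f) (z : Euc N) :
    ∫⁻ x, ENNReal.ofReal |f x - f (x + z)| ≤ ∫⁻ x, ENNReal.ofReal |fderiv ℝ f x z| := by
  have cf : Continuous fun x => fderiv ℝ f x z := (hf.c1.continuous_fderiv (by simp)).clm_apply continuous_const
  have hp : ∀ x, ENNReal.ofReal |f x - f (x + z)| ≤ ∫⁻ t in Icc (0 : ℝ) 1, ENNReal.ofReal |fderiv ℝ f (x + t • z) z| := by
    intro x
    have hd : ∀ t : ℝ, HasDerivAt (fun t : ℝ => f (x + t • z)) (fderiv ℝ f (x + t • z) z) t := by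
      intro t
      have h1 := (hf.c1.differentiable (by simp) (x + t • z)).hasFDerivAt
      have h2 : HasDerivAt (fun t : ℝ => x + t • z) z t := by
        simpa using ((hasDerivAt_id t).smul_const z).const_add x
      exact h1.comp_hasDerivAt t h2
    have hc : Continuous fun t : ℝ => fderiv ℝ f (x + t • z) z :=
      cf.comp (continuous_const.add (continuous_id.smul continuous_const))
    have h3 := intervalIntegral.integral_eq_sub_of_hasDerivAt (a := 0) (b := 1) (fun t _ => hd t) (hc.intervalIntegrable _ _)
    simp only [one_smul, zero_smul, add_zero] at h3
    rw [abs_sub_comm, ← h3, intervalIntegral.integral_of_le zero_le_one, ← integral_Icc_eq_integral_Ioc]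
    have := enorm_integral_le_lintegral_enorm (μ := volume.restrict (Icc (0 : ℝ) 1)) fun t => fderiv ℝ f (x + t • z) z
    simpa only [Real.enorm_eq_ofReal_abs] using this
  calc _ ≤ ∫⁻ x, ∫⁻ t in Icc (0 : ℝ) 1, ENNReal.ofReal |fderiv ℝ f (x + t • z) z| := lintegral_mono hp
    _ = ∫⁻ t in Icc (0 : ℝ) 1, ∫⁻ x, ENNReal.ofReal |fderiv ℝ f (x + t • z) z| := by
        rw [lintegral_lintegral_swap]
        refine Measurable.aemeasurable ?_
        have : Continuous fun p : Euc N × ℝ => |fderiv ℝ f (p.1 + p.2 • z) z| :=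
          (cf.comp (continuous_fst.add (continuous_snd.smul continuous_const))).abs
        exact this.measurable.ennreal_ofReal
    _ = ∫⁻ t in Icc (0 : ℝ) 1, ∫⁻ x, ENNReal.ofReal |fderiv ℝ f x z| := by
        refine lintegral_congr fun t => ?_
        exact lintegral_add_right_eq_self (fun x => ENNReal.ofReal |fderiv ℝ f x z|) (t • z)
    _ = _ := by simp

def DD {N : ℕ} (g : Euc N → ℝ) (z : Euc N) : ℝ≥0∞ := ∫⁻ x, ENNReal.ofReal |g x - g (x + z)|

lemma DD_approx {N : ℕ} {f g : Euc N → ℝ} (hf : Integrable f) (hg : Integrable g) (cg : Measurable g) (cf : Measurable f) {ε : ℝ} (hε : 0 ≤ ε)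
    (h : ∫ x, |f x - g x| ≤ ε) (z : Euc N) : DD g z ≤ DD f z + ENNReal.ofReal (2 * ε) := by
  have h1 : ∫⁻ x, ENNReal.ofReal |f x - g x| ≤ ENNReal.ofReal ε := by
    have ii : Integrable (fun x => |f x - g x|) := (hf.sub hg).abs
    rw [← ofReal_integral_eq_lintegral_ofReal ii (Eventually.of_forall fun x => abs_nonneg _)]
    exact ENNReal.ofReal_le_ofReal h
  have m1 : Measurable fun x => ENNReal.ofReal |f x - g x| := (cf.sub cg).abs.ennreal_ofReal
  have m2 : Measurable fun x => ENNReal.ofReal |f x - f (x + z)| :=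
    (cf.sub (cf.comp (measurable_id.add_const z))).abs.ennreal_ofReal
  calc DD g z ≤ ∫⁻ x, (ENNReal.ofReal |f x - f (x + z)| + (ENNReal.ofReal |f x - g x| + ENNReal.ofReal |f (x + z) - g (x + z)|)) := by
        refine lintegral_mono fun x => ?_
        simp only
        rw [← ENNReal.ofReal_add (abs_nonneg _) (abs_nonneg _), ← ENNReal.ofReal_add (abs_nonneg _) (by positivity)]
        apply ENNReal.ofReal_le_ofReal
        have e : g x - g (x + z) = (f x - f (x + z)) + (-(f x - g x) + (f (x + z) - g (x + z))) := by ring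
        rw [e]
        refine (abs_add_le _ _).trans ?_
        have := abs_add_le (-(f x - g x)) (f (x + z) - g (x + z))
        rw [abs_neg] at this
        linarith
    _ = DD f z + ((∫⁻ x, ENNReal.ofReal |f x - g x|) + ∫⁻ x, ENNReal.ofReal |f (x + z) - g (x + z)|) := by
        rw [lintegral_add_left m2, lintegral_add_left m1]; rfl
    _ ≤ _ := by
        rw [lintegral_add_right_eq_self (fun x => ENNReal.ofReal |f x - g x|) z, two_mul, ENNReal.ofReal_add hε hε]
        gcongr

lemma DD_chi {N : ℕ} {F : Set (Euc N)} (hF : MeasurableSet F) {m : ℝ} (hm : 0 ≤ m) (hv : volume F = ENNReal.ofReal m) (z : Euc N) :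
    DD (chi F) z ≤ ENNReal.ofReal (2 * m) := by
  have ci := chi_int hF (by rw [hv]; simp)
  have h := DD_approx (f := fun _ => 0) (g := chi F) (integrable_zero _ _ _) ci (measurable_one.indicator hF) measurable_const hm ?_ z
  · simpa [DD] using h
  · have : ∀ x, |0 - chi F x| = chi F x := fun x => by rw [zero_sub, abs_neg, abs_of_nonneg (chi_nn F x)]
    simp only [this]
    rw [chi_integral hF, hv, ENNReal.toReal_ofReal hm]

lemma PK_DD {N : ℕ} {K : Euc N → ℝ} (hK : Measurable K) (K0 : ∀ x, 0 ≤ K x) (Km : ∀ x y : Euc N, ‖x‖ ≤ ‖y‖ → K y ≤ K x)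
    {F : Set (Euc N)} (hF : MeasurableSet F) :
    ENNReal.ofReal (PK K F) ≤ ∫⁻ z, ENNReal.ofReal (K z) * DD (chi F) z := by
  have Ks : ∀ x, K (-x) = K x := fun x => le_antisymm (Km _ _ (by simp)) (Km _ _ (by simp))
  have cm : Measurable (chi F) := measurable_one.indicator hF
  have h1 : ENNReal.ofReal (PK K F) ≤ ∫⁻ x, ∫⁻ y, ENNReal.ofReal (K (x - y)) * ENNReal.ofReal |chi F x - chi F y| := by
    refine (Real.ofReal_le_enorm _).trans ?_
    unfold PK
    refine (enorm_integral_le_lintegral_enorm _).trans (lintegral_mono fun x => ?_)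
    refine (enorm_integral_le_lintegral_enorm _).trans (lintegral_mono fun y => ?_)
    simp only
    rw [← ENNReal.ofReal_mul (K0 _), Real.enorm_eq_ofReal (mul_nonneg (K0 _) (abs_nonneg _))]
  refine h1.trans (le_of_eq ?_)
  have h2 : ∀ x, ∫⁻ y, ENNReal.ofReal (K (x - y)) * ENNReal.ofReal |chi F x - chi F y| =
      ∫⁻ z, ENNReal.ofReal (K z) * ENNReal.ofReal |chi F x - chi F (x + z)| := by
    intro x
    rw [← lintegral_add_left_eq_self (fun y => ENNReal.ofReal (K (x - y)) * ENNReal.ofReal |chi F x - chi F y|) x]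
    refine lintegral_congr fun z => ?_
    rw [sub_add_cancel_left, Ks]
  simp only [h2]
  rw [lintegral_lintegral_swap]
  · refine lintegral_congr fun z => ?_
    unfold DD
    have mz : Measurable fun x => ENNReal.ofReal |chi F x - chi F (x + z)| :=
      (cm.sub (cm.comp (measurable_id.add_const z))).abs.ennreal_ofReal
    rw [lintegral_const_mul _ mz]
  · refine Measurable.aemeasurable ?_
    have : Measurable fun p : Euc N × Euc N => chi F p.1 - chi F (p.1 + p.2) :=
      (cm.comp measurable_fst).sub (cm.comp (measurable_fst.add measurable_snd))
    exact ((hK.comp measurable_snd).ennreal_ofReal).mul this.abs.ennreal_ofReal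

lemma PK_eps {N : ℕ} (hN : 1 ≤ N) {s R : ℝ} (hs0 : 0 < s) (hs1 : s < 1) (hR : 0 < R) {K : Euc N → ℝ} (hK : Measurable K) (K0 : ∀ x, 0 ≤ K x)
    (Kb : ∀ x : Euc N, x ≠ 0 → K x ≤ ‖x‖ ^ (-((N : ℝ) + s))) (Km : ∀ x y : Euc N, ‖x‖ ≤ ‖y‖ → K y ≤ K x)
    {F : Set (Euc N)} (hF : MeasurableSet F) {m : ℝ} (hm : 0 ≤ m) (hv : volume F = ENNReal.ofReal m) (hP : HasFinitePerim F)
    {ε : ℝ} (hε : 0 < ε) :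
    PK K F ≤ (perim F + ε) * (1 / √N * (N * ballVol N * (R ^ (1 - s) / (1 - s)))) + K 0 * (2 * ε) * (R ^ N * ballVol N)
      + N * ballVol N * (R ^ (-s) / s) * (2 * m) := by
  have hvt : volume F ≠ ⊤ := by rw [hv]; simp
  have hω := ballVol_pos N
  have P0 := perim_nn hP
  have ci := chi_int hF hvt
  have cm : Measurable (chi F) := measurable_one.indicator hF
  obtain ⟨f, hf, hf1, hf2⟩ := approx hF hvt hP hε
  have cf := hf.c1.continuous
  set κ1 : Euc N → ℝ≥0∞ := fun z => ENNReal.ofReal ((Iio R).indicator (fun t => t ^ (-((N : ℝ) + s))) ‖z‖) with hκ1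
  set κ2 : Euc N → ℝ≥0∞ := fun z => ENNReal.ofReal ((Ici R).indicator (fun t => t ^ (-((N : ℝ) + s))) ‖z‖) with hκ2
  have mk : Measurable fun t : ℝ => t ^ (-((N : ℝ) + s)) := by fun_prop
  have m1 : Measurable κ1 := ((mk.indicator measurableSet_Iio).comp measurable_norm).ennreal_ofReal
  have m2 : Measurable κ2 := ((mk.indicator measurableSet_Ici).comp measurable_norm).ennreal_ofReal
  have mD : Measurable (DD f) := by
    have : Measurable (Function.uncurry fun (z x : Euc N) => ENNReal.ofReal |f x - f (x + z)|) := by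
      have : Continuous fun p : Euc N × Euc N => |f p.2 - f (p.2 + p.1)| :=
        ((cf.comp continuous_snd).sub (cf.comp (continuous_snd.add continuous_fst))).abs
      exact this.measurable.ennreal_ofReal
    exact this.lintegral_prod_right
  have mE : Measurable ((ball (0 : Euc N) R).indicator fun _ => ENNReal.ofReal (K 0 * (2 * ε))) :=
    measurable_const.indicator measurableSet_ball
  have pt : ∀ z, ENNReal.ofReal (K z) * DD (chi F) z ≤ κ1 z * DD f z +
      (ball (0 : Euc N) R).indicator (fun _ => ENNReal.ofReal (K 0 * (2 * ε))) z + κ2 z * ENNReal.ofReal (2 * m) := by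
    intro z
    rcases eq_or_ne z 0 with rfl | hz
    · have : DD (chi F) 0 = 0 := by simp [DD]
      rw [this, mul_zero]; exact zero_le
    rcases lt_or_ge ‖z‖ R with h | h
    · have e1 : ENNReal.ofReal (K z) ≤ κ1 z := by
        rw [hκ1]; simp only
        rw [indicator_of_mem (by exact h)]
        exact ENNReal.ofReal_le_ofReal (Kb z hz)
      have e2 : (ball (0 : Euc N) R).indicator (fun _ => ENNReal.ofReal (K 0 * (2 * ε))) z = ENNReal.ofReal (K 0) * ENNReal.ofReal (2 * ε) := by
        rw [indicator_of_mem (by rwa [mem_ball_zero_iff]), ENNReal.ofReal_mul (K0 0)]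
      have e3 : ENNReal.ofReal (K z) ≤ ENNReal.ofReal (K 0) := ENNReal.ofReal_le_ofReal (Km _ _ (by simp))
      rw [e2]
      refine le_trans ?_ le_self_add
      calc _ ≤ ENNReal.ofReal (K z) * (DD f z + ENNReal.ofReal (2 * ε)) := by
            gcongr
            exact DD_approx hf.int ci cm cf.measurable hε.le hf1 z
        _ ≤ _ := by
            rw [mul_add]
            gcongr
    · have e1 : ENNReal.ofReal (K z) ≤ κ2 z := by
        rw [hκ2]; simp only
        rw [indicator_of_mem (by exact h)]
        exact ENNReal.ofReal_le_ofReal (Kb z hz)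
      refine le_trans ?_ le_add_self
      gcongr
      exact DD_chi hF hm hv z
  have near : ∫⁻ z, κ1 z * DD f z ≤ ENNReal.ofReal (perim F + ε) * (ENNReal.ofReal (1 / √N) * ENNReal.ofReal (N * ballVol N * (R ^ (1 - s) / (1 - s)))) := by
    have cf2 : Continuous fun p : Euc N × Euc N => fderiv ℝ f p.2 p.1 :=
      ((hf.c1.continuous_fderiv (by simp)).comp continuous_snd).clm_apply continuous_fst
    calc ∫⁻ z, κ1 z * DD f z ≤ ∫⁻ z, ∫⁻ x, κ1 z * ENNReal.ofReal |fderiv ℝ f x z| := by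
          refine lintegral_mono fun z => ?_
          simp only
          rw [lintegral_const_mul]
          · gcongr
            exact diff_le hf z
          · have : Continuous fun x => fderiv ℝ f x z := (hf.c1.continuous_fderiv (by simp)).clm_apply continuous_const
            exact this.abs.measurable.ennreal_ofReal
      _ = ∫⁻ x, ∫⁻ z, κ1 z * ENNReal.ofReal |fderiv ℝ f x z| := by
          rw [lintegral_lintegral_swap]
          exact ((m1.comp measurable_fst).mul cf2.abs.measurable.ennreal_ofReal).aemeasurable
      _ ≤ ∫⁻ x, ENNReal.ofReal (kg f x) * (ENNReal.ofReal (1 / √N) * ENNReal.ofReal (N * ballVol N * (R ^ (1 - s) / (1 - s)))) := by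
          refine lintegral_mono fun x => ?_
          have := avg hN m1 (fun x y h => by simp only [hκ1, h]) (fderiv ℝ f x)
          rwa [near_int hN hs1 hR] at this
      _ = (∫⁻ x, ENNReal.ofReal (kg f x)) * (ENNReal.ofReal (1 / √N) * ENNReal.ofReal (N * ballVol N * (R ^ (1 - s) / (1 - s)))) := by
          rw [lintegral_mul_const _ (kg_cont hf).measurable.ennreal_ofReal]
      _ ≤ _ := by
          gcongr
          rw [← ofReal_integral_eq_lintegral_ofReal hf.kg_int (Eventually.of_forall (kg_nonneg f))]
          exact ENNReal.ofReal_le_ofReal hf2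
  have mA : Measurable fun z => κ1 z * DD f z := m1.mul mD
  have mB : Measurable fun z => κ1 z * DD f z + (ball (0 : Euc N) R).indicator (fun _ => ENNReal.ofReal (K 0 * (2 * ε))) z :=
    mA.add mE
  have tot := (PK_DD hK K0 Km hF).trans (lintegral_mono pt)
  rw [lintegral_add_left mB, lintegral_add_left mA, lintegral_mul_const _ m2, far_int hN hs0 hR,
    lintegral_indicator measurableSet_ball, setLIntegral_const] at tot
  have q1 : 0 < 1 - s := by linarith
  have hvb : volume (ball (0 : Euc N) R) = ENNReal.ofReal (R ^ N * ballVol N) := by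
    rw [← vol_ball (0 : Euc N) hR, ENNReal.ofReal_toReal measure_ball_lt_top.ne]
  have kk := K0 0
  have tot2 := tot.trans (add_le_add (add_le_add near le_rfl) le_rfl)
  rw [hvb, ← ENNReal.ofReal_mul (by positivity), ← ENNReal.ofReal_mul (by positivity), ← ENNReal.ofReal_mul (by positivity),
    ← ENNReal.ofReal_mul (by positivity), ← ENNReal.ofReal_add (by positivity) (by positivity),
    ← ENNReal.ofReal_add (by positivity) (by positivity)] at tot2
  exact (ENNReal.ofReal_le_ofReal_iff (by positivity)).1 tot2

lemma PK_le {N : ℕ} (hN : 1 ≤ N) {s R : ℝ} (hs0 : 0 < s) (hs1 : s < 1) (hR : 0 < R) {K : Euc N → ℝ} (hK : Measurable K) (K0 : ∀ x, 0 ≤ K x)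
    (Kb : ∀ x : Euc N, x ≠ 0 → K x ≤ ‖x‖ ^ (-((N : ℝ) + s))) (Km : ∀ x y : Euc N, ‖x‖ ≤ ‖y‖ → K y ≤ K x)
    {F : Set (Euc N)} (hF : MeasurableSet F) {m : ℝ} (hm : 0 ≤ m) (hv : volume F = ENNReal.ofReal m) (hP : HasFinitePerim F) :
    PK K F ≤ N * ballVol N * (perim F / √N * (R ^ (1 - s) / (1 - s)) + R ^ (-s) / s * (2 * m)) := by
  have l2 : Tendsto (fun ε : ℝ => (perim F + ε) * (1 / √N * (N * ballVol N * (R ^ (1 - s) / (1 - s)))) + K 0 * (2 * ε) * (R ^ N * ballVol N)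
      + N * ballVol N * (R ^ (-s) / s) * (2 * m)) (nhdsWithin 0 (Ioi 0))
      (nhds ((perim F + 0) * (1 / √N * (N * ballVol N * (R ^ (1 - s) / (1 - s)))) + K 0 * (2 * 0) * (R ^ N * ballVol N)
      + N * ballVol N * (R ^ (-s) / s) * (2 * m))) := by
    refine Tendsto.mono_left (Continuous.tendsto ?_ _) nhdsWithin_le_nhds
    fun_prop
  have := ge_of_tendsto l2 (eventually_mem_nhdsWithin.mono fun ε hε => PK_eps hN hs0 hs1 hR hK K0 Kb Km hF hm hv hP hε)
  refine this.trans (le_of_eq ?_)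
  ring

lemma core_real {s M g P PB b c : ℝ} (hs0 : 0 < s) (hs1 : s < 1) (hM : 0 < M) (hg : 0 < g) (hP : 0 < P) (hb : 0 < b)
    (hc : 0 < c) (hc1 : c ≤ 3 / 4) (hPB : PB = b * M) (h : P ≤ PB + g * (2 * M) ^ (1 - s) * (c * P) ^ s) :
    P ≤ 4 * (b + 2) * (1 + g ^ ((1 : ℝ) / (1 - s))) * M ∧
    P - PB ≤ 2 * g * (4 * (b + 2)) * (1 + g ^ ((1 : ℝ) / (1 - s))) ^ s * M := by
  set a := g ^ ((1 : ℝ) / (1 - s)) with ha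
  have q : 0 < 1 - s := by linarith
  have a0 : 0 < a := by positivity
  have ea : g = a ^ (1 - s) := by
    rw [ha, ← Real.rpow_mul hg.le, one_div_mul_cancel q.ne', Real.rpow_one]
  have h1 : P ≤ 4 * (b + 2) * (1 + a) * M := by
    have e : g * (2 * M) ^ (1 - s) * (c * P) ^ s = (a * (2 * M)) ^ (1 - s) * (c * P) ^ s := by
      rw [Real.mul_rpow a0.le (by positivity), ← ea]
    have y := Real.geom_mean_le_arith_mean2_weighted q.le hs0.le (p₁ := a * (2 * M)) (p₂ := c * P) (by positivity) (by positivity) (by ring)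
    rw [e] at h
    have z1 : s * (c * P) ≤ 3 / 4 * P := by
      have : s * c ≤ 3 / 4 := by nlinarith
      nlinarith
    have z2 : (1 - s) * (a * (2 * M)) ≤ a * (2 * M) := mul_le_of_le_one_left (by positivity) (by linarith)
    have z3 : P ≤ 4 * (b * M + 2 * a * M) := by linarith
    have z4 : 0 < a * M := by positivity
    have z5 : 0 < b * (a * M) := by positivity
    nlinarith
  refine ⟨h1, ?_⟩
  have k1 : (2 * M) ^ (1 - s) * (c * P) ^ s ≤ 2 * (4 * (b + 2)) * (1 + a) ^ s * M := by
    have cP : c * P ≤ 4 * (b + 2) * (1 + a) * M := by nlinarith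
    calc (2 * M) ^ (1 - s) * (c * P) ^ s ≤ (2 * M) ^ (1 - s) * (4 * (b + 2) * (1 + a) * M) ^ s := by gcongr
      _ = 2 ^ (1 - s) * (4 * (b + 2)) ^ s * (1 + a) ^ s * (M ^ (1 - s) * M ^ s) := by
          rw [Real.mul_rpow (by norm_num) hM.le, Real.mul_rpow (by positivity) hM.le, Real.mul_rpow (by positivity) (by positivity)]
          ring
      _ = 2 ^ (1 - s) * (4 * (b + 2)) ^ s * (1 + a) ^ s * M := by
          rw [← Real.rpow_add hM, sub_add_cancel, Real.rpow_one]
      _ ≤ 2 ^ (1 : ℝ) * (4 * (b + 2)) ^ (1 : ℝ) * (1 + a) ^ s * M := by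
          have : (1 : ℝ) ≤ 4 * (b + 2) := by linarith
          have r1 : (2 : ℝ) ^ (1 - s) ≤ 2 ^ (1 : ℝ) := Real.rpow_le_rpow_of_exponent_le (by norm_num) (by linarith)
          have r2 : (4 * (b + 2)) ^ s ≤ (4 * (b + 2)) ^ (1 : ℝ) := Real.rpow_le_rpow_of_exponent_le this hs1.le
          gcongr
      _ = _ := by rw [Real.rpow_one, Real.rpow_one]
  have := mul_le_mul_of_nonneg_left k1 hg.le
  linarith

lemma R_opt {X Y s : ℝ} (hX : 0 < X) (hY : 0 < Y) : Y * (X / Y) ^ (1 - s) = X ^ (1 - s) * Y ^ s ∧ (X / Y) ^ (-s) * X = X ^ (1 - s) * Y ^ s := by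
  constructor
  · rw [Real.div_rpow hX.le hY.le, Real.rpow_sub hY, Real.rpow_one]
    have : 0 < Y ^ s := by positivity
    field_simp
  · rw [Real.div_rpow hX.le hY.le, Real.rpow_neg hY.le, Real.rpow_sub hX, Real.rpow_neg hX.le, Real.rpow_one]
    have : 0 < Y ^ s := by positivity
    have : 0 < X ^ s := by positivity
    field_simp

/-- constant in the perimeter of balls -/
def cB (N : ℕ) : ℝ := N * ballVol N ^ ((1 : ℝ) / N)

lemma cB_pos {N : ℕ} (hN : 1 ≤ N) : 0 < cB N := by
  have := ballVol_pos N
  unfold cB; positivity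

lemma ball_perim_m {N : ℕ} (hN : 1 ≤ N) {r m : ℝ} (hr : 0 < r) (hm : 0 < m) (hv : volume (ball (0 : Euc N) r) = ENNReal.ofReal m) :
    m = r ^ N * ballVol N ∧ perim (ball (0 : Euc N) r) = cB N * m ^ (((N : ℝ) - 1) / N) := by
  have hω := ballVol_pos N
  have e : m = r ^ N * ballVol N := by rw [← vol_ball (0 : Euc N) hr, hv, ENNReal.toReal_ofReal hm.le]
  refine ⟨e, ?_⟩
  rw [(ball_perim hN hr).2, ← e]
  have hN0 : (0 : ℝ) < N := by exact_mod_cast hN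
  have e2 : m ^ ((1 : ℝ) / N) = r * ballVol N ^ ((1 : ℝ) / N) := by
    rw [e, Real.mul_rpow (by positivity) hω.le, ← Real.rpow_natCast r N, ← Real.rpow_mul hr.le,
      mul_one_div_cancel (by positivity), Real.rpow_one]
  rw [sub_div, div_self hN0.ne', Real.rpow_sub hm, Real.rpow_one, e2]
  unfold cB
  have : 0 < ballVol N ^ ((1 : ℝ) / N) := by positivity
  field_simp

lemma PK_nn {N : ℕ} {K : Euc N → ℝ} (K0 : ∀ x, 0 ≤ K x) (F : Set (Euc N)) : 0 ≤ PK K F :=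
  integral_nonneg fun _ => integral_nonneg fun _ => mul_nonneg (K0 _) (abs_nonneg _)

lemma part12 {N : ℕ} (hN : 2 ≤ N) {s : ℝ} (hs0 : 0 < s) (hs1 : s < 1) {K : Euc N → ℝ} (hK : Measurable K) (K0 : ∀ x, 0 ≤ K x)
    (Kb : ∀ x : Euc N, x ≠ 0 → K x ≤ ‖x‖ ^ (-((N : ℝ) + s))) (Km : ∀ x y : Euc N, ‖x‖ ≤ ‖y‖ → K y ≤ K x)
    {α m r γ : ℝ} (hα : 0 < α) (hm : 0 < m) (hr : 0 < r) (hvb : volume (ball (0 : Euc N) r) = ENNReal.ofReal m)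
    (hγ : γ = α * m ^ ((1 - s) / N))
    {F : Set (Euc N)} (hF : MeasurableSet F) (hP : HasFinitePerim F) (hv : volume F = ENNReal.ofReal m)
    (hJ : Jen K s α F ≤ Jen K s α (ball (0 : Euc N) r)) :
    perim F ≤ 4 * (cB N + 2) * (1 + (N * ballVol N * γ) ^ ((1 : ℝ) / (1 - s))) * m ^ (((N : ℝ) - 1) / N) ∧
    perim F - perim (ball (0 : Euc N) r) ≤ 2 * (N * ballVol N * γ) * (4 * (cB N + 2)) *
      (1 + (N * ballVol N * γ) ^ ((1 : ℝ) / (1 - s))) ^ s * m ^ (((N : ℝ) - 1) / N) := by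
  have hN1 : 1 ≤ N := by omega
  have hN0 : (2 : ℝ) ≤ N := by exact_mod_cast hN
  have hN00 : (0 : ℝ) < N := by linarith
  have hω := ballVol_pos N
  obtain ⟨em, eP⟩ := ball_perim_m hN1 hr hm hvb
  have hγ0 : 0 < γ := by rw [hγ]; positivity
  set M := m ^ (((N : ℝ) - 1) / N) with hM
  have M0 : 0 < M := by positivity
  have hPp : 0 < perim F := by
    have h := iso hN1 hF (by rw [hv]; simp) hP
    rw [hv, ENNReal.toReal_ofReal hm.le] at h
    have h1 : 0 < (N : ℝ) * ballVol N ^ ((1 : ℝ) / N) * m := by positivity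
    exact pos_of_mul_pos_right (h1.trans_le h) (by positivity)
  set c : ℝ := 1 / √N with hc
  have sN : (4 / 3 : ℝ) ≤ √N := Real.le_sqrt_of_sq_le (by norm_num; linarith)
  have c0 : 0 < c := by positivity
  have c1 : c ≤ 3 / 4 := by
    rw [hc, div_le_iff₀ (by linarith)]; linarith
  have q : 0 < 1 - s := by linarith
  have hX : 0 < 2 * m := by linarith
  have hY : 0 < c * perim F := by positivity
  have pk := PK_le hN1 hs0 hs1 (div_pos hX hY) hK K0 Kb Km hF hm.le hv hP
  obtain ⟨o1, o2⟩ := R_opt (s := s) hX hY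
  have pk2 : s * (1 - s) * PK K F ≤ N * ballVol N * ((2 * m) ^ (1 - s) * (c * perim F) ^ s) := by
    have := mul_le_mul_of_nonneg_left pk (mul_nonneg hs0.le q.le)
    refine this.trans (le_of_eq ?_)
    have e : s * (1 - s) * (N * ballVol N * (perim F / √N * ((2 * m / (c * perim F)) ^ (1 - s) / (1 - s)) + (2 * m / (c * perim F)) ^ (-s) / s * (2 * m)))
        = N * ballVol N * (s * (c * perim F * (2 * m / (c * perim F)) ^ (1 - s)) + (1 - s) * ((2 * m / (c * perim F)) ^ (-s) * (2 * m))) := by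
      generalize (2 * m / (c * perim F)) ^ (1 - s) = u
      generalize (2 * m / (c * perim F)) ^ (-s) = v
      rw [hc]
      field_simp
    rw [e, o1, o2]; ring
  have hJ2 : perim F ≤ perim (ball (0 : Euc N) r) + α * (s * (1 - s) * PK K F) := by
    unfold Jen at hJ
    have h1 : 0 ≤ α * s * (1 - s) * PK K (ball (0 : Euc N) r) :=
      mul_nonneg (mul_nonneg (mul_nonneg hα.le hs0.le) q.le) (PK_nn K0 _)
    linarith
  have eX : α * (2 * m) ^ (1 - s) = γ * (2 * M) ^ (1 - s) := by
    have : m = M * m ^ ((1 : ℝ) / N) := by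
      rw [hM, ← Real.rpow_add hm, ← add_div, sub_add_cancel, div_self hN00.ne', Real.rpow_one]
    conv_lhs => rw [this, ← mul_assoc, Real.mul_rpow (by positivity) (by positivity), ← Real.rpow_mul hm.le, one_div_mul_eq_div]
    rw [hγ]; ring
  have main : perim F ≤ perim (ball (0 : Euc N) r) + (N * ballVol N * γ) * (2 * M) ^ (1 - s) * (c * perim F) ^ s := by
    refine hJ2.trans ?_
    have := mul_le_mul_of_nonneg_left pk2 hα.le
    have e : α * (N * ballVol N * ((2 * m) ^ (1 - s) * (c * perim F) ^ s)) = (N * ballVol N) * (α * (2 * m) ^ (1 - s)) * (c * perim F) ^ s := by ring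
    rw [e, eX] at this
    linarith
  exact core_real hs0 hs1 M0 (by positivity) hPp (cB_pos hN1) c0 c1 eP main

lemma ev_small (c : ℝ) {d : ℝ} (hd : 0 < d) : ∀ᶠ η in nhdsWithin (0 : ℝ) (Ioi 0), c * η ≤ d := by
  have h : Tendsto (fun η : ℝ => c * η) (nhds 0) (nhds (c * 0)) := (continuous_const.mul continuous_id).tendsto 0
  rw [mul_zero] at h
  exact (h.mono_left nhdsWithin_le_nhds).eventually_le_const hd

set_option maxHeartbeats 1000000 in
lemma QS (n : ℕ) (hn : 1 ≤ n) {F : Set (Euc (n + 1))} (hF : MeasurableSet F) (hv : volume F ≠ ⊤) (hP : HasFinitePerim F)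
    {r δ : ℝ} (hr : 0 < r) (hδ0 : 0 < δ) (hδ1 : δ ≤ 1) (hδ : δ / cc1 n ≤ ballVol (n + 1) / 2)
    (hV : (volume F).toReal = r ^ (n + 1) * ballVol (n + 1))
    (hp : perim F ≤ r ^ n * ((n + 1) * ballVol (n + 1) + δ / 2)) :
    ∃ b : Euc (n + 1), (volume (F \ closedBall b r)).toReal ≤ r ^ (n + 1) * ((2 * CI n + 1) * √δ) := by
  have hω := ballVol_pos (n + 1)
  set ω := ballVol (n + 1) with hω'
  have hsq : 0 < √δ := Real.sqrt_pos.2 hδ0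
  obtain ⟨η, ⟨⟨⟨⟨⟨e1, e2⟩, e3⟩, e4⟩, e5⟩, η0⟩⟩ := (((((ev_small 4 hω).and (ev_small r (half_pos hδ0))).and
    (ev_small (12 * (n + 1)) hδ0)).and (ev_small (n * (δ / ballVol n) ^ (-(1 / (n : ℝ))) * 6) hδ0)).and
    (ev_small 1 hsq) |>.and self_mem_nhdsWithin).exists
  have η0 : 0 < η := η0
  have hrN : 0 < r ^ (n + 1) := by positivity
  obtain ⟨f, tf, f1, f2⟩ := approx hF hv hP (mul_pos hrN η0)
  have ci := chi_int hF hv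
  have fi := tf.int
  have di : Integrable fun x => |f x - chi F x| := (fi.sub ci).abs
  set θ := 1 - 2 * η / ω with hθ
  have hηω : η / ω ≤ 1 / 4 := by rw [div_le_div_iff₀ hω (by norm_num)]; linarith
  have hηω0 : 0 < η / ω := by positivity
  have hθ' : θ = 1 - 2 * (η / ω) := by rw [hθ]; ring
  have hθ1 : 1 / 2 ≤ θ := by linarith
  have hθ2 : θ ≤ 1 := by linarith
  have hηω1 : η / ω * ω = η := by field_simp
  let g : Euc (n + 1) → ℝ := fun y => θ * f (r • y)
  have c1 : ContDiff ℝ 1 (fun y => f (r • y)) := tf.c1.comp (contDiff_const_smul r)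
  have tg : TF g := by
    refine ⟨contDiff_const.mul c1, ?_, fun x => mul_nonneg (by linarith) (tf.nn _), fun x => ?_⟩
    · exact (tf.cs.comp_homeomorph (Homeomorph.smulOfNeZero r hr.ne')).mul_left
    · have := tf.le (r • x); have := tf.nn (r • x); change θ * f (r • x) ≤ 1; nlinarith
  have sc : ∀ h : Euc (n + 1) → ℝ, r ^ (n + 1) * ∫ y, h (r • y) = ∫ y, h y := by
    intro h
    rw [Measure.integral_comp_smul]
    simp only [finrank_euclideanSpace, Fintype.card_fin, smul_eq_mul]
    rw [abs_of_pos (by positivity)]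
    field_simp
  have If : ∫ x, f x ≤ r ^ (n + 1) * ω + r ^ (n + 1) * η := by
    have : ∫ x, f x ≤ ∫ x, (chi F x + |f x - chi F x|) :=
      integral_mono fi (ci.add di) fun x => by have := le_abs_self (f x - chi F x); simp only; linarith
    rw [integral_add ci di, chi_integral hF, hV] at this
    linarith
  have If2 : r ^ (n + 1) * ω - 2 * (r ^ (n + 1) * η) ≤ ∫ x, f x ^ 2 := by
    have : ∫ x, (chi F x - 2 * |f x - chi F x|) ≤ ∫ x, f x ^ 2 := by
      refine integral_mono (ci.sub (di.const_mul 2)) tf.sq_int fun x => ?_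
      have h0 := tf.nn x
      have h1 := tf.le x
      simp only
      by_cases hx : x ∈ F
      · have : chi F x = 1 := by simp [chi, hx]
        rw [this, abs_sub_comm, abs_of_nonneg (by linarith)]; nlinarith
      · have : chi F x = 0 := by simp [chi, hx]
        rw [this, sub_zero, abs_of_nonneg h0]; nlinarith
    rw [integral_sub ci (di.const_mul 2), integral_const_mul, chi_integral hF, hV] at this
    linarith
  have h1 : ∫ x, g x < ω := by
    have e : ∫ x, g x = θ * ∫ y, f (r • y) := integral_const_mul _ _
    have : ∫ y, f (r • y) ≤ ω + η := by
      refine le_of_mul_le_mul_left ?_ hrN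
      rw [sc f]; linarith
    rw [e]
    have := mul_le_mul_of_nonneg_left this (by linarith : 0 ≤ θ)
    nlinarith
  have h2 : ω - 6 * η ≤ ∫ x, g x ^ 2 := by
    have e : ∫ x, g x ^ 2 = θ ^ 2 * ∫ y, f (r • y) ^ 2 := by
      rw [← integral_const_mul]; congr 1; ext y; simp only [g]; ring
    have : ω - 2 * η ≤ ∫ y, f (r • y) ^ 2 := by
      refine le_of_mul_le_mul_left ?_ hrN
      rw [sc fun y => f y ^ 2]; linarith
    rw [e]
    have h3 := mul_le_mul_of_nonneg_left this (sq_nonneg θ)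
    have h4 : 1 - 4 * (η / ω) ≤ θ ^ 2 := by rw [hθ']; nlinarith
    have h5 : (1 - 4 * (η / ω)) * (ω - 2 * η) ≤ θ ^ 2 * (ω - 2 * η) := mul_le_mul_of_nonneg_right h4 (by linarith)
    have h6 : (1 - 4 * (η / ω)) * (ω - 2 * η) = ω - 2 * η - 4 * (η / ω * ω) + 8 * (η / ω * η) := by ring
    have h7 : 0 < η / ω * η := by positivity
    rw [hηω1] at h6
    linarith
  have h3 : ∫ x, kg g x ≤ (n + 1) * ω + δ := by
    have k1 : ∀ x, kg g x ≤ r * kg f (r • x) := by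
      intro x
      have : kg g x = |θ| * (|r| * kg f (r • x)) := by
        rw [← kg_dil tf.c1]
        unfold kg
        rw [fderiv_const_mul (c1.differentiable (by simp) x), norm_smul, Real.norm_eq_abs]
      rw [this, abs_of_pos (by linarith), abs_of_pos hr]
      have := kg_nonneg f (r • x)
      nlinarith [mul_nonneg hr.le this]
    have ki : Integrable fun x => r * kg f (r • x) := ((integrable_comp_smul_iff volume (kg f) hr.ne').2 tf.kg_int).const_mul r
    refine (integral_mono tg.kg_int ki k1).trans ?_
    rw [integral_const_mul]
    have : r ^ (n + 1) * ∫ y, kg f (r • y) ≤ r ^ n * ((n + 1) * ω + δ / 2) + r ^ (n + 1) * η := by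
      rw [sc]; linarith
    have hrn : 0 < r ^ n := by positivity
    refine le_of_mul_le_mul_left ?_ hrn
    have : r ^ n * (r * η) ≤ r ^ n * (δ / 2) := by gcongr
    calc r ^ n * (r * ∫ y, kg f (r • y)) = r ^ (n + 1) * ∫ y, kg f (r • y) := by ring
      _ ≤ _ := by assumption
      _ = r ^ n * ((n + 1) * ω + δ / 2) + r ^ n * (r * η) := by ring
      _ ≤ _ := by linarith
  obtain ⟨b, hb⟩ := QI n hn tg δ (6 * η) hδ0 hδ1 hδ (by linarith) (by linarith) h1 h2 h3
  refine ⟨r • b, ?_⟩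
  set S : Set (Euc (n + 1)) := (closedBall (r • b) r)ᶜ with hS
  have hSm : MeasurableSet S := measurableSet_closedBall.compl
  have e6 : ∫ x in (closedBall b 1)ᶜ, g x = θ * ∫ y, S.indicator f (r • y) := by
    rw [← integral_indicator measurableSet_closedBall.compl, ← integral_const_mul]
    congr 1; ext y
    have : r • y ∈ S ↔ y ∈ (closedBall b 1)ᶜ := by
      simp only [hS, mem_compl_iff, mem_closedBall, dist_eq_norm, ← smul_sub, norm_smul, Real.norm_eq_abs, abs_of_pos hr]
      rw [mul_le_iff_le_one_right hr]
    by_cases hy : y ∈ (closedBall b 1)ᶜ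
    · rw [indicator_of_mem hy, indicator_of_mem (this.2 hy)]
    · rw [indicator_of_notMem hy, indicator_of_notMem (fun h => hy (this.1 h)), mul_zero]
  have X0 : 0 ≤ ∫ y, S.indicator f (r • y) :=
    integral_nonneg fun y => indicator_nonneg (fun x _ => tf.nn x) _
  have X1 : ∫ y, S.indicator f (r • y) ≤ 2 * CI n * √δ := by nlinarith
  have X2 : ∫ y, S.indicator f y ≤ r ^ (n + 1) * (2 * CI n * √δ) := by
    rw [← sc]; gcongr
  have X3 : (volume (F \ closedBall (r • b) r)).toReal ≤ ∫ y, (S.indicator f y + |f y - chi F y|) := by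
    rw [← chi_integral (hF.diff measurableSet_closedBall)]
    refine integral_mono (chi_int (hF.diff measurableSet_closedBall) (ne_top_of_le_ne_top hv (measure_mono diff_subset)))
      ((fi.indicator hSm).add di) fun x => ?_
    simp only
    have i0 : 0 ≤ S.indicator f x := indicator_nonneg (fun x _ => tf.nn x) _
    by_cases hx : x ∈ F \ closedBall (r • b) r
    · have a1 : chi (F \ closedBall (r • b) r) x = 1 := by unfold chi; rw [indicator_of_mem hx]; rfl
      have a2 : chi F x = 1 := by simp [chi, hx.1]
      have a3 : S.indicator f x = f x := indicator_of_mem hx.2 _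
      rw [a1, a2, a3]
      have := neg_abs_le (f x - 1); linarith
    · have a1 : chi (F \ closedBall (r • b) r) x = 0 := by unfold chi; rw [indicator_of_notMem hx]
      rw [a1]; positivity
  rw [integral_add (fi.indicator hSm) di] at X3
  have : r ^ (n + 1) * η ≤ r ^ (n + 1) * √δ := by gcongr; linarith
  linarith

lemma sd_trans {N : ℕ} {F : Set (Euc N)} (hF : MeasurableSet F) {r m : ℝ} (hr : 0 < r)
    (hvb : volume (ball (0 : Euc N) r) = ENNReal.ofReal m) (hv : volume F = ENNReal.ofReal m) (b : Euc N) :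
    (volume (((fun x => -b + x) '' F) ∆ ball (0 : Euc N) r)).toReal ≤ 2 * (volume (F \ closedBall b r)).toReal := by
  set A := (fun x => -b + x) '' F with hA
  have eA : A = (fun x => b + x) ⁻¹' F := by rw [hA, image_add_left, neg_neg]
  have mA : MeasurableSet A := by rw [eA]; exact hF.preimage (measurable_const_add b)
  have vA : volume A = ENNReal.ofReal m := by rw [eA, measure_preimage_add, hv]
  have h1 : volume (A \ ball 0 r) = volume (F \ closedBall b r) := by
    have : A \ ball 0 r = (fun x => b + x) ⁻¹' (F \ ball b r) := by
      rw [eA]; ext x; simp [dist_eq_norm]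
    rw [this, measure_preimage_add]
    have h0 : volume (sphere b r) = 0 := Measure.addHaar_sphere_of_ne_zero _ _ hr.ne'
    rw [← ball_union_sphere, ← diff_diff, measure_diff_null h0]
  have h2 : volume (ball 0 r \ A) = volume (A \ ball 0 r) := by
    have a1 := measure_diff_add_inter (μ := volume) A (measurableSet_ball (x := (0 : Euc N)) (ε := r))
    have a2 := measure_diff_add_inter (μ := volume) (ball (0 : Euc N) r) mA
    rw [inter_comm, hvb, ← vA, ← a1] at a2
    refine (ENNReal.add_left_inj ?_).1 a2
    exact ne_top_of_le_ne_top (vA ▸ ENNReal.ofReal_ne_top : volume A ≠ ⊤) (measure_mono inter_subset_left)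
  have fin : volume (F \ closedBall b r) ≠ ⊤ :=
    ne_top_of_le_ne_top (hv ▸ ENNReal.ofReal_ne_top : volume F ≠ ⊤) (measure_mono diff_subset)
  have h3 : volume (A ∆ ball (0 : Euc N) r) ≤ volume (F \ closedBall b r) + volume (F \ closedBall b r) := by
    rw [Set.symmDiff_def]
    refine (measure_union_le _ _).trans ?_
    rw [h2, h1]
  have := ENNReal.toReal_mono (ENNReal.add_ne_top.2 ⟨fin, fin⟩) h3
  rw [ENNReal.toReal_add fin fin] at this
  linarith

/-- deficit constant -/
def dfc (n : ℕ) : ℝ := 2 * ((n + 1) * ballVol (n + 1)) * (4 * (cB (n + 1) + 2)) * ((n + 1) * ballVol (n + 1) / cB (n + 1))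
lemma dfc_pos (n : ℕ) : 0 < dfc n := by
  have := ballVol_pos (n + 1)
  have := cB_pos (N := n + 1) (by omega)
  unfold dfc; positivity
/-- threshold -/
def d0 (n : ℕ) : ℝ := min 1 (ballVol (n + 1) / 2 * cc1 n)
lemma d0_pos (n : ℕ) : 0 < d0 n := by
  have := ballVol_pos (n + 1)
  have := cc1_pos n
  unfold d0; positivity
/-- constant for asymmetry -/
def C3 (n : ℕ) : ℝ := 2 * |2 * CI n + 1| * √(2 * dfc n) / ballVol (n + 1) + 2 / √(d0 n / (2 * dfc n))

lemma part3 (n : ℕ) (hn : 1 ≤ n) {F : Set (Euc (n + 1))} (hF : MeasurableSet F) (hP : HasFinitePerim F) {r m q : ℝ}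
    (hr : 0 < r) (hm : 0 < m) (hq : 0 < q) (hvb : volume (ball (0 : Euc (n + 1)) r) = ENNReal.ofReal m)
    (hv : volume F = ENNReal.ofReal m)
    (hp : perim F - perim (ball (0 : Euc (n + 1)) r) ≤ 2 * ((n + 1) * ballVol (n + 1)) * (4 * (cB (n + 1) + 2)) *
      (q * m ^ ((((n + 1 : ℕ) : ℝ) - 1) / ((n + 1 : ℕ) : ℝ)))) :
    ∃ v : Euc (n + 1), (volume (((fun x => v + x) '' F) ∆ ball (0 : Euc (n + 1)) r)).toReal ≤ C3 n * m * √q := by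
  have hω := ballVol_pos (n + 1)
  have hc := cB_pos (N := n + 1) (by omega)
  have hD := dfc_pos n
  have hd := d0_pos n
  have hcc := cc1_pos n
  obtain ⟨em, eP⟩ := ball_perim_m (N := n + 1) (by omega) hr hm hvb
  have eP2 := (ball_perim (N := n + 1) (by omega) hr).2
  have hsq := Real.sqrt_pos.2 hq
  rcases le_or_gt (2 * dfc n * q) (d0 n) with h | h
  · set M := m ^ ((((n + 1 : ℕ) : ℝ) - 1) / ((n + 1 : ℕ) : ℝ)) with hM
    have eP3 : perim (ball (0 : Euc (n + 1)) r) = r ^ n * ((n + 1) * ballVol (n + 1)) := by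
      rw [eP2]; push_cast; field_simp; ring
    have eM : M = r ^ n * ((n + 1) * ballVol (n + 1) / cB (n + 1)) := by
      rw [eP3] at eP; field_simp; linarith
    obtain ⟨b, hb⟩ := QS n hn hF (hv ▸ ENNReal.ofReal_ne_top) hP (δ := 2 * dfc n * q) hr (by positivity) (h.trans (min_le_left _ _))
      (by rw [div_le_iff₀ hcc]; exact h.trans (min_le_right _ _)) (by rw [hv, ENNReal.toReal_ofReal hm.le, em])
      (by
        rw [eM, eP3] at hp
        have : 2 * ((n + 1) * ballVol (n + 1)) * (4 * (cB (n + 1) + 2)) * (q * (r ^ n * ((n + 1) * ballVol (n + 1) / cB (n + 1))))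
          = r ^ n * (dfc n * q) := by unfold dfc; ring
        rw [this] at hp
        linarith)
    refine ⟨-b, (sd_trans hF hr hvb hv b).trans ?_⟩
    rw [Real.sqrt_mul (by positivity)] at hb
    have h1 : r ^ (n + 1) * ((2 * CI n + 1) * (√(2 * dfc n) * √q)) ≤ r ^ (n + 1) * (|2 * CI n + 1| * (√(2 * dfc n) * √q)) := by
      gcongr; exact le_abs_self _
    have h2 : r ^ (n + 1) = m / ballVol (n + 1) := by rw [em]; field_simp
    have h3 : 0 ≤ 2 / √(d0 n / (2 * dfc n)) * (m * √q) := by positivity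
    calc _ ≤ 2 * (r ^ (n + 1) * (|2 * CI n + 1| * (√(2 * dfc n) * √q))) := by linarith
      _ = 2 * |2 * CI n + 1| * √(2 * dfc n) / ballVol (n + 1) * (m * √q) := by rw [h2]; ring
      _ ≤ C3 n * m * √q := by unfold C3; linarith
  · refine ⟨-0, (sd_trans hF hr hvb hv 0).trans ?_⟩
    have h1 : (volume (F \ closedBall (0 : Euc (n + 1)) r)).toReal ≤ m := by
      have := ENNReal.toReal_mono (hv ▸ ENNReal.ofReal_ne_top : volume F ≠ ⊤) (measure_mono (diff_subset (s := F) (t := closedBall 0 r)))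
      rwa [hv, ENNReal.toReal_ofReal hm.le] at this
    have h2 : √(d0 n / (2 * dfc n)) ≤ √q := by
      apply Real.sqrt_le_sqrt; rw [div_le_iff₀ (by positivity)]; linarith
    have h3 : 0 < √(d0 n / (2 * dfc n)) := Real.sqrt_pos.2 (by positivity)
    have h4 : 0 ≤ 2 * |2 * CI n + 1| * √(2 * dfc n) / ballVol (n + 1) * (m * √q) := by positivity
    have h5 : 2 * m ≤ 2 / √(d0 n / (2 * dfc n)) * (m * √q) := by
      have : 1 ≤ √q / √(d0 n / (2 * dfc n)) := (one_le_div h3).2 h2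
      calc 2 * m = 2 * m * 1 := by ring
        _ ≤ 2 * m * (√q / √(d0 n / (2 * dfc n))) := by gcongr
        _ = _ := by ring
    calc _ ≤ 2 * m := by linarith
      _ ≤ C3 n * m * √q := by unfold C3; linarith

/-- a priori bounds for competitors with energy below that of the ball:
perimeter bound, isoperimetric-deficit bound, and closeness (up to translation) to the ball. -/
theorem stmt_12 (n : ℕ) (hn : 2 ≤ n) :
    ∃ C : ℝ, 0 < C ∧
      ∀ s : ℝ, s ∈ Set.Ioo (0 : ℝ) 1 →
      ∀ K : Euc n → ℝ, Measurable K → (∀ x, 0 ≤ K x) →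
        (∀ x : Euc n, x ≠ 0 → K x ≤ ‖x‖ ^ (-((n : ℝ) + s))) →
        (∀ x y : Euc n, ‖x‖ ≤ ‖y‖ → K y ≤ K x) →
      ∀ α m r₀ : ℝ, 0 < α → 0 < m → 0 < r₀ →
        volume (ball (0 : Euc n) r₀) = ENNReal.ofReal m →
      ∀ γ : ℝ, γ = α * m ^ ((1 - s) / n) →
      ∀ F : Set (Euc n), MeasurableSet F → HasFinitePerim F →
        volume F = ENNReal.ofReal m →
        Jen K s α F ≤ Jen K s α (ball (0 : Euc n) r₀) →
        -- (i) perimeter bound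
        (perim F ≤ C * (1 + (n * ballVol n * γ) ^ ((1 : ℝ) / (1 - s))) * m ^ (((n : ℝ) - 1) / n) ∧
        -- (ii) deficit bound
          (perim F - perim (ball (0 : Euc n) r₀)) / perim (ball (0 : Euc n) r₀) ≤
            C * γ * (1 + (n * ballVol n * γ) ^ ((1 : ℝ) / (1 - s))) ^ s ∧
        -- (iii) closeness of a translate of F to the ball
          ∃ v : Euc n,
            (volume (((fun x => v + x) '' F) ∆ ball (0 : Euc n) r₀)).toReal ≤
              C * m * Real.sqrt γ *
                (1 + (n * ballVol n * γ) ^ ((1 : ℝ) / (1 - s))) ^ (s / 2)) := by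
  obtain ⟨n, rfl⟩ : ∃ k, n = k + 1 := ⟨n - 1, by omega⟩
  have hω := ballVol_pos (n + 1)
  have hc := cB_pos (N := n + 1) (by omega)
  have h3 : 0 ≤ C3 n := by
    have := dfc_pos n
    have := d0_pos n
    unfold C3; positivity
  set Cb := 2 * ((n + 1) * ballVol (n + 1)) * (4 * (cB (n + 1) + 2)) with hCb
  have hCb0 : 0 < Cb := by positivity
  refine ⟨4 * (cB (n + 1) + 2) + Cb / cB (n + 1) + C3 n, by positivity, ?_⟩
  intro s hs K hK K0 Kb Km α m r hα hm hr hvb γ hγ F hF hP hv hJ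
  obtain ⟨p1, p2⟩ := part12 (N := n + 1) hn hs.1 hs.2 hK K0 Kb Km hα hm hr hvb hγ hF hP hv hJ
  obtain ⟨em, eP⟩ := ball_perim_m (N := n + 1) (by omega) hr hm hvb
  have hγ0 : 0 < γ := by rw [hγ]; positivity
  set A := 1 + (((n + 1 : ℕ) : ℝ) * ballVol (n + 1) * γ) ^ ((1 : ℝ) / (1 - s)) with hA
  have hA0 : 0 < A := by positivity
  set M := m ^ ((((n + 1 : ℕ) : ℝ) - 1) / ((n + 1 : ℕ) : ℝ)) with hM
  have hM0 : 0 < M := by positivity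
  have hAs : 0 < A ^ s := by positivity
  have p3 : perim F - perim (ball (0 : Euc (n + 1)) r) ≤ Cb * (γ * A ^ s * M) := by
    refine p2.trans (le_of_eq ?_); rw [hCb]; push_cast; ring
  refine ⟨p1.trans ?_, ?_, ?_⟩
  · gcongr
    have : 0 < Cb / cB (n + 1) := by positivity
    linarith
  · rw [eP] at p3 ⊢
    rw [div_le_iff₀ (by positivity)]
    refine p3.trans ?_
    calc Cb * (γ * A ^ s * M) = (Cb / cB (n + 1)) * γ * A ^ s * (cB (n + 1) * M) := by field_simp
      _ ≤ _ := by gcongr; linarith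
  · obtain ⟨v, hv'⟩ := part3 n (by omega) hF hP (q := γ * A ^ s) hr hm (by positivity) hvb hv p3
    refine ⟨v, hv'.trans ?_⟩
    have e : √(γ * A ^ s) = √γ * A ^ (s / 2) := by
      rw [Real.sqrt_mul hγ0.le, Real.sqrt_eq_rpow (A ^ s), ← Real.rpow_mul hA0.le]
      ring_nf
    rw [e, ← mul_assoc]
    gcongr
    have : 0 < Cb / cB (n + 1) := by positivity
    linarith
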